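/- Let M be an o-minimal structure, A ⊆ M, and let S be an A-definable family of subsets of M^k that has a finite tame transversal of size n, i.e., S can be covered by n subfamilies each of which extends to a definable type. Then S can be partitioned into n subfamilies S_1, …, S_n such that for every 1 ≤ i ≤ n the family S_i extends to an A-definable type. -/

import Mathlib

open FirstOrder Set

/-- `M` is an o-minimal `L`-structure: a densely linearly ordered structure without endpoints,
whose order is `∅`-definable, and in which every definable (with parameters) subset of `M`
is a finite union of points and open intervals with endpoints in `M ∪ {±∞}`. -/
def IsOMinimal (L : FirstOrder.Language) (M : Type*) [L.Structure M] [LinearOrder M] : Prop :=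
  Nonempty M ∧ DenselyOrdered M ∧ NoMinOrder M ∧ NoMaxOrder M ∧
  Set.Definable (∅ : Set M) L {v : Fin 2 → M | v 0 < v 1} ∧
  ∀ s : Set M, Set.Definable₁ (Set.univ : Set M) L s →
    ∃ F : Finset (Set M), s = ⋃₀ (F : Set (Set M)) ∧
      ∀ t ∈ F, (∃ a : M, t = {a}) ∨ (∃ a b : M, t = Set.Ioo a b) ∨
        (∃ a : M, t = Set.Ioi a) ∨ (∃ a : M, t = Set.Iio a) ∨ t = Set.univ

/-- The fiber over `u` of a set `D ⊆ M^{m+n}`, i.e. the set `φ(u, M^n)`. -/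
def famFiber {M : Type*} {m n : ℕ} (D : Set (Fin m ⊕ Fin n → M)) (u : Fin m → M) :
    Set (Fin n → M) :=
  {v | Sum.elim u v ∈ D}

/-- An `A`-definable family of subsets of `M^n`: the family of fibers `φ(u, M^n)` for `u`
ranging over an `A`-definable index set `Ω`, where `φ` is `A`-definable. -/
def IsDefFamily (L : FirstOrder.Language) {M : Type*} [L.Structure M] (A : Set M) (n : ℕ)
    (S : Set (Set (Fin n → M))) : Prop :=
  ∃ (m : ℕ) (Ω : Set (Fin m → M)) (D : Set (Fin m ⊕ Fin n → M)),
    Set.Definable A L Ω ∧ Set.Definable A L D ∧ S = famFiber D '' Ω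

/-- A family of sets is downward directed: it does not contain `∅` and any two members
contain a common member. -/
def DirectedFam {α : Type*} (S : Set (Set α)) : Prop :=
  ∅ ∉ S ∧ ∀ X ∈ S, ∀ Y ∈ S, ∃ Z ∈ S, Z ⊆ X ∩ Y

/-- `S` is finer than `F`: every member of `F` contains a member of `S`. -/
def FinerThan {α : Type*} (S F : Set (Set α)) : Prop :=
  ∀ X ∈ F, ∃ Y ∈ S, Y ⊆ X

/-- A (complete) `n`-type over `M`: an ultrafilter on the Boolean algebra of definable
subsets of `M^n`. -/
def IsTypeOn (L : FirstOrder.Language) {M : Type*} [L.Structure M] (n : ℕ)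
    (p : Set (Set (Fin n → M))) : Prop :=
  (∀ X ∈ p, Set.Definable (Set.univ : Set M) L X) ∧
  ∅ ∉ p ∧
  (∀ X ∈ p, ∀ Y ∈ p, X ∩ Y ∈ p) ∧
  (∀ X ∈ p, ∀ Y : Set (Fin n → M), Set.Definable (Set.univ : Set M) L Y → X ⊆ Y → Y ∈ p) ∧
  (∀ X : Set (Fin n → M), Set.Definable (Set.univ : Set M) L X → X ∈ p ∨ Xᶜ ∈ p)

/-- A type `p` is `A`-definable if for every `∅`-definable `D ⊆ M^{m+n}` the set of
parameters `u` with `φ(u, M^n) ∈ p` is `A`-definable. -/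
def IsDefTypeOver (L : FirstOrder.Language) {M : Type*} [L.Structure M] (A : Set M) (n : ℕ)
    (p : Set (Set (Fin n → M))) : Prop :=
  ∀ (m : ℕ) (D : Set (Fin m ⊕ Fin n → M)), Set.Definable (∅ : Set M) L D →
    Set.Definable A L {u : Fin m → M | famFiber D u ∈ p}

/-- A family `F` is complete for a family `X` if each member of `X` either contains a member
of `F` or is disjoint from one. -/
def CompleteFor {α : Type*} (F X : Set (Set α)) : Prop :=
  ∀ Y ∈ X, ∃ Z ∈ F, Z ⊆ Y ∨ Z ∩ Y = ∅

/-- A family of subsets of `M^n` is complete if it decides every definable set. -/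
def IsCompleteFam (L : FirstOrder.Language) {M : Type*} [L.Structure M] (n : ℕ)
    (S : Set (Set (Fin n → M))) : Prop :=
  ∀ X : Set (Fin n → M), Set.Definable (Set.univ : Set M) L X → ∃ Z ∈ S, Z ⊆ X ∨ Z ∩ X = ∅

/-- `B` is a basis for the type `p`: a downward directed subfamily generating `p`. -/
def IsBasisOfType {α : Type*} (B p : Set (Set α)) : Prop :=
  B ⊆ p ∧ DirectedFam B ∧ ∀ Y ∈ p, ∃ Z ∈ B, Z ⊆ Y

/-- `p` has an `A`-definable basis. -/
def HasDefBasis (L : FirstOrder.Language) {M : Type*} [L.Structure M] (A : Set M) (n : ℕ)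
    (p : Set (Set (Fin n → M))) : Prop :=
  ∃ B, IsDefFamily L A n B ∧ IsBasisOfType B p

/-- `S` has a finite tame transversal: it is covered by finitely many subfamilies, each of
which extends to a definable type. -/
def HasFTT (L : FirstOrder.Language) {M : Type*} [L.Structure M] (n : ℕ)
    (S : Set (Set (Fin n → M))) : Prop :=
  ∃ (N : ℕ) (p : Fin N → Set (Set (Fin n → M))),
    (∀ i, IsTypeOn L n (p i) ∧ IsDefTypeOver L (Set.univ : Set M) n (p i)) ∧
    ∀ X ∈ S, ∃ i, X ∈ p i

/-- The `(m,n)`-property: among any `m` members of the family, some `n` have nonempty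
intersection. -/
def HasMNProperty {α : Type*} (S : Set (Set α)) (m n : ℕ) : Prop :=
  ∀ F : Finset (Set α), ↑F ⊆ S → F.card = m →
    ∃ G ⊆ F, G.card = n ∧ (⋂₀ (G : Set (Set α))).Nonempty


universe u

/-- Spaces with coordinates in `M`. -/
class Crd (M : Type u) (X : Type u) where
  ι : Type
  fin : Finite ι
  e : X ≃ (ι → M)

namespace OM

instance crdFin (M X : Type u) [c : Crd M X] : Finite c.ι := c.fin

instance crdSelf (M : Type u) : Crd M M where
  ι := Unit
  fin := inferInstance
  e := (Equiv.funUnique Unit M).symm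

instance crdUnit (M : Type u) : Crd M PUnit.{u+1} where
  ι := Empty
  fin := inferInstance
  e := ⟨fun _ i => i.elim, fun _ => PUnit.unit, fun _ => rfl, fun _ => funext fun i => i.elim⟩

instance crdProd (M X Y : Type u) [Crd M X] [Crd M Y] : Crd M (X × Y) where
  ι := Crd.ι M X ⊕ Crd.ι M Y
  fin := inferInstance
  e := (Equiv.prodCongr Crd.e Crd.e).trans (Equiv.sumArrowEquivProdArrow _ _ _).symm

instance crdFun (M : Type u) (n : ℕ) : Crd M (Fin n → M) where
  ι := Fin n
  fin := inferInstance
  e := Equiv.refl _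

/-- Iterated powers. -/
def Pow (M : Type u) : ℕ → Type u
  | 0 => PUnit
  | n+1 => M × Pow M n

instance crdPow (M : Type u) : (n : ℕ) → Crd M (Pow M n)
  | 0 => crdUnit M
  | n+1 => @crdProd M M (Pow M n) _ (crdPow M n)

section calc_
variable {L : FirstOrder.Language} {M : Type u} [L.Structure M]
variable {X Y Z W : Type u} [Crd M X] [Crd M Y] [Crd M Z] [Crd M W]

variable (L) in
/-- Definable predicates. -/
def DefP (A : Set M) (P : X → Prop) : Prop :=
  A.Definable L {v : Crd.ι M X → M | P (Crd.e.symm v)}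

variable (L) in
/-- Definable functions. -/
def DefF (A : Set M) (f : X → Y) : Prop :=
  DefP L A (fun q : X × Y => f q.1 = q.2)

variable {A : Set M}

theorem DefP.congr {P Q : X → Prop} (h : DefP L A P) (hPQ : ∀ x, P x ↔ Q x) : DefP L A Q := by
  have : P = Q := funext fun x => propext (hPQ x)
  exact this ▸ h

theorem DefP.and {P Q : X → Prop} (hP : DefP L A P) (hQ : DefP L A Q) :
    DefP L A (fun q => P q ∧ Q q) := Definable.inter hP hQ

theorem DefP.or {P Q : X → Prop} (hP : DefP L A P) (hQ : DefP L A Q) :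
    DefP L A (fun q => P q ∨ Q q) := Definable.union hP hQ

theorem DefP.not {P : X → Prop} (hP : DefP L A P) :
    DefP L A (fun q => ¬ P q) := Definable.compl hP

theorem DefP.imp {P Q : X → Prop} (hP : DefP L A P) (hQ : DefP L A Q) :
    DefP L A (fun q => P q → Q q) :=
  (hP.not.or hQ).congr fun x => by tauto

theorem DefP.iff {P Q : X → Prop} (hP : DefP L A P) (hQ : DefP L A Q) :
    DefP L A (fun q => P q ↔ Q q) :=
  ((hP.imp hQ).and (hQ.imp hP)).congr fun x => by tauto

theorem DefP.const (p : Prop) : DefP L A (fun _ : X => p) := by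
  by_cases h : p
  · simp [DefP, h]
  · simp [DefP, h]

theorem DefP.ex {P : X → Y → Prop} (hP : DefP L A (fun q : X × Y => P q.1 q.2)) :
    DefP L A (fun x => ∃ y, P x y) := by
  unfold DefP at *
  have := Definable.exists_of_finite hP
  convert! this using 1
  ext v
  simp only [mem_ofPred_eq]
  constructor
  · rintro ⟨y, hy⟩
    refine ⟨Crd.e y, ?_⟩
    show P (Crd.e.symm v) (Crd.e.symm (Crd.e (M := M) y))
    rwa [Equiv.symm_apply_apply]
  · rintro ⟨w, hw⟩
    exact ⟨_, hw⟩

theorem DefP.all {P : X → Y → Prop} (hP : DefP L A (fun q : X × Y => P q.1 q.2)) :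
    DefP L A (fun x => ∀ y, P x y) :=
  (DefP.not (DefP.ex (P := fun x y => ¬ P x y) (DefP.not hP))).congr fun x => by simp

theorem DefP.reindex {P : Y → Prop} (hP : DefP L A P) (g : X → Y) (r : Crd.ι M Y → Crd.ι M X)
    (h : ∀ x, Crd.e (g x) = Crd.e x ∘ r) : DefP L A (fun x => P (g x)) := by
  unfold DefP at *
  have := Definable.preimage_comp r hP
  convert! this using 1
  ext v
  simp only [mem_ofPred_eq, mem_preimage]
  have := h (Crd.e.symm v)
  rw [Equiv.apply_symm_apply] at this
  rw [← this, Equiv.symm_apply_apply]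

theorem DefP.mono {B : Set M} {P : X → Prop} (hP : DefP L A P) (h : A ⊆ B) : DefP L B P :=
  Definable.mono hP h

theorem DefF.mono {B : Set M} {f : X → Y} (hf : DefF L A f) (h : A ⊆ B) : DefF L B f :=
  DefP.mono hf h

theorem DefP.eq0 : DefP L A (fun q : X × X => q.1 = q.2) := by
  have : ∀ i : Crd.ι M X, A.Definable L {v : Crd.ι M (X × X) → M | v (Sum.inl i) = v (Sum.inr i)} := by
    intro i
    refine ⟨(FirstOrder.Language.Term.var (Sum.inl i)).equal (FirstOrder.Language.Term.var (Sum.inr i)), ?_⟩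
    ext; simp
  have := definable_iInter_of_finite this
  unfold DefP
  convert! this using 1
  ext v
  simp only [mem_ofPred_eq, mem_iInter]
  constructor
  · intro h i
    have h2 := congrArg (fun z => Crd.e (M := M) z i) h
    simpa [Crd.e] using! h2
  · intro h
    apply (Crd.e (M := M)).injective
    ext i
    simpa [Crd.e] using! h i

theorem DefF.of_reindex (g : X → Y) (r : Crd.ι M Y → Crd.ι M X)
    (h : ∀ x, Crd.e (g x) = Crd.e x ∘ r) : DefF L A g :=
  DefP.reindex (X := X × Y) (Y := Y × Y) DefP.eq0 (fun q => (g q.1, q.2)) (Sum.map r id) (by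
    intro x; funext i; rcases i with i | i
    · exact congrFun (h x.1) i
    · rfl)

theorem DefF.id : DefF L A (fun x : X => x) := DefF.of_reindex _ (fun i => i) (fun _ => rfl)
theorem DefF.fst0 : DefF L A (fun x : X × Y => x.1) := DefF.of_reindex _ Sum.inl (fun _ => rfl)
theorem DefF.snd0 : DefF L A (fun x : X × Y => x.2) := DefF.of_reindex _ Sum.inr (fun _ => rfl)

theorem DefP.comp {P : Y → Prop} {f : X → Y} (hP : DefP L A P) (hf : DefF L A f) :
    DefP L A (fun x => P (f x)) := by
  have h1 : DefP L A (fun q : X × Y => P q.2) := hP.reindex _ Sum.inr (fun _ => rfl)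
  refine DefP.congr (DefP.ex (P := fun x y => f x = y ∧ P y) (DefP.and hf h1)) fun x => by simp

theorem DefF.pair {f : X → Y} {g : X → Z} (hf : DefF L A f) (hg : DefF L A g) :
    DefF L A (fun x => (f x, g x)) := by
  have h1 : DefP L A (fun q : X × (Y × Z) => f q.1 = q.2.1) :=
    DefP.reindex (X := X × (Y × Z)) (Y := X × Y) hf (fun q => (q.1, q.2.1)) (Sum.map (fun i => i) Sum.inl) (by
      intro x; funext i; rcases i with i | i <;> rfl)
  have h2 : DefP L A (fun q : X × (Y × Z) => g q.1 = q.2.2) :=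
    DefP.reindex (X := X × (Y × Z)) (Y := X × Z) hg (fun q => (q.1, q.2.2)) (Sum.map (fun i => i) Sum.inr) (by
      intro x; funext i; rcases i with i | i <;> rfl)
  exact (h1.and h2).congr fun x => by rw [Prod.ext_iff]

theorem DefF.comp {g : Y → Z} {f : X → Y} (hg : DefF L A g) (hf : DefF L A f) :
    DefF L A (fun x => g (f x)) := by
  have h1 : DefF L A (fun q : X × Z => f q.1) := by
    refine DefP.reindex (X := (X × Z) × Y) (Y := X × Y) hf (fun q : (X × Z) × Y => (q.1.1, q.2))
      (Sum.map Sum.inl (fun i => i)) ?_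
    intro x; funext i; rcases i with i | i <;> rfl
  exact DefP.comp (X := X × Z) (Y := Y × Z) hg (DefF.pair h1 DefF.snd0)

theorem DefF.fst {f : X → Y × Z} (hf : DefF L A f) : DefF L A (fun x => (f x).1) :=
  DefF.comp DefF.fst0 hf
theorem DefF.snd {f : X → Y × Z} (hf : DefF L A f) : DefF L A (fun x => (f x).2) :=
  DefF.comp DefF.snd0 hf

theorem DefP.eq {f g : X → Y} (hf : DefF L A f) (hg : DefF L A g) :
    DefP L A (fun x => f x = g x) :=
  DefP.comp (DefP.eq0) (DefF.pair hf hg)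

theorem DefP.comp2 {H : Y → Z → Prop} {f : X → Y} {g : X → Z}
    (hH : DefP L A (fun z : Y × Z => H z.1 z.2)) (hf : DefF L A f) (hg : DefF L A g) :
    DefP L A (fun x => H (f x) (g x)) := DefP.comp hH (DefF.pair hf hg)

theorem DefP.comp3 {H : Y → Z → W → Prop} {f : X → Y} {g : X → Z} {k : X → W}
    (hH : DefP L A (fun z : Y × Z × W => H z.1 z.2.1 z.2.2)) (hf : DefF L A f) (hg : DefF L A g)
    (hk : DefF L A k) :
    DefP L A (fun x => H (f x) (g x) (k x)) := DefP.comp hH (DefF.pair hf (hg.pair hk))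

theorem DefP.comp4 {V : Type u} [Crd M V] {H : Y → Z → W → V → Prop}
    {f : X → Y} {g : X → Z} {k : X → W} {l : X → V}
    (hH : DefP L A (fun z : Y × Z × W × V => H z.1 z.2.1 z.2.2.1 z.2.2.2))
    (hf : DefF L A f) (hg : DefF L A g) (hk : DefF L A k) (hl : DefF L A l) :
    DefP L A (fun x => H (f x) (g x) (k x) (l x)) :=
  DefP.comp hH (DefF.pair hf (hg.pair (hk.pair hl)))

theorem DefF.const (c : Y) : DefF L (Set.univ : Set M) (fun _ : X => c) := by
  have : ∀ i : Crd.ι M Y, (Set.univ : Set M).Definable L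
      {v : Crd.ι M (X × Y) → M | (Crd.e c : Crd.ι M Y → M) i = v (Sum.inr i)} := by
    intro i
    have := (Definable.singleton_of_mem L (Set.mem_univ ((Crd.e c : Crd.ι M Y → M) i)))
    have := Definable.preimage_comp (β := Crd.ι M (X × Y)) (fun _ => Sum.inr i) this
    convert! this using 1
    ext v; simp [eq_comm]
  have := definable_iInter_of_finite this
  unfold DefF DefP
  convert! this using 1
  ext v
  simp only [mem_ofPred_eq, mem_iInter]
  constructor
  · intro h i
    have h2 := congrArg (fun z => Crd.e (M := M) z i) h
    simpa [Crd.e] using! h2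
  · intro h
    apply (Crd.e (M := M)).injective
    ext i
    simpa [Crd.e] using! h i

theorem DefF.unit {f : X → PUnit.{u+1}} : DefF L A f := DefP.congr (DefP.const True) (by simp)

theorem DefP.exFin {I : Type*} [Finite I] {P : I → X → Prop} (h : ∀ i, DefP L A (P i)) :
    DefP L A (fun x => ∃ i, P i x) := by
  have := definable_iUnion_of_finite h
  unfold DefP
  convert! this using 1
  ext; simp
theorem DefP.allFin {I : Type*} [Finite I] {P : I → X → Prop} (h : ∀ i, DefP L A (P i)) :
    DefP L A (fun x => ∀ i, P i x) := by
  have := definable_iInter_of_finite h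
  unfold DefP
  convert! this using 1
  ext; simp

/-- Extraction of parameters. -/
theorem DefP.params {P : X → Prop} (h : DefP L (Set.univ : Set M) P) :
    ∃ (s : ℕ) (c : Fin s → M) (G : (Fin s → M) → X → Prop),
      DefP L (∅ : Set M) (fun z : (Fin s → M) × X => G z.1 z.2) ∧ ∀ x, P x ↔ G c x := by
  obtain ⟨B, -, hB⟩ := definable_iff_finitely_definable.1 h
  obtain ⟨φ, hφ⟩ := definable_iff_exists_formula_sum.1 hB
  let E := Fintype.equivFin (B : Set M)
  refine ⟨_, fun i => (E.symm i : M), fun c x => φ.Realize (Sum.elim (fun b => c (E b)) (Crd.e x)), ?_, ?_⟩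
  · refine (empty_definable_iff).2 ⟨φ.relabel (Sum.map E (fun i => i)), ?_⟩
    ext v
    simp only [mem_ofPred_eq, Language.Formula.realize_relabel]
    apply iff_of_eq; congr 1; funext i
    rcases i with i | i
    · rfl
    · simp [Crd.e]; rfl
  · intro x
    have := Set.ext_iff.1 hφ (Crd.e x)
    simp only [mem_ofPred_eq, Equiv.symm_apply_apply] at this
    rw [this]; simp

theorem DefP.ne {f g : X → Y} (hf : DefF L A f) (hg : DefF L A g) :
    DefP L A (fun x => f x ≠ g x) := (DefP.eq hf hg).not

end calc_

/-- o-minimality, as a class. -/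
class OMin (L : FirstOrder.Language) (M : Type u) [L.Structure M] [LinearOrder M] : Prop where
  lt : DefP L (∅ : Set M) (fun q : M × M => q.1 < q.2)
  fin : ∀ s : Set M, DefP L (Set.univ : Set M) (fun x => x ∈ s) →
    ∃ F : Finset (Set M), s = ⋃₀ (F : Set (Set M)) ∧
      ∀ t ∈ F, (∃ a : M, t = {a}) ∨ (∃ a b : M, t = Set.Ioo a b) ∨
        (∃ a : M, t = Set.Ioi a) ∨ (∃ a : M, t = Set.Iio a) ∨ t = Set.univ

section order
variable {L : FirstOrder.Language} {M : Type u} [L.Structure M] [LinearOrder M] [OMin L M]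
variable {X : Type u} [Crd M X] {A : Set M}

theorem DefP.lt {f g : X → M} (hf : DefF L A f) (hg : DefF L A g) :
    DefP L A (fun x => f x < g x) :=
  DefP.comp2 (H := fun a b => a < b) (OMin.lt.mono (Set.empty_subset _)) hf hg
theorem DefP.le {f g : X → M} (hf : DefF L A f) (hg : DefF L A g) :
    DefP L A (fun x => f x ≤ g x) :=
  (DefP.lt hg hf).not.congr fun x => by simp
end order

theorem OMin.of_isOMinimal {L : FirstOrder.Language} {M : Type u} [L.Structure M] [LinearOrder M]
    (h : IsOMinimal L M) : OMin L M := by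
  obtain ⟨-, -, -, -, h1, h2⟩ := h
  refine ⟨?_, fun s hs => h2 s ?_⟩
  · have := Definable.preimage_comp (β := Crd.ι M (M × M)) ![Sum.inl (), Sum.inr ()] h1
    convert! this using 1
  · have := Definable.preimage_comp (β := Fin 1) (fun _ => 0) hs
    convert! this using 1

/-- Dual order on the same type. -/
abbrev dualOrd (M : Type u) [LinearOrder M] : LinearOrder M :=
  (inferInstance : LinearOrder Mᵒᵈ)

theorem OMin.dual {L : FirstOrder.Language} {M : Type u} [L.Structure M] [LinearOrder M]
    [h : OMin L M] : @OMin L M _ (dualOrd M) := by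
  refine @OMin.mk L M _ (dualOrd M) ?_ ?_
  · exact DefP.comp2 (H := fun a b => a < b) OMin.lt DefF.snd0 DefF.fst0
  · intro s hs
    obtain ⟨F, h1, h2⟩ := h.fin s hs
    refine ⟨F, h1, fun t ht => ?_⟩
    rcases h2 t ht with ⟨a, h⟩ | ⟨a, b, h⟩ | ⟨a, h⟩ | ⟨a, h⟩ | h
    · exact Or.inl ⟨a, h⟩
    · refine Or.inr (Or.inl ⟨b, a, ?_⟩)
      rw [h]; ext x; exact and_comm
    · exact Or.inr (Or.inr (Or.inr (Or.inl ⟨a, h⟩)))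
    · exact Or.inr (Or.inr (Or.inl ⟨a, h⟩))
    · exact Or.inr (Or.inr (Or.inr (Or.inr h)))

attribute [irreducible] DefP DefF

end OM

namespace OM

set_option linter.unusedSectionVars false

section near
variable {M : Type u} [LinearOrder M]
/-- `P` holds just to the right of `c`. -/
def NR (c : M) (P : M → Prop) : Prop := ∃ d, c < d ∧ ∀ x, c < x → x < d → P x
/-- `P` holds just to the left of `c`. -/
def NL (c : M) (P : M → Prop) : Prop := ∃ d, d < c ∧ ∀ x, d < x → x < c → P x
/-- `P` holds near `+∞`. -/
def NP (P : M → Prop) : Prop := ∃ d, ∀ x, d < x → P x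
/-- `P` holds near `-∞`. -/
def NM (P : M → Prop) : Prop := ∃ d, ∀ x, x < d → P x
/-- `P` contains an interval. -/
def Fat (P : M → Prop) : Prop := ∃ a b, a < b ∧ ∀ x, a < x → x < b → P x
end near

section
variable {L : FirstOrder.Language} {M : Type u} [L.Structure M] [LinearOrder M] [OMin L M]
variable {X : Type u} [Crd M X] {A : Set M}

theorem DefP.nr {f : X → M} {P : X → M → Prop} (hf : DefF L A f)
    (hP : DefP L A (fun q : X × M => P q.1 q.2)) : DefP L A (fun x => NR (f x) (P x)) := by
  unfold NR
  refine DefP.ex (DefP.and (DefP.lt ?_ DefF.snd0) (DefP.all (DefP.imp (DefP.lt ?_ DefF.snd0)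
    (DefP.imp (DefP.lt DefF.snd0 (DefF.fst0.snd)) (DefP.comp2 hP (DefF.fst0.fst) DefF.snd0)))))
  · exact DefF.comp hf DefF.fst0
  · exact DefF.comp hf DefF.fst0.fst

theorem DefP.nl {f : X → M} {P : X → M → Prop} (hf : DefF L A f)
    (hP : DefP L A (fun q : X × M => P q.1 q.2)) : DefP L A (fun x => NL (f x) (P x)) := by
  unfold NL
  refine DefP.ex (DefP.and (DefP.lt DefF.snd0 ?_) (DefP.all (DefP.imp (DefP.lt DefF.fst0.snd DefF.snd0)
    (DefP.imp (DefP.lt DefF.snd0 ?_) (DefP.comp2 hP (DefF.fst0.fst) DefF.snd0)))))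
  · exact DefF.comp hf DefF.fst0
  · exact DefF.comp hf DefF.fst0.fst

theorem DefP.np {P : X → M → Prop}
    (hP : DefP L A (fun q : X × M => P q.1 q.2)) : DefP L A (fun x => NP (P x)) := by
  unfold NP
  exact DefP.ex (DefP.all (DefP.imp (DefP.lt DefF.fst0.snd DefF.snd0)
    (DefP.comp2 hP (DefF.fst0.fst) DefF.snd0)))

theorem DefP.nm {P : X → M → Prop}
    (hP : DefP L A (fun q : X × M => P q.1 q.2)) : DefP L A (fun x => NM (P x)) := by
  unfold NM
  exact DefP.ex (DefP.all (DefP.imp (DefP.lt DefF.snd0 DefF.fst0.snd)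
    (DefP.comp2 hP (DefF.fst0.fst) DefF.snd0)))

theorem DefP.fat {P : X → M → Prop}
    (hP : DefP L A (fun q : X × M => P q.1 q.2)) : DefP L A (fun x => Fat (P x)) := by
  unfold Fat
  exact DefP.ex (DefP.ex (DefP.and (DefP.lt DefF.fst0.snd DefF.snd0)
    (DefP.all (DefP.imp (DefP.lt DefF.fst0.fst.snd DefF.snd0) (DefP.imp (DefP.lt DefF.snd0 DefF.fst0.snd)
    (DefP.comp2 hP (DefF.fst0.fst.fst) DefF.snd0))))))
end

/-- Definability prover: the argument is found by applying the closure rules and local hypotheses. -/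
theorem dfn {p : Prop} (h : p := by
    repeat' first
      | assumption | exact DefP.const _ | exact DefF.id | exact DefF.unit | exact DefF.const _
      | apply DefP.and | apply DefP.or | apply DefP.not | apply DefP.imp | apply DefP.iff
      | apply DefP.ex | apply DefP.all | apply DefP.exFin | apply DefP.allFin
      | apply DefP.lt | apply DefP.le | apply DefP.ne | apply DefP.eq
      | apply DefP.nr | apply DefP.nl | apply DefP.np | apply DefP.nm | apply DefP.fat
      | apply DefF.fst | apply DefF.snd | apply DefF.pair
      | refine DefP.comp4 (by assumption) ?_ ?_ ?_ ?_
      | refine DefP.comp3 (by assumption) ?_ ?_ ?_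
      | refine DefP.comp2 (by assumption) ?_ ?_
      | refine DefP.comp (by assumption) ?_ | refine DefF.comp (by assumption) ?_
      | intro _) : p := h

section duals
variable (M : Type u) [LinearOrder M]
theorem dual_dense [DenselyOrdered M] : @DenselyOrdered M (dualOrd M).toLT :=
  (inferInstance : DenselyOrdered Mᵒᵈ)
theorem dual_nomin [NoMaxOrder M] : @NoMinOrder M (dualOrd M).toLT :=
  (inferInstance : NoMinOrder Mᵒᵈ)
theorem dual_nomax [NoMinOrder M] : @NoMaxOrder M (dualOrd M).toLT :=
  (inferInstance : NoMaxOrder Mᵒᵈ)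
end duals

section tame
variable {L : FirstOrder.Language} {M : Type u} [L.Structure M] [LinearOrder M] [OMin L M]
variable [DenselyOrdered M] [NoMinOrder M] [NoMaxOrder M]

theorem NR.mono {c : M} {P Q : M → Prop} (h : NR c P) (hPQ : ∀ x, P x → Q x) : NR c Q :=
  let ⟨d, h1, h2⟩ := h; ⟨d, h1, fun x a b => hPQ x (h2 x a b)⟩
theorem NL.mono {c : M} {P Q : M → Prop} (h : NL c P) (hPQ : ∀ x, P x → Q x) : NL c Q :=
  let ⟨d, h1, h2⟩ := h; ⟨d, h1, fun x a b => hPQ x (h2 x a b)⟩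
theorem NP.mono {P Q : M → Prop} (h : NP P) (hPQ : ∀ x, P x → Q x) : NP Q :=
  let ⟨d, h2⟩ := h; ⟨d, fun x a => hPQ x (h2 x a)⟩
theorem NM.mono {P Q : M → Prop} (h : NM P) (hPQ : ∀ x, P x → Q x) : NM Q :=
  let ⟨d, h2⟩ := h; ⟨d, fun x a => hPQ x (h2 x a)⟩
theorem NR.and {c : M} {P Q : M → Prop} (h : NR c P) (h' : NR c Q) : NR c (fun x => P x ∧ Q x) :=
  let ⟨d, h1, h2⟩ := h; let ⟨d', h1', h2'⟩ := h'
  ⟨min d d', lt_min h1 h1', fun x a b => ⟨h2 x a (lt_of_lt_of_le b (min_le_left _ _)),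
    h2' x a (lt_of_lt_of_le b (min_le_right _ _))⟩⟩
theorem NL.and {c : M} {P Q : M → Prop} (h : NL c P) (h' : NL c Q) : NL c (fun x => P x ∧ Q x) :=
  let ⟨d, h1, h2⟩ := h; let ⟨d', h1', h2'⟩ := h'
  ⟨max d d', max_lt h1 h1', fun x a b => ⟨h2 x (lt_of_le_of_lt (le_max_left _ _) a) b,
    h2' x (lt_of_le_of_lt (le_max_right _ _) a) b⟩⟩
theorem NP.and {P Q : M → Prop} (h : NP P) (h' : NP Q) : NP (fun x => P x ∧ Q x) :=
  let ⟨d, h2⟩ := h; let ⟨d', h2'⟩ := h'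
  ⟨max d d', fun x a => ⟨h2 x (lt_of_le_of_lt (le_max_left _ _) a),
    h2' x (lt_of_le_of_lt (le_max_right _ _) a)⟩⟩
theorem NM.and {P Q : M → Prop} (h : NM P) (h' : NM Q) : NM (fun x => P x ∧ Q x) :=
  let ⟨d, h2⟩ := h; let ⟨d', h2'⟩ := h'
  ⟨min d d', fun x b => ⟨h2 x (lt_of_lt_of_le b (min_le_left _ _)),
    h2' x (lt_of_lt_of_le b (min_le_right _ _))⟩⟩
theorem NR.exists {c : M} {P : M → Prop} (h : NR c P) : ∃ x, c < x ∧ P x :=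
  let ⟨_, h1, h2⟩ := h; let ⟨x, a, b⟩ := exists_between h1; ⟨x, a, h2 x a b⟩
theorem NL.exists {c : M} {P : M → Prop} (h : NL c P) : ∃ x, x < c ∧ P x :=
  let ⟨_, h1, h2⟩ := h; let ⟨x, a, b⟩ := exists_between h1; ⟨x, b, h2 x a b⟩
theorem NP.exists [Nonempty M] {P : M → Prop} (h : NP P) : ∃ x, P x :=
  let ⟨d, h2⟩ := h; let ⟨x, a⟩ := exists_gt d; ⟨x, h2 x a⟩
theorem NM.exists [Nonempty M] {P : M → Prop} (h : NM P) : ∃ x, P x :=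
  let ⟨d, h2⟩ := h; let ⟨x, a⟩ := exists_lt d; ⟨x, h2 x a⟩
theorem NR.lt {c d : M} (h : c < d) : NR c (fun x => c < x ∧ x < d) := ⟨d, h, fun _ a b => ⟨a, b⟩⟩
theorem NL.lt {c d : M} (h : d < c) : NL c (fun x => d < x ∧ x < c) := ⟨d, h, fun _ a b => ⟨a, b⟩⟩

/-- Finite union principle. -/
theorem OMin.ind {P : M → Prop} (h : DefP L (univ : Set M) P) (Q : Set M → Prop)
    (h0 : Q ∅) (hU : ∀ s t, Q s → Q t → Q (s ∪ t)) (h1 : ∀ a, Q {a})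
    (h2 : ∀ a b, a < b → Q (Ioo a b)) (h3 : ∀ a, Q (Ioi a)) (h4 : ∀ a, Q (Iio a)) (h5 : Q univ) :
    Q {x | P x} := by
  classical
  obtain ⟨F, hF, hb⟩ := OMin.fin (L := L) {x | P x} h
  rw [hF]; clear hF
  induction F using Finset.induction_on with
  | empty => simpa using h0
  | insert t F _ ih =>
    rw [Finset.coe_insert, sUnion_insert]
    apply hU
    · rcases hb t (by simp) with ⟨a, h⟩ | ⟨a, b, h⟩ | ⟨a, h⟩ | ⟨a, h⟩ | h
      · exact h ▸ h1 a
      · rcases lt_or_ge a b with hab | hab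
        · exact h ▸ h2 a b hab
        · rw [h, Ioo_eq_empty (not_lt.2 hab)]; exact h0
      · exact h ▸ h3 a
      · exact h ▸ h4 a
      · exact h ▸ h5
    · exact ih fun t ht => hb t (by simp [ht])

theorem nr_or {P : M → Prop} (h : DefP L (univ : Set M) P) (c : M) :
    NR c P ∨ NR c (fun x => ¬ P x) := by
  refine OMin.ind h (fun s => NR c (fun x => x ∈ s) ∨ NR c (fun x => ¬ x ∈ s)) ?_ ?_ ?_ ?_ ?_ ?_ ?_
  · obtain ⟨d, hd⟩ := exists_gt c
    exact Or.inr ⟨d, hd, by simp⟩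
  · rintro s t (hs | hs) h
    · exact Or.inl (hs.mono fun x h => Or.inl h)
    · rcases h with h | h
      · exact Or.inl (h.mono fun x h => Or.inr h)
      · exact Or.inr ((hs.and h).mono (by simp))
  · intro a
    rcases lt_or_ge c a with h | h
    · exact Or.inr ⟨a, h, fun x _ h2 => by simpa using h2.ne⟩
    · obtain ⟨d, hd⟩ := exists_gt c
      exact Or.inr ⟨d, hd, fun x h1 h2 => by simpa using (h.trans_lt h1).ne'⟩
  · intro a b hab
    rcases lt_or_ge c a with h | h
    · exact Or.inr ⟨a, h, fun x _ h2 h3 => absurd h3.1 (not_lt.2 h2.le)⟩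
    · rcases lt_or_ge c b with h' | h'
      · exact Or.inl ⟨b, h', fun x h1 h2 => ⟨h.trans_lt h1, h2⟩⟩
      · obtain ⟨d, hd⟩ := exists_gt c
        exact Or.inr ⟨d, hd, fun x h1 h2 h3 => absurd h3.2 (not_lt.2 (h'.trans h1.le))⟩
  · intro a
    rcases lt_or_ge c a with h | h
    · exact Or.inr ⟨a, h, fun x _ h2 h3 => absurd h3 (not_lt.2 h2.le)⟩
    · obtain ⟨d, hd⟩ := exists_gt c
      exact Or.inl ⟨d, hd, fun x h1 h2 => h.trans_lt h1⟩
  · intro b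
    rcases lt_or_ge c b with h' | h'
    · exact Or.inl ⟨b, h', fun x h1 h2 => h2⟩
    · obtain ⟨d, hd⟩ := exists_gt c
      exact Or.inr ⟨d, hd, fun x h1 h2 h3 => absurd h3 (not_lt.2 (h'.trans h1.le))⟩
  · obtain ⟨d, hd⟩ := exists_gt c
    exact Or.inl ⟨d, hd, by simp⟩

theorem nl_or {P : M → Prop} (h : DefP L (univ : Set M) P) (c : M) :
    NL c P ∨ NL c (fun x => ¬ P x) := by
  have hO := OMin.dual (L := L) (M := M)
  have := @nr_or L M _ (dualOrd M) hO (dual_dense M) (dual_nomin M) (dual_nomax M) P h c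
  rcases this with ⟨d, h1, h2⟩ | ⟨d, h1, h2⟩
  · exact Or.inl ⟨d, h1, fun x a b => h2 x b a⟩
  · exact Or.inr ⟨d, h1, fun x a b => h2 x b a⟩

theorem np_or [Nonempty M] {P : M → Prop} (h : DefP L (univ : Set M) P) :
    NP P ∨ NP (fun x => ¬ P x) := by
  refine OMin.ind h (fun s => NP (fun x => x ∈ s) ∨ NP (fun x => ¬ x ∈ s)) ?_ ?_ ?_ ?_ ?_ ?_ ?_
  · exact Or.inr ⟨Classical.arbitrary M, by simp⟩
  · rintro s t (hs | hs) h
    · exact Or.inl (hs.mono fun x h => Or.inl h)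
    · rcases h with h | h
      · exact Or.inl (h.mono fun x h => Or.inr h)
      · exact Or.inr ((hs.and h).mono (by simp))
  · intro a
    exact Or.inr ⟨a, fun x h2 => by simpa using h2.ne'⟩
  · intro a b hab
    exact Or.inr ⟨b, fun x h2 h3 => absurd h3.2 (not_lt.2 h2.le)⟩
  · intro a
    exact Or.inl ⟨a, fun x h => h⟩
  · intro b
    exact Or.inr ⟨b, fun x h2 h3 => absurd h3 (not_lt.2 h2.le)⟩
  · exact Or.inl ⟨Classical.arbitrary M, by simp⟩

theorem nm_or [Nonempty M] {P : M → Prop} (h : DefP L (univ : Set M) P) :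
    NM P ∨ NM (fun x => ¬ P x) := by
  have hO := OMin.dual (L := L) (M := M)
  exact @np_or L M _ (dualOrd M) hO (dual_dense M) (dual_nomin M) (dual_nomax M) inferInstance P h

theorem exists_glb {P : M → Prop} (h : DefP L (univ : Set M) P) (hne : ∃ x, P x)
    (hb : ∃ b, ∀ x, P x → b ≤ x) : ∃ c, IsGLB {x | P x} c := by
  have := OMin.ind h (fun s => s = ∅ ∨ (∀ x, ∃ y ∈ s, y < x) ∨ ∃ c, IsGLB s c) ?_ ?_ ?_ ?_ ?_ ?_ ?_
  · rcases this with h | h | h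
    · obtain ⟨x, hx⟩ := hne
      exact absurd (show x ∈ {x | P x} from hx) (by rw [h]; simp)
    · obtain ⟨b, hb⟩ := hb
      obtain ⟨y, hy, h2⟩ := h b
      exact absurd (hb y hy) (not_le.2 h2)
    · exact h
  · simp
  · rintro s t (h | h | ⟨c, h⟩) (h' | h' | ⟨c', h'⟩)
    · simp [h, h']
    · subst h; right; left; simpa using h'
    · subst h; right; right; simpa using ⟨c', h'⟩
    · subst h'; right; left; simpa using h
    · right; left; intro x; obtain ⟨y, a, b⟩ := h x; exact ⟨y, Or.inl a, b⟩
    · right; left; intro x; obtain ⟨y, a, b⟩ := h x; exact ⟨y, Or.inl a, b⟩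
    · subst h'; right; right; simpa using ⟨c, h⟩
    · right; left; intro x; obtain ⟨y, a, b⟩ := h' x; exact ⟨y, Or.inr a, b⟩
    · right; right; exact ⟨_, h.union h'⟩
  · intro a; right; right; exact ⟨a, isGLB_singleton⟩
  · intro a b hab; right; right; exact ⟨a, isGLB_Ioo hab⟩
  · intro a; right; right; exact ⟨a, isGLB_Ioi⟩
  · intro a; right; left; intro x
    obtain ⟨y, hy⟩ := exists_lt (min a x)
    exact ⟨y, hy.trans_le (min_le_left _ _), hy.trans_le (min_le_right _ _)⟩
  · right; left; intro x
    obtain ⟨y, hy⟩ := exists_lt x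
    exact ⟨y, trivial, hy⟩

theorem exists_lub {P : M → Prop} (h : DefP L (univ : Set M) P) (hne : ∃ x, P x)
    (hb : ∃ b, ∀ x, P x → x ≤ b) : ∃ c, IsLUB {x | P x} c := by
  have hO := OMin.dual (L := L) (M := M)
  exact @exists_glb L M _ (dualOrd M) hO (dual_dense M) (dual_nomin M) (dual_nomax M) P h hne hb

theorem fat_or_finite [Nonempty M] {P : M → Prop} (h : DefP L (univ : Set M) P) :
    Fat P ∨ {x | P x}.Finite := by
  refine OMin.ind h (fun s => Fat (fun x => x ∈ s) ∨ s.Finite) ?_ ?_ ?_ ?_ ?_ ?_ ?_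
  · simp
  · rintro s t (⟨a, b, h1, h2⟩ | h) (⟨a', b', h1', h2'⟩ | h')
    · exact Or.inl ⟨a, b, h1, fun x u v => Or.inl (h2 x u v)⟩
    · exact Or.inl ⟨a, b, h1, fun x u v => Or.inl (h2 x u v)⟩
    · exact Or.inl ⟨a', b', h1', fun x u v => Or.inr (h2' x u v)⟩
    · exact Or.inr (h.union h')
  · intro a; simp
  · intro a b hab; exact Or.inl ⟨a, b, hab, fun x h1 h2 => ⟨h1, h2⟩⟩
  · intro a; obtain ⟨b, hb⟩ := exists_gt a
    exact Or.inl ⟨a, b, hb, fun x h1 h2 => h1⟩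
  · intro b; obtain ⟨a, hb⟩ := exists_lt b
    exact Or.inl ⟨a, b, hb, fun x h1 h2 => h2⟩
  · obtain ⟨a, hb⟩ := exists_lt (Classical.arbitrary M)
    exact Or.inl ⟨a, _, hb, fun x h1 h2 => trivial⟩

theorem Fat.infinite {P : M → Prop} (h : Fat P) : {x | P x}.Infinite := by
  obtain ⟨a, b, h1, h2⟩ := h
  exact (Ioo_infinite h1).mono fun x hx => h2 x hx.1 hx.2

theorem fat_iff [Nonempty M] {P : M → Prop} (h : DefP L (univ : Set M) P) :
    Fat P ↔ {x | P x}.Infinite :=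
  ⟨fun h => h.infinite, fun h' => (fat_or_finite h).resolve_right h'⟩

end tame
end OM

namespace OM
set_option linter.unusedSectionVars false

section slm
variable {L : FirstOrder.Language} {M : Type u} [L.Structure M] [LinearOrder M] [OMin L M]
variable [DenselyOrdered M] [NoMinOrder M] [NoMaxOrder M] [Nonempty M]

theorem NL.of_cofinal {P : M → Prop} (h : DefP L (univ : Set M) P) {c : M}
    (hc : ∀ d, d < c → ∃ x, d < x ∧ x < c ∧ P x) : NL c P := by
  rcases nl_or h c with h | ⟨d, h1, h2⟩
  · exact h
  · obtain ⟨x, a, b, hx⟩ := hc d h1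
    exact absurd hx (h2 x a b)

theorem NR.of_cofinal {P : M → Prop} (h : DefP L (univ : Set M) P) {c : M}
    (hc : ∀ d, c < d → ∃ x, c < x ∧ x < d ∧ P x) : NR c P := by
  rcases nr_or h c with h | ⟨d, h1, h2⟩
  · exact h
  · obtain ⟨x, a, b, hx⟩ := hc d h1
    exact absurd hx (h2 x a b)

theorem lub_le {P : M → Prop} {z : M} (hz : IsLUB {x | P x} z) (e : M) (h : ∀ y, P y → y ≤ e) :
    z ≤ e := hz.2 h
theorem le_glb {P : M → Prop} {z : M} (hz : IsGLB {x | P x} z) (e : M) (h : ∀ y, P y → e ≤ y) :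
    e ≤ z := hz.2 h

theorem NL.fat {P : M → Prop} {c : M} (h : NL c P) : Fat P :=
  let ⟨d, h1, h2⟩ := h; ⟨d, c, h1, h2⟩
theorem NR.fat {P : M → Prop} {c : M} (h : NR c P) : Fat P :=
  let ⟨d, h1, h2⟩ := h; ⟨c, d, h1, h2⟩

/-- Every point of `(a,b)` is a strict local minimum of the total preorder `le`. -/
structure LMin (le : M → M → Prop) (a b : M) : Prop where
  tot : ∀ x y, a < x → x < b → a < y → y < b → le x y ∨ le y x
  tr : ∀ x y z, a < x → x < b → a < y → y < b → a < z → z < b → le x y → le y z → le x z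
  mR : ∀ x, a < x → x < b → NR x (fun y => ¬ le y x)
  mL : ∀ x, a < x → x < b → NL x (fun y => ¬ le y x)

theorem LMin.half {le : M → M → Prop} (hd : DefP L (univ : Set M) (fun q : M × M => le q.1 q.2))
    {a b : M} (hab : a < b) (h : LMin le a b) :
    ∃ a' b', a ≤ a' ∧ a' < b' ∧ b' ≤ b ∧ ∀ z, a' < z → z < b' →
      ∃ c, a < c ∧ c < b ∧ NL z (fun y => le c y) ∧ NR z (fun y => ¬ le c y) := by
  let B : M → Prop := fun x => a < x ∧ x < b ∧ ∀ y, x < y → y < b → ¬ le y x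
  have hB : DefP L (univ : Set M) B := dfn
  have hBf : ¬ Fat B := by
    rintro ⟨p, q, hpq, hB⟩
    obtain ⟨y, hy1, hy2⟩ := exists_between hpq
    have hyB := hB y hy1 hy2
    obtain ⟨x, hx1, hx2, hx3⟩ := ((h.mL y hyB.1 hyB.2.1).and (NL.lt hy1)).exists
    have hxB := hB x hx3.1 (hx1.trans hy2)
    rcases h.tot x y hxB.1 hxB.2.1 hyB.1 hyB.2.1 with h | h
    · exact hx2 h
    · exact hxB.2.2 y hx1 hyB.2.1 h
  obtain ⟨a1, ha1, hab1, hB1⟩ : ∃ a1, a ≤ a1 ∧ a1 < b ∧ ∀ x, a1 < x → x < b → ¬ B x := by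
    rcases nl_or hB b with h | ⟨d, h1, h2⟩
    · exact absurd h.fat hBf
    · exact ⟨max a d, le_max_left _ _, max_lt hab h1,
        fun x u v => h2 x ((le_max_right _ _).trans_lt u) v⟩
  have st1 : ∀ x, a1 < x → x < b → NL b (fun y => le y x) := by
    intro x hx1 hx2
    have hax := ha1.trans_lt hx1
    have hxx : le x x := by rcases h.tot x x hax hx2 hax hx2 with h | h <;> exact h
    apply NL.of_cofinal (L := L) dfn
    by_contra! hcon
    obtain ⟨d, hdb, hcon⟩ := hcon
    obtain ⟨z, hz⟩ := exists_lub (L := L) (P := fun y => x ≤ y ∧ y < b ∧ le y x) dfn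
      ⟨x, le_rfl, hx2, hxx⟩ ⟨b, fun y hy => hy.2.1.le⟩
    have hxz : x ≤ z := hz.1 ⟨le_rfl, hx2, hxx⟩
    have hzb : z < b := by
      refine lt_of_le_of_lt (lub_le hz (max d x) ?_) (max_lt hdb hx2)
      rintro y ⟨hy1, hy2, hy3⟩
      by_contra! hcy
      exact hcon y ((le_max_left _ _).trans_lt hcy) hy2 hy3
    have haz := hax.trans_le hxz
    by_cases hzx : le z x
    · apply hB1 z (hx1.trans_le hxz) hzb
      refine ⟨haz, hzb, fun y hzy hyb hyz => ?_⟩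
      have hay := haz.trans hzy
      have := h.tr y z x hay hyb haz hzb hax hx2 hyz hzx
      exact absurd (hz.1 ⟨hxz.trans hzy.le, hyb, this⟩) (not_le.2 hzy)
    · obtain ⟨e, he, hez⟩ := h.mL z haz hzb
      have hle : ∃ y, (x ≤ y ∧ y < b ∧ le y x) ∧ max e a < y := by
        by_contra! hno
        exact absurd (lub_le hz (max e a) fun y hy => hno y hy) (not_le.2 (max_lt he haz))
      obtain ⟨y, hy, hy2⟩ := hle
      have hyz : y ≤ z := hz.1 hy
      have hyz' : y < z := lt_of_le_of_ne hyz (by rintro rfl; exact hzx hy.2.2)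
      have hay := (le_max_right _ _).trans_lt hy2
      have h1 := hez y ((le_max_left _ _).trans_lt hy2) hyz'
      have h2 := (h.tot z x haz hzb hax hx2).resolve_left hzx
      exact h1 (h.tr y x z hay hy.2.1 hax hx2 haz hzb hy.2.2 h2)
  have st2 : ∀ x, a1 < x → x < b → NL b (fun y => ¬ le x y) := by
    intro x hx1 hx2
    have hax := ha1.trans_lt hx1
    have hd1 : DefP L (univ : Set M) (fun y => le x y) := dfn
    rcases nl_or hd1 b with h3 | h3
    · exfalso
      obtain ⟨d, hd, hd'⟩ := (h3.and (st1 x hx1 hx2)).and (NL.lt (hab))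
      obtain ⟨y, hy1, hy2⟩ := exists_between hd
      obtain ⟨⟨hy3, hy4⟩, hy5⟩ := hd' y hy1 hy2
      obtain ⟨y', hy'1, hy'2, hy'3⟩ := ((h.mL y hy5.1 hy5.2).and (NL.lt hy1)).exists
      obtain ⟨⟨hy'4, hy'5⟩, hy'6⟩ := hd' y' hy'3.1 (hy'1.trans hy2)
      exact hy'2 (h.tr y' x y hy'6.1 hy'6.2 hax hx2 hy5.1 hy5.2 hy'5 hy3)
    · exact h3
  let V : M → Prop := fun z => a1 < z ∧ z < b ∧ ∃ c, a < c ∧ c < b ∧ NL z (fun y => le c y) ∧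
    NR z (fun y => ¬ le c y)
  have hV : DefP L (univ : Set M) V := dfn
  have hVb : NL b V := by
    apply NL.of_cofinal hV
    intro d hdb
    obtain ⟨x, hx1', hx2⟩ := exists_between (max_lt hdb hab1)
    have hx1 := (le_max_right _ _).trans_lt hx1'
    have hax := ha1.trans_lt hx1
    have hxx : le x x := by rcases h.tot x x hax hx2 hax hx2 with h | h <;> exact h
    obtain ⟨z, hz⟩ := exists_lub (L := L) (P := fun y => x ≤ y ∧ y < b ∧ le x y) dfn
      ⟨x, le_rfl, hx2, hxx⟩ ⟨b, fun y hy => hy.2.1.le⟩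
    have hxz : x < z := by
      obtain ⟨y, hy1, hy2, hy3⟩ := ((h.mR x hax hx2).and (NR.lt hx2)).exists
      refine hy1.trans_le (hz.1 ⟨hy1.le, hy3.2, ?_⟩)
      exact (h.tot x y hax hx2 (hax.trans hy1) hy3.2).resolve_right hy2
    have hzb : z < b := by
      obtain ⟨e, he, he'⟩ := st2 x hx1 hx2
      refine lt_of_le_of_lt (lub_le hz (max e x) ?_) (max_lt he hx2)
      rintro y ⟨hy1, hy2, hy3⟩
      by_contra! hcy
      exact he' y ((le_max_left _ _).trans_lt hcy) hy2 hy3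
    have haz := hax.trans hxz
    have hup : ∀ y, z < y → y < b → ¬ le x y := fun y h1 h2 h3 =>
      absurd (hz.1 ⟨hxz.le.trans h1.le, h2, h3⟩) (not_le.2 h1)
    have hzx : ¬ le x z := by
      intro hxz'
      obtain ⟨y, hy1, hy2, hy3⟩ := ((h.mR z haz hzb).and (NR.lt hzb)).exists
      have := (h.tot z y haz hzb (haz.trans hy1) hy3.2).resolve_right hy2
      exact hup y hy1 hy3.2 (h.tr x z y hax hx2 haz hzb (haz.trans hy1) hy3.2 hxz' this)
    refine ⟨z, ((le_max_left _ _).trans_lt hx1').trans hxz, hzb, hx1.trans hxz, hzb, x, hax, hx2, ?_,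
      ⟨b, hzb, hup⟩⟩
    apply NL.of_cofinal (L := L) dfn
    intro e he
    by_contra! hno
    refine absurd (lub_le hz (e) ?_) (not_le.2 he)
    rintro y hy
    by_contra! hey
    have hyz : y ≤ z := hz.1 hy
    rcases hyz.lt_or_eq with h | h
    · exact hno y hey h hy.2.2
    · exact hzx (h ▸ hy.2.2)
  obtain ⟨a', b', hab', hK⟩ := hVb.fat
  refine ⟨max a a', min b b', le_max_left _ _, ?_, min_le_left _ _, ?_⟩
  · obtain ⟨z, hz1, hz2⟩ := exists_between hab'
    have := hK z hz1 hz2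
    exact (max_lt (ha1.trans_lt this.1) hz1).trans (lt_min this.2.1 hz2)
  · intro z hz1 hz2
    exact (hK z ((le_max_right _ _).trans_lt hz1) (hz2.trans_le (min_le_right _ _))).2.2

theorem LMin.false {le : M → M → Prop} (hd : DefP L (univ : Set M) (fun q : M × M => le q.1 q.2))
    {a b : M} (hab : a < b) (h : LMin le a b) : False := by
  obtain ⟨a', b', h1, h2, h3, h4⟩ := h.half hd hab
  have hO := OMin.dual (L := L) (M := M)
  have hD : @LMin M (dualOrd M) le b' a' := by
    refine @LMin.mk M (dualOrd M) _ _ _ ?_ ?_ ?_ ?_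
    · intro x y hx1 hx2 hy1 hy2
      exact h.tot x y (h1.trans_lt hx2) (lt_of_lt_of_le hx1 h3) (h1.trans_lt hy2) (lt_of_lt_of_le hy1 h3)
    · intro x y z hx1 hx2 hy1 hy2 hz1 hz2
      exact h.tr x y z (h1.trans_lt hx2) (lt_of_lt_of_le hx1 h3) (h1.trans_lt hy2)
        (lt_of_lt_of_le hy1 h3) (h1.trans_lt hz2) (lt_of_lt_of_le hz1 h3)
    · intro x hx1 hx2
      obtain ⟨d, e1, e2⟩ := h.mL x (h1.trans_lt hx2) (lt_of_lt_of_le hx1 h3)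
      exact ⟨d, e1, fun y u v => e2 y v u⟩
    · intro x hx1 hx2
      obtain ⟨d, e1, e2⟩ := h.mR x (h1.trans_lt hx2) (lt_of_lt_of_le hx1 h3)
      exact ⟨d, e1, fun y u v => e2 y v u⟩
  obtain ⟨p, q, k1, k2, k3, k4⟩ := @LMin.half L M _ (dualOrd M) hO (dual_dense M) (dual_nomin M)
    (dual_nomax M) inferInstance le hd b' a' h2 hD
  have k1 : p ≤ b' := k1
  have k2 : q < p := k2
  have k3 : a' ≤ q := k3
  obtain ⟨z, hz1, hz2⟩ := exists_between k2
  obtain ⟨c, c1, c2, c3, c4⟩ := h4 z (k3.trans_lt hz1) (hz2.trans_le k1)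
  obtain ⟨c', c1', c2', ⟨d, d1, d2⟩, ⟨d', d1', d2'⟩⟩ := k4 z hz2 hz1
  have c1' : c' < b' := c1'
  have c2' : a' < c' := c2'
  have n1 : NR z (fun y => le c' y) := ⟨d, d1, fun y u v => d2 y v u⟩
  have n2 : NL z (fun y => ¬ le c' y) := ⟨d', d1', fun y u v => d2' y v u⟩
  have haz : a < z := (h1.trans k3).trans_lt hz1
  have hzb : z < b := hz2.trans_le (k1.trans h3)
  have e1 := h1.trans_lt c2'
  have e2 := lt_of_lt_of_le c1' h3
  obtain ⟨y, y1, ⟨y2, y3⟩, y4⟩ := ((c3.and n2).and (NL.lt haz)).exists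
  obtain ⟨w, w1, ⟨w2, w3⟩, w4⟩ := ((c4.and n1).and (NR.lt hzb)).exists
  rcases h.tot c c' c1 c2 e1 e2 with h5 | h5
  · exact w2 (h.tr c c' w c1 c2 e1 e2 (haz.trans w1) w4.2 h5 w3)
  · exact y3 (h.tr c' c y e1 e2 c1 c2 y4.1 (y1.trans hzb) h5 y2)
end slm
end OM

namespace OM
set_option linter.unusedSectionVars false

section swap
variable {L : FirstOrder.Language} {M : Type u} [L.Structure M] [LinearOrder M] [OMin L M]
variable [DenselyOrdered M] [NoMinOrder M] [NoMaxOrder M] [Nonempty M]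

theorem Fat.mono {P Q : M → Prop} (h : Fat P) (hPQ : ∀ x, P x → Q x) : Fat Q :=
  let ⟨a, b, h1, h2⟩ := h; ⟨a, b, h1, fun x u v => hPQ x (h2 x u v)⟩

/-- Pairwise disjoint fat sets cannot be indexed by an interval. -/
theorem no_disjoint_fat {E : M → M → Prop} (hE : DefP L (univ : Set M) (fun q : M × M => E q.1 q.2))
    (hdis : ∀ x x' y, E x y → E x' y → x = x') {c d : M} (hcd : c < d)
    (hf : ∀ x, c < x → x < d → Fat (E x)) : False := by
  have hred : ∃ c' d', c' < d' ∧ ∀ x, c' < x → x < d' → Fat (E x) ∧ ¬ NM (E x) := by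
    by_cases h0 : ∃ x0, c < x0 ∧ x0 < d ∧ NM (E x0)
    · obtain ⟨x0, h1, h2, h3⟩ := h0
      refine ⟨c, x0, h1, fun x u v => ⟨hf x u (v.trans h2), fun h4 => ?_⟩⟩
      obtain ⟨y, y1, y2⟩ := (h3.and h4).exists
      exact v.ne' (hdis _ _ _ y1 y2)
    · push Not at h0
      exact ⟨c, d, hcd, fun x u v => ⟨hf x u v, h0 x u v⟩⟩
  obtain ⟨c', d', hcd', hf'⟩ := hred
  let V : M → Prop := fun y => ∃ x, NR y (E x) ∧ ¬ (NL y (E x) ∧ E x y)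
  have hV : DefP L (univ : Set M) V := dfn
  have hVf : ¬ Fat V := by
    rintro ⟨p, q, hpq, hK⟩
    obtain ⟨y, y1, y2⟩ := exists_between hpq
    obtain ⟨x, ⟨e, e1, e2⟩, -⟩ := hK y y1 y2
    obtain ⟨y', y'1, y'2⟩ := exists_between (lt_min e1 y2)
    have y'3 := y'2.trans_le (min_le_left _ _)
    obtain ⟨x', hx1, hx2⟩ := hK y' (y1.trans y'1) (y'2.trans_le (min_le_right _ _))
    have hr : NR y' (E x) := ⟨e, y'3, fun t u v => e2 t (y'1.trans u) v⟩
    obtain ⟨t, t1, t2, t3⟩ := (hr.and hx1).exists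
    have := hdis _ _ _ t2 t3
    subst this
    exact hx2 ⟨⟨y, y'1, fun t u v => e2 t u (v.trans y'3)⟩, e2 y' y'1 y'3⟩
  have hVfin := (fat_or_finite hV).resolve_left hVf
  have hsel : ∀ x, c' < x → x < d' → ∃ y, NR y (E x) ∧ ¬ (NL y (E x) ∧ E x y) := by
    intro x hx1 hx2
    obtain ⟨⟨p, q, hpq, hK⟩, hnm⟩ := hf' x hx1 hx2
    obtain ⟨p', p1, p2⟩ := exists_between hpq
    obtain ⟨y, hy⟩ := exists_lub (L := L) (P := fun t => t < p' ∧ ¬ E x t) dfn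
      (by by_contra! h; exact hnm ⟨p', h⟩) ⟨p', fun t ht => ht.1.le⟩
    have hyp : y ≤ p := lub_le hy p (fun t ht => by
      by_contra! h; exact ht.2 (hK t h (ht.1.trans p2)))
    refine ⟨y, ⟨p', hyp.trans_lt p1, fun t u v => ?_⟩, ?_⟩
    · by_contra h
      exact absurd (hy.1 ⟨v, h⟩) (not_le.2 u)
    · rintro ⟨⟨e, e1, e2⟩, h2⟩
      refine absurd (lub_le hy e fun t ht => ?_) (not_le.2 e1)
      by_contra! h
      have hty : t ≤ y := hy.1 ht
      rcases hty.lt_or_eq with h3 | h3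
      · exact ht.2 (e2 t h h3)
      · exact ht.2 (h3 ▸ h2)
  choose! ψ hψ1 hψ2 using hsel
  refine Set.infinite_of_injOn_mapsTo (f := ψ) (s := Ioo c' d') ?_ ?_ (Ioo_infinite hcd') hVfin
  · intro x hx x' hx' hxx
    have h1 := hψ1 x hx.1 hx.2
    have h2 := hψ1 x' hx'.1 hx'.2
    rw [← hxx] at h2
    obtain ⟨t, t1, t2, t3⟩ := (h1.and h2).exists
    exact hdis _ _ _ t2 t3
  · intro x hx
    exact ⟨x, hψ1 x hx.1 hx.2, hψ2 x hx.1 hx.2⟩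

theorem swap_open {S : M → M → Prop} (hS : DefP L (univ : Set M) (fun q : M × M => S q.1 q.2))
    {a b : M} (hab : a < b) (hf : ∀ x, a < x → x < b → Fat (S x))
    (hop : ∀ x y, S x y → NL y (S x) ∧ NR y (S x)) :
    ∃ y, Fat (fun x => a < x ∧ x < b ∧ S x y) := by
  by_contra! hno
  have hfin : ∀ y, {x | a < x ∧ x < b ∧ S x y}.Finite := fun y =>
    (fat_or_finite (L := L) dfn).resolve_left (hno y)
  have hmax : ∀ y x, a < x → x < b → S x y → ∃ m, (a < m ∧ m < b ∧ S m y) ∧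
      ∀ w, a < w → w < b → S w y → w ≤ m := by
    intro y x h1 h2 h3
    obtain ⟨m, hm1, hm2⟩ := Set.exists_max_image _ id (hfin y) ⟨x, h1, h2, h3⟩
    exact ⟨m, hm1, fun w h1 h2 h3 => hm2 w ⟨h1, h2, h3⟩⟩
  let E : M → M → Prop := fun x y => (a < x ∧ x < b ∧ S x y) ∧ ∀ w, a < w → w < b → S w y → w ≤ x
  have hE : DefP L (univ : Set M) (fun q : M × M => E q.1 q.2) := dfn
  have hX : ¬ Fat (fun x => Fat (E x)) := by
    rintro ⟨c, d, hcd, h⟩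
    refine no_disjoint_fat hE ?_ hcd h
    rintro x x' y ⟨⟨h1, h2, h3⟩, h4⟩ ⟨⟨h1', h2', h3'⟩, h4'⟩
    exact le_antisymm (h4' x h1 h2 h3) (h4 x' h1' h2' h3')
  have hX' : NL b (fun x => ¬ Fat (E x)) := by
    have : DefP L (univ : Set M) (fun x => Fat (E x)) := dfn
    rcases nl_or this b with h | h
    · exact absurd h.fat hX
    · exact h
  obtain ⟨e, he, he'⟩ := hX'
  obtain ⟨x, x1, x2⟩ := exists_between (max_lt he hab)
  obtain ⟨p, q, hpq, hJ⟩ := hf x ((le_max_right _ _).trans_lt x1) x2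
  have hax := (le_max_right _ _).trans_lt x1
  let le : M → M → Prop := fun y y' => ∃ w, a < w ∧ w < b ∧ S w y' ∧
    ∀ w', a < w' → w' < b → S w' y → w' ≤ w
  have hle : DefP L (univ : Set M) (fun q : M × M => le q.1 q.2) := dfn
  have key : ∀ y, p < y → y < q → ∃ m, E m y ∧ ¬ Fat (E m) := by
    intro y y1 y2
    obtain ⟨m, hm1, hm2⟩ := hmax y x hax x2 (hJ y y1 y2)
    refine ⟨m, ⟨hm1, hm2⟩, he' m ?_ hm1.2.1⟩
    exact (le_max_left _ _).trans_lt (x1.trans_le (hm2 x hax x2 (hJ y y1 y2)))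
  have key2 : ∀ y m, E m y → ¬ Fat (E m) → ∀ y', S m y' → le y' y → E m y' := by
    rintro y m ⟨h1, h2⟩ h3 y' hs ⟨w, w1, w2, w3, w4⟩
    refine ⟨⟨h1.1, h1.2.1, hs⟩, fun w' a1 a2 a3 => (w4 w' a1 a2 a3).trans (h2 w w1 w2 w3)⟩
  refine LMin.false hle hpq ⟨?_, ?_, ?_, ?_⟩
  · intro y y' a1 a2 a3 a4
    obtain ⟨m, hm1, hm2⟩ := hmax y x hax x2 (hJ y a1 a2)
    obtain ⟨m', hm1', hm2'⟩ := hmax y' x hax x2 (hJ y' a3 a4)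
    rcases le_total m m' with h | h
    · exact Or.inl ⟨m', hm1'.1, hm1'.2.1, hm1'.2.2, fun w b1 b2 b3 => (hm2 w b1 b2 b3).trans h⟩
    · exact Or.inr ⟨m, hm1.1, hm1.2.1, hm1.2.2, fun w b1 b2 b3 => (hm2' w b1 b2 b3).trans h⟩
  · rintro y y' y'' - - - - - - ⟨w, w1, w2, w3, w4⟩ ⟨v, v1, v2, v3, v4⟩
    exact ⟨v, v1, v2, v3, fun w' a1 a2 a3 => (w4 w' a1 a2 a3).trans (v4 w w1 w2 w3)⟩
  · intro y y1 y2
    obtain ⟨m, hm, hmf⟩ := key y y1 y2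
    have h1 := (hop m y hm.1.2.2).2
    have hd : DefP L (univ : Set M) (E m) := dfn
    rcases nr_or hd y with h2 | h2
    · exact absurd h2.fat hmf
    · exact (h1.and h2).mono fun y' h3 h4 => h3.2 (key2 y m hm hmf y' h3.1 h4)
  · intro y y1 y2
    obtain ⟨m, hm, hmf⟩ := key y y1 y2
    have h1 := (hop m y hm.1.2.2).1
    have hd : DefP L (univ : Set M) (E m) := dfn
    rcases nl_or hd y with h2 | h2
    · exact absurd h2.fat hmf
    · exact (h1.and h2).mono fun y' h3 h4 => h3.2 (key2 y m hm hmf y' h3.1 h4)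

theorem swap {S : M → M → Prop} (hS : DefP L (univ : Set M) (fun q : M × M => S q.1 q.2))
    {a b : M} (hab : a < b) (hf : ∀ x, a < x → x < b → Fat (S x)) :
    ∃ y, Fat (fun x => a < x ∧ x < b ∧ S x y) := by
  let S' : M → M → Prop := fun x y => ∃ p q, p < y ∧ y < q ∧ ∀ z, p < z → z < q → S x z
  have hS' : DefP L (univ : Set M) (fun q : M × M => S' q.1 q.2) := dfn
  obtain ⟨y, hy⟩ := swap_open hS' hab (fun x h1 h2 => by
    obtain ⟨p, q, h3, h4⟩ := hf x h1 h2
    exact ⟨p, q, h3, fun y y1 y2 => ⟨p, q, y1, y2, h4⟩⟩) (by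
    rintro x y ⟨p, q, h1, h2, h3⟩
    exact ⟨⟨p, h1, fun z u v => ⟨p, q, u, v.trans h2, h3⟩⟩,
      ⟨q, h2, fun z u v => ⟨p, q, h1.trans u, v, h3⟩⟩⟩)
  exact ⟨y, hy.mono fun x ⟨h1, h2, p, q, h3, h4, h5⟩ => ⟨h1, h2, h5 y h3 h4⟩⟩

end swap
end OM

namespace OM
set_option linter.unusedSectionVars false

section cont
variable {L : FirstOrder.Language} {M : Type u} [L.Structure M] [LinearOrder M] [OMin L M]
variable [DenselyOrdered M] [NoMinOrder M] [NoMaxOrder M] [Nonempty M]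

theorem exists_fun {G : M → M → Prop} (hG : DefP L (univ : Set M) (fun q : M × M => G q.1 q.2))
    {a b : M} (h : ∀ w, a < w → w < b → ∃ y, G w y)
    (hu : ∀ w, a < w → w < b → ∀ y y', G w y → G w y' → y = y') :
    ∃ f : M → M, DefF L (univ : Set M) f ∧ ∀ w, a < w → w < b → G w (f w) := by
  classical
  choose! g hg using h
  let f : M → M := fun w => if a < w ∧ w < b then g w else a
  have hf : ∀ w, a < w → w < b → f w = g w := fun w h1 h2 => by simp [f, h1, h2]
  refine ⟨f, ?_, fun w h1 h2 => by rw [hf w h1 h2]; exact hg w h1 h2⟩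
  unfold DefF
  have : DefP L (univ : Set M) (fun q : M × M => (a < q.1 ∧ q.1 < b ∧ G q.1 q.2) ∨
    (¬ (a < q.1 ∧ q.1 < b) ∧ q.2 = a)) := dfn
  refine this.congr ?_
  rintro ⟨w, y⟩
  by_cases h1 : a < w ∧ w < b
  · have := hg w h1.1 h1.2
    simp only [h1, true_and, not_true_eq_false, false_and, or_false, hf w h1.1 h1.2, and_self]
    exact ⟨fun h2 => hu w h1.1 h1.2 _ _ this h2, fun h => h ▸ this⟩
  · have h2 : f w = a := by simp only [f, h1, if_false]
    rw [h2]
    constructor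
    · rintro (h | h)
      · exact absurd ⟨h.1, h.2.1⟩ h1
      · exact h.2.symm
    · exact fun h => Or.inr ⟨h1, h.symm⟩

theorem no_disc {S : M → M → Prop} (hS : DefP L (univ : Set M) (fun q : M × M => S q.1 q.2))
    (nb : M → (M → Prop) → Prop) (r : M → M → Prop)
    (h1 : ∀ w z, S w z → r w z ∧ nb w (fun w' => ¬ r w' z))
    (hd : ∀ w, (∃ z, S w z) → Fat (S w))
    (hnb : ∀ p q w P, p < w → w < q → nb w P → ∃ w', p < w' ∧ w' < q ∧ P w') :
    ¬ Fat (fun w => ∃ z, S w z) := by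
  rintro ⟨c, d, hcd, h⟩
  obtain ⟨z, p, q, hpq, hz⟩ := swap hS hcd fun w u v => hd w (h w u v)
  obtain ⟨w, w1, w2⟩ := exists_between hpq
  have h2 := (h1 w z (hz w w1 w2).2.2).2
  obtain ⟨w', w3, w4, w5⟩ := hnb p q w _ w1 w2 h2
  exact w5 (h1 w' z (hz w' w3 w4).2.2).1

theorem nr_pick (p q w : M) (P : M → Prop) (h1 : p < w) (h2 : w < q) (h : NR w P) :
    ∃ w', p < w' ∧ w' < q ∧ P w' :=
  let ⟨x, a, b, c⟩ := (h.and (NR.lt h2)).exists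
  ⟨x, h1.trans a, c.2, b⟩
theorem nl_pick (p q w : M) (P : M → Prop) (h1 : p < w) (h2 : w < q) (h : NL w P) :
    ∃ w', p < w' ∧ w' < q ∧ P w' :=
  let ⟨x, a, b, c⟩ := (h.and (NL.lt h1)).exists
  ⟨x, c.1, a.trans h2, b⟩

/-- `P` holds on a neighbourhood of `w`, except perhaps at `w`. -/
def NN (w : M) (P : M → Prop) : Prop := NL w P ∧ NR w P

theorem NN.mono {c : M} {P Q : M → Prop} (h : NN c P) (hPQ : ∀ x, P x → Q x) : NN c Q :=
  ⟨h.1.mono hPQ, h.2.mono hPQ⟩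
theorem NN.and {c : M} {P Q : M → Prop} (h : NN c P) (h' : NN c Q) : NN c (fun x => P x ∧ Q x) :=
  ⟨h.1.and h'.1, h.2.and h'.2⟩

/-- Continuity of `f` at `w`. -/
def Cont (f : M → M) (w : M) : Prop :=
  ∀ y1 y2, y1 < f w → f w < y2 → NN w (fun w' => y1 < f w' ∧ f w' < y2)

theorem cont_ae {f : M → M} (hf : DefF L (univ : Set M) f) : {w | ¬ Cont f w}.Finite := by
  have f1 : {w | ∃ z, f w < z ∧ NR w (fun w' => ¬ f w' < z)}.Finite := by
    refine (fat_or_finite (L := L) dfn).resolve_left (no_disc (L := L) dfn NR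
      (fun w z => f w < z) (fun w z h => h) ?_ nr_pick)
    rintro w ⟨z, h1, h2⟩
    exact ⟨f w, z, h1, fun t u v => ⟨u, h2.mono fun w' h3 h4 => h3 (h4.trans v)⟩⟩
  have f2 : {w | ∃ z, f w < z ∧ NL w (fun w' => ¬ f w' < z)}.Finite := by
    refine (fat_or_finite (L := L) dfn).resolve_left (no_disc (L := L) dfn NL
      (fun w z => f w < z) (fun w z h => h) ?_ nl_pick)
    rintro w ⟨z, h1, h2⟩
    exact ⟨f w, z, h1, fun t u v => ⟨u, h2.mono fun w' h3 h4 => h3 (h4.trans v)⟩⟩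
  have f3 : {w | ∃ z, z < f w ∧ NR w (fun w' => ¬ z < f w')}.Finite := by
    refine (fat_or_finite (L := L) dfn).resolve_left (no_disc (L := L) dfn NR
      (fun w z => z < f w) (fun w z h => h) ?_ nr_pick)
    rintro w ⟨z, h1, h2⟩
    exact ⟨z, f w, h1, fun t u v => ⟨v, h2.mono fun w' h3 h4 => h3 (u.trans h4)⟩⟩
  have f4 : {w | ∃ z, z < f w ∧ NL w (fun w' => ¬ z < f w')}.Finite := by
    refine (fat_or_finite (L := L) dfn).resolve_left (no_disc (L := L) dfn NL
      (fun w z => z < f w) (fun w z h => h) ?_ nl_pick)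
    rintro w ⟨z, h1, h2⟩
    exact ⟨z, f w, h1, fun t u v => ⟨v, h2.mono fun w' h3 h4 => h3 (u.trans h4)⟩⟩
  refine (((f1.union f2).union f3).union f4).subset fun w hw => ?_
  by_contra hc
  apply hw
  simp only [mem_union, mem_ofPred_eq, not_or] at hc
  push Not at hc
  obtain ⟨⟨⟨c1, c2⟩, c3⟩, c4⟩ := hc
  intro y1 y2 h1 h2
  have d1 : DefP L (univ : Set M) (fun w' => f w' < y2) := dfn
  have d2 : DefP L (univ : Set M) (fun w' => y1 < f w') := dfn
  have r1 := (nr_or d1 w).resolve_right (by simpa using c1 y2 h2)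
  have r2 := (nl_or d1 w).resolve_right (by simpa using c2 y2 h2)
  have r3 := (nr_or d2 w).resolve_right (by simpa using c3 y1 h1)
  have r4 := (nl_or d2 w).resolve_right (by simpa using c4 y1 h1)
  exact ⟨r4.and r2, r3.and r1⟩

theorem exists_notin {a b : M} (hab : a < b) {s : Set M} (hs : s.Finite) :
    ∃ w, a < w ∧ w < b ∧ w ∉ s := by
  obtain ⟨w, h1, h2⟩ := (Ioo_infinite hab).exists_notMem_finite hs
  exact ⟨w, h1.1, h1.2, h2⟩

end cont
end OM

namespace OM
set_option linter.unusedSectionVars false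

section count
variable {M : Type u} [LinearOrder M]

/-- At least `j` elements of `S` are below `z`. -/
def AL (S : M → Prop) : ℕ → M → Prop
  | 0, _ => True
  | j+1, z => ∃ t, t < z ∧ S t ∧ AL S j t

theorem al_iff {S : M → Prop} (hS : {t | S t}.Finite) (j : ℕ) (z : M) :
    AL S j z ↔ j ≤ {t | S t ∧ t < z}.ncard := by
  induction j generalizing z with
  | zero => simp [AL]
  | succ j ih =>
    have fin : ∀ z, {t | S t ∧ t < z}.Finite := fun z => hS.subset fun t h => h.1
    simp only [AL]
    constructor
    · rintro ⟨t, h1, h2, h3⟩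
      rw [ih] at h3
      have h4 : insert t {t' | S t' ∧ t' < t} ⊆ {t | S t ∧ t < z} := by
        rintro x (rfl | hx)
        · exact ⟨h2, h1⟩
        · exact ⟨hx.1, hx.2.trans h1⟩
      have h5 := ncard_le_ncard h4 (fin z)
      rw [ncard_insert_of_notMem (by simp) (fin t)] at h5
      omega
    · intro h
      have hne : {t | S t ∧ t < z}.Nonempty := by
        rw [nonempty_iff_ne_empty]; intro h0; rw [h0] at h; simp at h
      obtain ⟨t, ht, hm⟩ := exists_max_image _ id (fin z) hne
      refine ⟨t, ht.2, ht.1, (ih t).2 ?_⟩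
      have h4 : {t | S t ∧ t < z} ⊆ insert t {t' | S t' ∧ t' < t} := by
        intro x hx
        rcases (hm x hx).lt_or_eq with h | h
        · exact Or.inr ⟨hx.1, h⟩
        · exact Or.inl h
      have h5 := ncard_le_ncard h4 ((fin t).insert t)
      have h6 := ncard_insert_le t {t' | S t' ∧ t' < t}
      omega

theorem al_total [NoMaxOrder M] [Nonempty M] {S : M → Prop} (hS : {t | S t}.Finite) (j : ℕ) :
    (∃ z, AL S j z) ↔ j ≤ {t | S t}.ncard := by
  constructor
  · rintro ⟨z, h⟩
    rw [al_iff hS] at h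
    exact h.trans (ncard_le_ncard (fun t h => h.1) hS)
  · intro h
    obtain ⟨b, hb⟩ := hS.bddAbove
    obtain ⟨z, hz⟩ := exists_gt b
    refine ⟨z, (al_iff hS j z).2 ?_⟩
    have : {t | S t ∧ t < z} = {t | S t} := by
      ext t; exact ⟨fun h => h.1, fun h => ⟨h, (hb h).trans_lt hz⟩⟩
    rwa [this]
end count

section
variable {L : FirstOrder.Language} {M : Type u} [L.Structure M] [LinearOrder M] [OMin L M]
variable {X : Type u} [Crd M X] {A : Set M}

theorem DefP.al {S : X → M → Prop} (hS : DefP L A (fun q : X × M => S q.1 q.2)) (j : ℕ) :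
    DefP L A (fun q : X × M => AL (S q.1) j q.2) := by
  induction j with
  | zero => simp only [AL]; exact dfn
  | succ j ih => 
    simp only [AL]
    let H : X → M → Prop := fun x y => AL (S x) j y
    have hH : DefP L A (fun q : X × M => H q.1 q.2) := ih
    have : DefP L A (fun q : X × M => ∃ t, t < q.2 ∧ S q.1 t ∧ H q.1 t) := dfn
    exact this

theorem DefP.ncard [NoMaxOrder M] [Nonempty M] {S : X → M → Prop} (hS : DefP L A (fun q : X × M => S q.1 q.2))
    (hf : ∀ x, {t | S x t}.Finite) (j : ℕ) : DefP L A (fun x => {t | S x t}.ncard = j) := by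
  have h1 := DefP.al hS j
  have h2 := DefP.al hS (j+1)
  refine DefP.congr ((DefP.ex (P := fun x z => AL (S x) j z) h1).and (DefP.ex (P := fun x z => AL (S x) (j+1) z) h2).not) fun x => ?_
  rw [al_total (hf x), al_total (hf x)]; omega
end

section kprime
variable {L : FirstOrder.Language} {M : Type u} [L.Structure M] [LinearOrder M] [OMin L M]
variable [DenselyOrdered M] [NoMinOrder M] [NoMaxOrder M] [Nonempty M]

theorem fat_sub {P : M → Prop} (h : DefP L (univ : Set M) P) {a b : M} (hab : a < b) :
    ∃ c d, a ≤ c ∧ c < d ∧ d ≤ b ∧ ((∀ x, c < x → x < d → P x) ∨ (∀ x, c < x → x < d → ¬ P x)) := by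
  rcases nr_or h a with ⟨d, h1, h2⟩ | ⟨d, h1, h2⟩
  · exact ⟨a, min d b, le_rfl, lt_min h1 hab, min_le_right _ _, Or.inl fun x u v =>
      h2 x u (v.trans_le (min_le_left _ _))⟩
  · exact ⟨a, min d b, le_rfl, lt_min h1 hab, min_le_right _ _, Or.inr fun x u v =>
      h2 x u (v.trans_le (min_le_left _ _))⟩

theorem DefP.nn {X : Type u} [Crd M X] {A : Set M} {f : X → M} {P : X → M → Prop} (hf : DefF L A f)
    (hP : DefP L A (fun q : X × M => P q.1 q.2)) : DefP L A (fun x => NN (f x) (P x)) := by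
  unfold NN; exact dfn

theorem NN.of_mem {P : M → Prop} {c d w : M} (h1 : c < w) (h2 : w < d)
    (h : ∀ x, c < x → x < d → P x) : NN w P :=
  ⟨⟨c, h1, fun x u v => h x u (v.trans h2)⟩, ⟨d, h2, fun x u v => h x (h1.trans u) v⟩⟩

theorem bd_finite {P : M → Prop} (h : DefP L (univ : Set M) P) :
    {w | ¬ NN w (fun w' => P w' ↔ P w)}.Finite := by
  refine (fat_or_finite (L := L) (by unfold NN; exact dfn)).resolve_left ?_
  rintro ⟨a, b, hab, hh⟩
  obtain ⟨c, d, h1, h2, h3, h4⟩ := fat_sub h hab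
  obtain ⟨w, hw1, hw2⟩ := exists_between h2
  refine hh w (h1.trans_lt hw1) (hw2.trans_le h3) (NN.of_mem hw1 hw2 fun x u v => ?_)
  rcases h4 with h4 | h4
  · simp [h4 x u v, h4 w hw1 hw2]
  · simp [h4 x u v, h4 w hw1 hw2]

variable {D : M → M → Prop}

/-- niceness at `+∞` -/
def NcP (D : M → M → Prop) (w : M) : Prop :=
  ∃ q, (∀ z, q ≤ z → ¬ D w z) ∧ NN w (fun w' => ∀ z, q ≤ z → ¬ D w' z)
/-- niceness at `-∞` -/
def NcM (D : M → M → Prop) (w : M) : Prop :=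
  ∃ q, (∀ z, z ≤ q → ¬ D w z) ∧ NN w (fun w' => ∀ z, z ≤ q → ¬ D w' z)
/-- niceness at a point -/
def Nc (D : M → M → Prop) (w y : M) : Prop :=
  ∃ p q, p < y ∧ y < q ∧ (∀ z, p < z → z < q → D w z → z = y) ∧
    ∀ p' q', p < p' → p' < y → y < q' → q' < q → NN w (fun w' =>
      ((∃ z, p' ≤ z ∧ z < q' ∧ D w' z) ↔ D w y) ∧
      ∀ z z', p' ≤ z → z < q' → D w' z → p' ≤ z' → z' < q' → D w' z' → z = z')

theorem ncP_ae (hD : DefP L (univ : Set M) (fun q : M × M => D q.1 q.2))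
    (hf : ∀ w, {y | D w y}.Finite) : {w | ¬ NcP D w}.Finite := by
  refine (fat_or_finite (L := L) (by unfold NcP NN; exact dfn)).resolve_left ?_
  rintro ⟨a, b, hab, hh⟩
  have hE : DefP L (univ : Set M) (fun w => ∃ y, D w y) := dfn
  obtain ⟨c, d, h1, h2, h3, h4⟩ := fat_sub hE hab
  rcases h4 with h4 | h4
  · obtain ⟨m, hm, hm'⟩ := exists_fun (L := L) (G := fun w y => D w y ∧ ∀ y', D w y' → y' ≤ y) dfn
      (a := c) (b := d) (fun w u v => by
        obtain ⟨t, ht, hm⟩ := exists_max_image _ id (hf w) (h4 w u v)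
        exact ⟨t, ht, hm⟩)
      (fun w u v y y' h h' => le_antisymm (h'.2 _ h.1) (h.2 _ h'.1))
    obtain ⟨w, w1, w2, w3⟩ := exists_notin h2 (cont_ae (L := L) hm)
    simp only [mem_ofPred_eq, not_not] at w3
    refine hh w (h1.trans_lt w1) (w2.trans_le h3) ?_
    obtain ⟨p, hp⟩ := exists_lt (m w)
    obtain ⟨q, hq⟩ := exists_gt (m w)
    refine ⟨q, fun z hz h => ((hm' w w1 w2).2 z h).not_gt (hq.trans_le hz), ?_⟩
    refine ((w3 p q hp hq).and (NN.of_mem w1 w2 fun x u v => And.intro u v)).mono ?_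
    rintro w' ⟨⟨_, k1⟩, k2, k3⟩ z hz h
    exact ((hm' w' k2 k3).2 z h).not_gt (k1.trans_le hz)
  · obtain ⟨w, w1, w2⟩ := exists_between h2
    refine hh w (h1.trans_lt w1) (w2.trans_le h3) ⟨w, fun z _ h => h4 w w1 w2 ⟨z, h⟩, ?_⟩
    exact NN.of_mem w1 w2 fun x u v z _ h => h4 x u v ⟨z, h⟩

theorem ncM_ae (hD : DefP L (univ : Set M) (fun q : M × M => D q.1 q.2))
    (hf : ∀ w, {y | D w y}.Finite) : {w | ¬ NcM D w}.Finite := by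
  have hO := OMin.dual (L := L) (M := M)
  have := @ncP_ae L M _ (dualOrd M) hO (dual_dense M) (dual_nomin M) (dual_nomax M) inferInstance
    D hD hf
  refine this.subset ?_
  rintro w h ⟨q, h1, ⟨d1, h2, h3⟩, ⟨d2, h4, h5⟩⟩
  exact h ⟨q, h1, ⟨d2, h4, fun x u v => h5 x v u⟩, ⟨d1, h2, fun x u v => h3 x v u⟩⟩

/-- no points of `D` just above `β`, locally uniformly -/
def Up (D : M → M → Prop) (β : M → M) (w : M) : Prop :=
  ∃ q, β w < q ∧ (∀ z, β w < z → z < q → ¬ D w z) ∧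
    ∀ q', β w < q' → q' < q → NN w (fun w' => ∀ z, β w' < z → z ≤ q' → ¬ D w' z)
def Dn (D : M → M → Prop) (β : M → M) (w : M) : Prop :=
  ∃ q, q < β w ∧ (∀ z, z < β w → q < z → ¬ D w z) ∧
    ∀ q', q' < β w → q < q' → NN w (fun w' => ∀ z, z < β w' → q' ≤ z → ¬ D w' z)

theorem up_ae (hD : DefP L (univ : Set M) (fun q : M × M => D q.1 q.2))
    (hf : ∀ w, {y | D w y}.Finite) {β : M → M} (hβ : DefF L (univ : Set M) β) :
    {w | ¬ Up D β w}.Finite := by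
  refine (fat_or_finite (L := L) (by unfold Up NN; exact dfn)).resolve_left ?_
  rintro ⟨a, b, hab, hh⟩
  have hE : DefP L (univ : Set M) (fun w => ∃ y, D w y ∧ β w < y) := dfn
  obtain ⟨c, d, h1, h2, h3, h4⟩ := fat_sub hE hab
  rcases h4 with h4 | h4
  · obtain ⟨m, hm, hm'⟩ := exists_fun (L := L)
      (G := fun w y => (D w y ∧ β w < y) ∧ ∀ y', (D w y' ∧ β w < y') → y ≤ y') dfn
      (a := c) (b := d) (fun w u v => by
        obtain ⟨t, ht, hm⟩ := exists_min_image {y | D w y ∧ β w < y} id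
          ((hf w).subset fun y h => h.1) (h4 w u v)
        exact ⟨t, ht, hm⟩)
      (fun w u v y y' h h' => le_antisymm (h.2 _ h'.1) (h'.2 _ h.1))
    obtain ⟨w, w1, w2, w3⟩ := exists_notin h2 (cont_ae (L := L) hm)
    simp only [mem_ofPred_eq, not_not] at w3
    refine hh w (h1.trans_lt w1) (w2.trans_le h3) ?_
    have k0 := hm' w w1 w2
    obtain ⟨q, hq⟩ := exists_gt (m w)
    refine ⟨m w, k0.1.2, fun z hz hz' h => (k0.2 z ⟨h, hz⟩).not_gt hz', fun q' h5 h6 => ?_⟩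
    refine ((w3 q' q h6 hq).and (NN.of_mem w1 w2 fun x u v => And.intro u v)).mono ?_
    rintro w' ⟨⟨k1, _⟩, k2, k3⟩ z hz hz' h
    exact ((hm' w' k2 k3).2 z ⟨h, hz⟩).not_gt (hz'.trans_lt k1)
  · obtain ⟨w, w1, w2⟩ := exists_between h2
    obtain ⟨q, hq⟩ := exists_gt (β w)
    refine hh w (h1.trans_lt w1) (w2.trans_le h3) ⟨q, hq, fun z h5 _ h => h4 w w1 w2 ⟨z, h, h5⟩, ?_⟩
    intro q' _ _
    exact NN.of_mem w1 w2 fun x u v z h5 _ h => h4 x u v ⟨z, h, h5⟩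

theorem dn_ae (hD : DefP L (univ : Set M) (fun q : M × M => D q.1 q.2))
    (hf : ∀ w, {y | D w y}.Finite) {β : M → M} (hβ : DefF L (univ : Set M) β) :
    {w | ¬ Dn D β w}.Finite := by
  have hO := OMin.dual (L := L) (M := M)
  have := @up_ae L M _ (dualOrd M) hO (dual_dense M) (dual_nomin M) (dual_nomax M) inferInstance
    D hD hf β hβ
  refine this.subset ?_
  rintro w h ⟨q, h1, h0, h2⟩
  refine h ⟨q, h1, h0, fun q' k1 k2 => ?_⟩
  obtain ⟨⟨d1, h2, h3⟩, ⟨d2, h4, h5⟩⟩ := h2 q' k1 k2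
  exact ⟨⟨d2, h4, fun x u v => h5 x v u⟩, ⟨d1, h2, fun x u v => h3 x v u⟩⟩

theorem Nc.right {w β : M} (h : Nc D w β) : NR β (fun y => Nc D w y) := by
  obtain ⟨p, q, h1, h2, h3, h4⟩ := h
  refine ⟨q, h2, fun y u v => ⟨β, q, u, v, fun z k1 k2 k3 => ?_, fun p' q' k1 k2 k3 k4 => ?_⟩⟩
  · exact absurd (h3 z (h1.trans k1) k2 k3) k1.ne'
  · obtain ⟨p0, l1, l2⟩ := exists_between h1
    have e1 := h4 p0 q' l1 l2 (u.trans k3) k4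
    have e2 := h4 p0 p' l1 l2 k1 (k2.trans v)
    have hy : ¬ D w y := fun h => u.ne' (h3 y (h1.trans u) v h)
    refine (e1.and e2).mono ?_
    rintro w' ⟨⟨a1, a2⟩, b1, b2⟩
    have key : ∀ z, p' ≤ z → z < q' → D w' z → False := fun z m1 m2 m3 => by
      have lp : p0 ≤ z := (l2.trans k1).le.trans m1
      obtain ⟨z', n1, n2, n3⟩ := b1.2 (a1.1 ⟨z, lp, m2, m3⟩)
      exact (n2.trans_le m1).ne (a2 z' z n1 (n2.trans (k2.trans k3)) n3 lp m2 m3)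
    exact ⟨⟨fun ⟨z, m1, m2, m3⟩ => (key z m1 m2 m3).elim, fun h => absurd h hy⟩,
      fun z z' m1 m2 m3 => (key z m1 m2 m3).elim⟩

theorem nc_ae (hD : DefP L (univ : Set M) (fun q : M × M => D q.1 q.2))
    (hf : ∀ w, {y | D w y}.Finite) : {w | ¬ ∀ y, Nc D w y}.Finite := by
  have hNc : DefP L (univ : Set M) (fun q : M × M => Nc D q.1 q.2) := by
    unfold Nc NN; exact dfn
  have hNM : DefP L (univ : Set M) (fun w => NcM D w) := by
    unfold NcM NN; exact dfn
  refine Finite.subset (s := {w | ¬ NcM D w} ∪ {w | NcM D w ∧ ¬ ∀ y, Nc D w y}) ((ncM_ae hD hf).union ?_)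
    (fun w hw => by by_cases h : NcM D w; exacts [Or.inr ⟨h, hw⟩, Or.inl h])
  refine (fat_or_finite (L := L) ?_).resolve_left ?_
  · have : DefP L (univ : Set M) (fun w => ∀ y, Nc D w y) := DefP.all hNc
    exact hNM.and this.not
  rintro ⟨c, d, hcd, hh⟩
  obtain ⟨β, hβ, hβ'⟩ := exists_fun (L := L)
      (G := fun w y => ¬ Nc D w y ∧ ∀ y', y' < y → Nc D w y')
      (hNc.not.and (DefP.all (DefP.imp (DefP.lt DefF.snd0 DefF.fst0.snd) (DefP.comp2 hNc DefF.fst0.fst DefF.snd0))))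
      (a := c) (b := d) (fun w u v => by
        obtain ⟨⟨q, hq1, hq2⟩, hb⟩ := hh w u v
        push Not at hb
        have hdef : DefP L (univ : Set M) (fun y => ¬ Nc D w y) :=
          (DefP.comp2 hNc (DefF.const w) DefF.id).not
        have hlow : ∀ y, ¬ Nc D w y → q ≤ y := by
          intro y hy
          by_contra hlt
          push Not at hlt
          apply hy
          obtain ⟨p, hp⟩ := exists_lt y
          have hyD : ¬ D w y := hq1 y hlt.le
          refine ⟨p, q, hp, hlt, fun z _ k2 k3 => absurd k3 (hq1 z k2.le), fun p' q' k1 k2 k3 k4 => ?_⟩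
          refine hq2.mono fun w' h => ?_
          have key : ∀ z, p' ≤ z → z < q' → D w' z → False := fun z m1 m2 m3 =>
            h z (m2.trans k4).le m3
          exact ⟨⟨fun ⟨z, m1, m2, m3⟩ => (key z m1 m2 m3).elim, fun h => absurd h hyD⟩,
            fun z z' m1 m2 m3 => (key z m1 m2 m3).elim⟩
        obtain ⟨β, hβ⟩ := exists_glb hdef hb ⟨q, hlow⟩
        refine ⟨β, fun hnice => ?_, fun y' hy' => ?_⟩
        · obtain ⟨e, he1, he2⟩ := hnice.right
          have : e ≤ β := le_glb hβ e fun y hy => by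
            by_contra hlt
            push Not at hlt
            rcases (hβ.1 hy).lt_or_eq with h | h
            · exact hy (he2 y h hlt)
            · exact hy (h ▸ hnice)
          exact this.not_gt he1
        · by_contra h
          exact (hβ.1 h).not_gt hy')
      (fun w u v y y' h h' => by
        rcases lt_trichotomy y y' with k | k | k
        · exact absurd (h'.2 y k) h.1
        · exact k
        · exact absurd (h.2 y' k) h'.1)
  have hDb : DefP L (univ : Set M) (fun w => D w (β w)) := dfn
  obtain ⟨w, w1, w2, w3⟩ := exists_notin hcd ((((cont_ae (L := L) hβ).union (up_ae hD hf hβ)).union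
    (dn_ae hD hf hβ)).union (bd_finite hDb))
  simp only [mem_union, mem_ofPred_eq, not_or, not_not] at w3
  obtain ⟨⟨⟨hc, q, q1, q2, q3⟩, p, p1, p2, p3⟩, hb⟩ := w3
  refine (hβ' w w1 w2).1 ⟨p, q, p1, q1, ?_, ?_⟩
  · intro z k1 k2 k3
    rcases lt_trichotomy z (β w) with k | k | k
    · exact absurd k3 (p2 z k k1)
    · exact k
    · exact absurd k3 (q2 z k k2)
  · intro p' q' k1 k2 k3 k4
    refine ((hc p' q' k2 k3).and ((q3 q' k3 k4).and ((p3 p' k2 k1).and hb))).mono ?_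
    rintro w' ⟨⟨l1, l2⟩, l3, l4, l5⟩
    have key : ∀ z, p' ≤ z → z < q' → D w' z → z = β w' := fun z m1 m2 m3 => by
      rcases lt_trichotomy z (β w') with k | k | k
      · exact absurd m3 (l4 z k m1)
      · exact k
      · exact absurd m3 (l3 z k m2.le)
    rw [← l5]
    refine ⟨⟨fun ⟨z, m1, m2, m3⟩ => key z m1 m2 m3 ▸ m3, fun h => ⟨β w', l1.le, l2, h⟩⟩, ?_⟩
    intro z z' m1 m2 m3 n1 n2 n3
    rw [key z m1 m2 m3, key z' n1 n2 n3]

/-- Everything is nice at `w`. -/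
def Nice (D : M → M → Prop) (w : M) : Prop := NcM D w ∧ NcP D w ∧ ∀ y, Nc D w y

theorem nice_ae (hD : DefP L (univ : Set M) (fun q : M × M => D q.1 q.2))
    (hf : ∀ w, {y | D w y}.Finite) : {w | ¬ Nice D w}.Finite := by
  refine (((ncM_ae hD hf).union (ncP_ae hD hf)).union (nc_ae hD hf)).subset fun w hw => ?_
  simp only [Nice, mem_ofPred_eq, mem_union] at *
  tauto

theorem Nice.ncard (hD : DefP L (univ : Set M) (fun q : M × M => D q.1 q.2))
    (hf : ∀ w, {y | D w y}.Finite) {w : M} (hw : Nice D w) :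
    NN w (fun w' => {y | D w' y}.ncard = {y | D w y}.ncard) := by
  obtain ⟨⟨q, hq1, hq2⟩, ⟨r, hr1, hr2⟩, hn⟩ := hw
  let T : M → Prop := fun z => ¬ D w z ∧
    NN w (fun w' => {y | D w' y ∧ y < z}.ncard = {y | D w y ∧ y < z}.ncard)
  have fin : ∀ w z, {t | D w t ∧ t < z}.Finite := fun w z => (hf w).subset fun t h => h.1
  have hT : DefP L (univ : Set M) T := by
    have h1 : ∀ j, DefP L (univ : Set M) (fun q : M × M => {y | D q.1 y ∧ y < q.2}.ncard = j) := fun j =>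
      DefP.ncard (S := fun (q : M × M) y => D q.1 y ∧ y < q.2) dfn (fun q => fin q.1 q.2) j
    let n := {y | D w y}.ncard
    let P : Fin (n+1) → M → M → Prop := fun j w z => {y | D w y ∧ y < z}.ncard = j
    have hP : ∀ j, DefP L (univ : Set M) (fun q : M × M => P j q.1 q.2) := fun j => h1 j
    have : DefP L (univ : Set M) (fun z => ¬ D w z ∧ ∃ j, P j w z ∧ NN w (fun w' => P j w' z)) := by
      unfold NN
      refine DefP.and dfn (DefP.exFin fun j => ?_)
      have := hP j
      have e1 : DefP L (univ : Set M) (P j w) := DefP.comp2 (hP j) (DefF.const w) DefF.id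
      exact dfn
    refine this.congr fun z => and_congr_right fun _ => ⟨?_, ?_⟩
    · rintro ⟨j, h1, h2⟩
      simp only [P] at h1 h2
      rw [h1]; exact h2
    · intro h
      have hlt : {y | D w y ∧ y < z}.ncard < n + 1 :=
        Nat.lt_succ_of_le (ncard_le_ncard (fun t h => h.1) (hf w))
      exact ⟨⟨_, hlt⟩, rfl, h⟩
  have hTq : T q := by
    refine ⟨hq1 q le_rfl, hq2.mono fun w' h => ?_⟩
    have e1 : {y | D w' y ∧ y < q} = ∅ := by
      ext y; simp only [mem_ofPred_eq, mem_empty_iff_false, iff_false]; exact fun k => h y k.2.le k.1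
    have e2 : {y | D w y ∧ y < q} = ∅ := by
      ext y; simp only [mem_ofPred_eq, mem_empty_iff_false, iff_false]; exact fun k => hq1 y k.2.le k.1
    rw [e1, e2]
  have unb : ∀ b, ∃ z, T z ∧ b < z := by
    by_contra hb
    push Not at hb
    obtain ⟨b, hb⟩ := hb
    obtain ⟨c, hc⟩ := exists_lub hT ⟨q, hTq⟩ ⟨b, hb⟩
    obtain ⟨p, q, h1, h2, h3, h4⟩ := hn c
    obtain ⟨q', l1, l2⟩ := exists_between h2
    have hDq' : ¬ D w q' := fun h => l1.ne' (h3 q' (h1.trans l1) l2 h)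
    -- find the left endpoint
    have : ∃ z, T z ∧ p < z ∧ z ≤ c := by
      by_contra hno
      push Not at hno
      have : c ≤ p := lub_le hc p fun y hy => by
        by_contra hlt
        push Not at hlt
        exact (hno y hy hlt).not_ge (hc.1 hy)
      exact this.not_gt h1
    obtain ⟨z, hz, z1, z2⟩ := this
    suffices T q' from (hc.1 this).not_gt l1
    have hcount : NN w (fun w' => {y | D w' y ∧ z ≤ y ∧ y < q'}.ncard =
        {y | D w y ∧ z ≤ y ∧ y < q'}.ncard) := by
      rcases z2.lt_or_eq with z3 | z3
      · refine (h4 z q' z1 z3 l1 l2).mono ?_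
        rintro w' ⟨k1, k2⟩
        by_cases hDc : D w c
        · obtain ⟨t, t1, t2, t3⟩ := k1.2 hDc
          have e1 : {y | D w' y ∧ z ≤ y ∧ y < q'} = {t} := by
            ext y; simp only [mem_ofPred_eq, mem_singleton_iff]
            exact ⟨fun k => k2 y t k.2.1 k.2.2 k.1 t1 t2 t3, fun k => k ▸ ⟨t3, t1, t2⟩⟩
          have e2 : {y | D w y ∧ z ≤ y ∧ y < q'} = {c} := by
            ext y; simp only [mem_ofPred_eq, mem_singleton_iff]
            exact ⟨fun k => h3 y (z1.trans_le k.2.1) (k.2.2.trans l2) k.1, fun k => k ▸ ⟨hDc, z2, l1⟩⟩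
          rw [e1, e2, ncard_singleton, ncard_singleton]
        · have e1 : {y | D w' y ∧ z ≤ y ∧ y < q'} = ∅ := by
            ext y; simp only [mem_ofPred_eq, mem_empty_iff_false, iff_false]
            exact fun k => hDc (k1.1 ⟨y, k.2.1, k.2.2, k.1⟩)
          have e2 : {y | D w y ∧ z ≤ y ∧ y < q'} = ∅ := by
            ext y; simp only [mem_ofPred_eq, mem_empty_iff_false, iff_false]
            exact fun k => hDc (h3 y (z1.trans_le k.2.1) (k.2.2.trans l2) k.1 ▸ k.1)
          rw [e1, e2]
      · have hDc : ¬ D w c := z3 ▸ hz.1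
        obtain ⟨p', m1, m2⟩ := exists_between h1
        refine (h4 p' q' m1 m2 l1 l2).mono ?_
        rintro w' ⟨k1, k2⟩
        have e1 : {y | D w' y ∧ z ≤ y ∧ y < q'} = ∅ := by
          ext y; simp only [mem_ofPred_eq, mem_empty_iff_false, iff_false]
          exact fun k => hDc (k1.1 ⟨y, m2.le.trans (z3 ▸ k.2.1), k.2.2, k.1⟩)
        have e2 : {y | D w y ∧ z ≤ y ∧ y < q'} = ∅ := by
          ext y; simp only [mem_ofPred_eq, mem_empty_iff_false, iff_false]
          exact fun k => hDc (h3 y (z1.trans_le k.2.1) (k.2.2.trans l2) k.1 ▸ k.1)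
        rw [e1, e2]
    refine ⟨hDq', (hcount.and hz.2).mono ?_⟩
    rintro w' ⟨k1, k2⟩
    have dec : ∀ w, {y | D w y ∧ y < q'}.ncard =
        {y | D w y ∧ y < z}.ncard + {y | D w y ∧ z ≤ y ∧ y < q'}.ncard := by
      intro w
      rw [← ncard_union_eq _ (fin w z) ((hf w).subset fun t h => h.1)]
      · congr 1
        ext y
        simp only [mem_ofPred_eq, mem_union]
        constructor
        · rintro ⟨a, b⟩
          rcases lt_or_ge y z with h | h
          · exact Or.inl ⟨a, h⟩
          · exact Or.inr ⟨a, h, b⟩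
        · rintro (⟨a, b⟩ | ⟨a, b, c⟩)
          · exact ⟨a, b.trans (z2.trans_lt l1)⟩
          · exact ⟨a, c⟩
      · rw [Set.disjoint_left]
        rintro y ⟨_, a⟩ ⟨_, b, _⟩
        exact a.not_ge b
    rw [dec w', dec w, k1, k2]
  obtain ⟨z, ⟨_, hz⟩, hrz⟩ := unb r
  refine (hz.and hr2).mono ?_
  rintro w' ⟨k1, k2⟩
  have e1 : {y | D w' y} = {y | D w' y ∧ y < z} := by
    ext y
    exact ⟨fun h => ⟨h, lt_of_not_ge fun h' => k2 y (hrz.le.trans h') h⟩, fun h => h.1⟩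
  have e2 : {y | D w y} = {y | D w y ∧ y < z} := by
    ext y
    exact ⟨fun h => ⟨h, lt_of_not_ge fun h' => hr1 y (hrz.le.trans h') h⟩, fun h => h.1⟩
  rw [e1, e2, k1]

end kprime
end OM

namespace OM
set_option linter.unusedSectionVars false

section
variable {L : FirstOrder.Language} {M : Type u} [L.Structure M]

theorem card_pow (M : Type u) (n : ℕ) : Nat.card (Crd.ι M (Pow M n)) = n := by
  induction n with
  | zero => 
    have : IsEmpty (Crd.ι M (Pow M 0)) := by
      exact (inferInstance : IsEmpty Empty)
    simp
  | succ n ih =>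
    have : Nat.card (Crd.ι M (Pow M (n+1))) = Nat.card (Unit ⊕ Crd.ι M (Pow M n)) := rfl
    rw [this, Nat.card_sum, ih]; simp [add_comm]

theorem exists_pow (L : FirstOrder.Language) {M : Type u} [L.Structure M] (X : Type u) [Crd M X] :
    ∃ (n : ℕ) (f : X → Pow M n) (g : Pow M n → X),
    (∀ A : Set M, DefF L A f) ∧ (∀ A : Set M, DefF L A g) ∧ (∀ x, g (f x) = x) ∧ ∀ y, f (g y) = y := by
  let n := Nat.card (Crd.ι M X)
  have e : Crd.ι M (Pow M n) ≃ Crd.ι M X := by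
    apply Classical.choice
    rw [← Finite.card_eq]
    exact card_pow M n
  refine ⟨n, fun x => Crd.e.symm (Crd.e x ∘ e), fun y => Crd.e.symm (Crd.e y ∘ e.symm), 
    fun A => DefF.of_reindex _ e (by intro x; simp), fun A => DefF.of_reindex _ e.symm (by intro x; simp), ?_, ?_⟩
  · intro x; simp [Function.comp_assoc]
  · intro x; simp [Function.comp_assoc]
end

section
variable {M : Type u} [LinearOrder M]
/-- Largeness of a subset of `M^j`. -/
def Lg : (j : ℕ) → (Pow M j → Prop) → Prop
  | 0, R => R PUnit.unit
  | j+1, R => Fat (fun w : M => Lg j (fun ρ => R (w, ρ)))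
end

section uf
variable {L : FirstOrder.Language} {M : Type u} [L.Structure M] [LinearOrder M] [OMin L M]

theorem DefP.lg (j : ℕ) {X : Type u} [Crd M X] {A : Set M} {R : X → Pow M j → Prop}
    (hR : DefP L A (fun q : X × Pow M j => R q.1 q.2)) : DefP L A (fun x => Lg j (R x)) := by
  induction j generalizing X with
  | zero =>
    simp only [Lg]
    refine DefP.congr (DefP.ex (P := fun x ρ => R x ρ) hR) fun x => ⟨?_, fun h => ⟨_, h⟩⟩
    rintro ⟨⟨⟩, h⟩; exact h
  | succ j ih =>
    simp only [Lg]
    refine DefP.fat (P := fun x w => Lg j (fun ρ => R x (w, ρ))) ?_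
    refine ih (X := X × M) (R := fun q ρ => R q.1 (q.2, ρ)) ?_
    exact DefP.comp2 hR DefF.fst0.fst (DefF.pair DefF.fst0.snd DefF.snd0)

variable [DenselyOrdered M] [NoMinOrder M] [NoMaxOrder M] [Nonempty M]

theorem swapj (j : ℕ) {R : M → Pow M j → Prop}
    (hR : DefP L (univ : Set M) (fun q : M × Pow M j => R q.1 q.2)) {a b : M} (hab : a < b)
    (h : ∀ w, a < w → w < b → Lg j (R w)) : ∃ ρ, Fat (fun w => a < w ∧ w < b ∧ R w ρ) := by
  induction j generalizing a b with
  | zero => exact ⟨PUnit.unit, a, b, hab, fun x u v => ⟨u, v, h x u v⟩⟩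
  | succ j ih =>
    have hS : DefP L (univ : Set M) (fun q : M × M => Lg j (fun ρ => R q.1 (q.2, ρ))) :=
      DefP.lg j (X := M × M) (R := fun q ρ => R q.1 (q.2, ρ))
        (DefP.comp2 hR DefF.fst0.fst (DefF.pair DefF.fst0.snd DefF.snd0))
    obtain ⟨v, c, d, hcd, hv⟩ := swap (S := fun w v => Lg j (fun ρ => R w (v, ρ))) hS hab h
    obtain ⟨ρ, hρ⟩ := ih (R := fun w ρ => R w (v, ρ))
      (DefP.comp2 hR DefF.fst0 (DefF.pair (DefF.const v) DefF.snd0)) hcd fun w u v => (hv w u v).2.2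
    exact ⟨(v, ρ), hρ.mono fun w hw => ⟨(hv w hw.1 hw.2.1).1, (hv w hw.1 hw.2.1).2.1, hw.2.2⟩⟩

theorem conn {P : M → Prop} (hP : DefP L (univ : Set M) P) {w1 w2 : M} (h12 : w1 ≤ w2)
    (h : ∀ w, w1 ≤ w → w ≤ w2 → NN w (fun w' => P w' ↔ P w)) (h1 : P w1) : P w2 := by
  by_contra h2
  let Q : M → Prop := fun z => w1 ≤ z ∧ z ≤ w2 ∧ ¬ P z
  have hQ : DefP L (univ : Set M) Q := dfn
  obtain ⟨c, hc⟩ := exists_glb hQ ⟨w2, h12, le_rfl, h2⟩ ⟨w1, fun x hx => hx.1⟩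
  have c1 : w1 ≤ c := le_glb hc w1 fun y hy => hy.1
  have c2 : c ≤ w2 := hc.1 ⟨h12, le_rfl, h2⟩
  obtain ⟨⟨d, d1, d2⟩, ⟨e, e1, e2⟩⟩ := h c c1 c2
  by_cases hPc : P c
  · have : e ≤ c := le_glb hc e fun y hy => by
      by_contra hlt
      push Not at hlt
      rcases (hc.1 hy).lt_or_eq with k | k
      · exact hy.2.2 ((e2 y k hlt).2 hPc)
      · exact hy.2.2 (k ▸ hPc)
    exact this.not_gt e1
  · have hlt : w1 < c := lt_of_le_of_ne c1 fun k => hPc (k ▸ h1)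
    obtain ⟨y, y1, y2⟩ := exists_between (max_lt d1 hlt)
    have : c ≤ y := hc.1 ⟨(le_max_right _ _).trans y1.le, y2.le.trans c2,
      fun k => hPc ((d2 y ((le_max_left _ _).trans_lt y1) y2).1 k)⟩
    exact this.not_gt y2

theorem rank_unique {S : M → Prop} (i : ℕ) {w w' : M} (h : S w) (h' : S w')
    (a : AL S i w) (b : ¬ AL S (i+1) w) (a' : AL S i w') (b' : ¬ AL S (i+1) w') : w = w' := by
  rcases lt_trichotomy w w' with k | k | k
  · exact absurd ⟨w, k, h, a⟩ b'
  · exact k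
  · exact absurd ⟨w', k, h', a'⟩ b

theorem finite_near {S : Set M} (hS : S.Finite) {w : M} (hw : w ∉ S) :
    ∃ a b, a < w ∧ w < b ∧ ∀ x, a < x → x < b → x ∉ S := by
  induction S, hS using Set.Finite.induction_on with
  | empty => 
    obtain ⟨a, ha⟩ := exists_lt w
    obtain ⟨b, hb⟩ := exists_gt w
    exact ⟨a, b, ha, hb, by simp⟩
  | @insert s S _ _ ih =>
    simp only [mem_insert_iff, not_or] at hw
    obtain ⟨a, b, h1, h2, h3⟩ := ih hw.2
    rcases lt_or_gt_of_ne hw.1 with k | k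
    · refine ⟨a, min b s, h1, lt_min h2 k, fun x u v => ?_⟩
      simp only [mem_insert_iff, not_or]
      exact ⟨(v.trans_le (min_le_right _ _)).ne, h3 x u (v.trans_le (min_le_left _ _))⟩
    · refine ⟨max a s, b, max_lt h1 k, h2, fun x u v => ?_⟩
      simp only [mem_insert_iff, not_or]
      exact ⟨((le_max_right _ _).trans_lt u).ne', h3 x ((le_max_left _ _).trans_lt u) v⟩

set_option maxHeartbeats 4000000 in
theorem uf (k : ℕ) : ∀ (j : ℕ) (R : Pow M k → Pow M j → Prop) (D : Pow M k → Pow M j → M → Prop),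
    DefP L (univ : Set M) (fun q : Pow M k × Pow M j => R q.1 q.2) →
    DefP L (univ : Set M) (fun q : Pow M k × Pow M j × M => D q.1 q.2.1 q.2.2) →
    (∀ x ρ, {y | D x ρ y}.Finite) →
    (∀ x ρ ρ', R x ρ → R x ρ' → {y | D x ρ y}.ncard = {y | D x ρ' y}.ncard) →
    ∃ N, ∀ x, Lg j (R x) → ∀ ρ, R x ρ → {y | D x ρ y}.ncard ≤ N := by
  induction k with
  | zero =>
    intro j R D _ _ _ hc
    by_cases h : ∃ ρ, R PUnit.unit ρ
    · obtain ⟨ρ, hρ⟩ := h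
      exact ⟨_, fun ⟨⟩ _ ρ' hρ' => (hc _ _ _ hρ' hρ).le⟩
    · push Not at h
      exact ⟨0, fun ⟨⟩ _ ρ' hρ' => absurd hρ' (h ρ')⟩
  | succ k ih =>
    intro j R D hR hD hf hc
    let R0 : M → Pow M k → Pow M j → Prop := fun w x ρ => R (w, x) ρ
    let D0 : M → Pow M k → Pow M j → M → Prop := fun w x ρ y => D (w, x) ρ y
    have hR0 : DefP L (univ : Set M) (fun q : M × Pow M k × Pow M j => R0 q.1 q.2.1 q.2.2) :=
      DefP.comp2 (Y := Pow M (k+1)) hR (DefF.pair DefF.fst0 DefF.snd0.fst) DefF.snd0.snd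
    have hD0 : DefP L (univ : Set M)
        (fun q : M × Pow M k × Pow M j × M => D0 q.1 q.2.1 q.2.2.1 q.2.2.2) :=
      DefP.comp3 (Y := Pow M (k+1)) hD (DefF.pair DefF.fst0 DefF.snd0.fst)
        DefF.snd0.snd.fst DefF.snd0.snd.snd
    let Dom : Pow M k → M → Prop := fun x w => Lg j (R0 w x)
    have hDom : DefP L (univ : Set M) (fun q : Pow M k × M => Dom q.1 q.2) :=
      DefP.lg j (X := Pow M k × M) (R := fun q ρ => R0 q.2 q.1 ρ) dfn
    let Good : Pow M k → M → Prop := fun x w => ∃ ρ a b, a < w ∧ w < b ∧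
      (∀ w', a < w' → w' < b → R0 w' x ρ) ∧ Nice (fun w' y => D0 w' x ρ y) w
    have hGood : DefP L (univ : Set M) (fun q : Pow M k × M => Good q.1 q.2) := by
      have hN : DefP L (univ : Set M) (fun q : Pow M k × M × Pow M j =>
          Nice (fun w' y => D0 w' q.1 q.2.2 y) q.2.1) := by
        unfold Nice NcM NcP Nc NN; exact dfn
      let N1 : Pow M k → M → Pow M j → Prop := fun x w ρ => Nice (fun w' y => D0 w' x ρ y) w
      have hN1 : DefP L (univ : Set M) (fun q : Pow M k × M × Pow M j => N1 q.1 q.2.1 q.2.2) := hN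
      have : DefP L (univ : Set M) (fun q : Pow M k × M => ∃ ρ a b, a < q.2 ∧ q.2 < b ∧
        (∀ w', a < w' → w' < b → R0 w' q.1 ρ) ∧ N1 q.1 q.2 ρ) := dfn
      exact this
    let B : Pow M k → M → Prop := fun x w => ¬ NN w (fun w' => Dom x w' ↔ Dom x w)
    have hB : DefP L (univ : Set M) (fun q : Pow M k × M => B q.1 q.2) := by
      have : DefP L (univ : Set M) (fun q : Pow M k × M => 
        ¬ NN q.2 (fun w' => Dom q.1 w' ↔ Dom q.1 q.2)) := by unfold NN; exact dfn
      exact this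
    let H : Pow M k → M → Prop := fun x w => B x w ∨ (Dom x w ∧ ¬ Good x w)
    have hH : DefP L (univ : Set M) (fun q : Pow M k × M => H q.1 q.2) := dfn
    have hDomx : ∀ x, DefP L (univ : Set M) (Dom x) := fun x =>
      DefP.comp2 hDom (DefF.const x) DefF.id
    have hfin : ∀ x, {w | H x w}.Finite := by
      intro x
      have h1 : {w | B x w}.Finite := bd_finite (hDomx x)
      have h2 : {w | Dom x w ∧ ¬ Good x w}.Finite := by
        refine (fat_or_finite (L := L) ((hDomx x).and
          (DefP.comp2 hGood (DefF.const x) DefF.id).not)).resolve_left ?_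
        rintro ⟨a, b, hab, hh⟩
        obtain ⟨ρ, c, d, hcd, hρ⟩ := swapj j (R := fun w ρ => R0 w x ρ) dfn hab
          fun w u v => (hh w u v).1
        have := nice_ae (L := L) (D := fun w y => D0 w x ρ y) dfn (fun w => hf _ _)
        obtain ⟨w, w1, w2, w3⟩ := exists_notin hcd this
        simp only [mem_ofPred_eq, not_not] at w3
        exact (hh w (hρ w w1 w2).1 (hρ w w1 w2).2.1).2
          ⟨ρ, c, d, w1, w2, fun w' u v => (hρ w' u v).2.2, w3⟩
      exact (h1.union h2).subset fun w h => h
    obtain ⟨K, hK⟩ := ih 0 (fun _ _ => True) (fun x _ w => H x w) (DefP.const True)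
      (DefP.comp2 hH DefF.fst0 DefF.snd0.snd) (fun x _ => hfin x)
      (fun _ _ _ _ _ => rfl)
    replace hK : ∀ x, {w | H x w}.ncard ≤ K := fun x => hK x trivial PUnit.unit trivial
    let rk : ℕ → Pow M k → M → Prop := fun i x w => AL (H x) i w ∧ ¬ AL (H x) (i+1) w
    have hrk : ∀ i, DefP L (univ : Set M) (fun q : Pow M k × M => rk i q.1 q.2) := fun i =>
      (DefP.al hH i).and (DefP.al hH (i+1)).not
    have rkex : ∀ x w, ∃ i, i < K + 1 ∧ rk i x w := fun x w => by
      refine ⟨{t | H x t ∧ t < w}.ncard, ?_, (al_iff (hfin x) _ _).2 le_rfl, fun h => ?_⟩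
      · exact Nat.lt_succ_of_le ((ncard_le_ncard (fun t h => h.1) (hfin x)).trans (hK x))
      · have := (al_iff (hfin x) _ _).1 h
        omega
    have const : ∀ x w1 w2, w1 ≤ w2 → (∀ w, w1 ≤ w → w ≤ w2 → ¬ H x w) → Dom x w1 →
        ∀ ρ1 ρ2, R0 w1 x ρ1 → R0 w2 x ρ2 → {y | D0 w1 x ρ1 y}.ncard = {y | D0 w2 x ρ2 y}.ncard := by
      intro x w1 w2 h12 hno hd ρ1 ρ2 hr1 hr2
      have nB : ∀ w, w1 ≤ w → w ≤ w2 → NN w (fun w' => Dom x w' ↔ Dom x w) := fun w u v => by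
        by_contra h
        exact hno w u v (Or.inl h)
      have hDw : ∀ w, w1 ≤ w → w ≤ w2 → Dom x w := fun w u v =>
        conn (hDomx x) u (fun w' a b => nB w' a (b.trans v)) hd
      have hG : ∀ w, w1 ≤ w → w ≤ w2 → Good x w := fun w u v => by
        by_contra h
        exact hno w u v (Or.inr ⟨hDw w u v, h⟩)
      let n := {y | D0 w1 x ρ1 y}.ncard
      let Vn : M → Pow M j → Prop := fun w ρ => {y | D0 w x ρ y}.ncard = n
      have hVn : DefP L (univ : Set M) (fun q : M × Pow M j => Vn q.1 q.2) :=
        DefP.ncard (S := fun (q : M × Pow M j) y => D0 q.1 x q.2 y) dfn (fun q => hf _ _) n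
      have hV : DefP L (univ : Set M) (fun w => ∃ ρ, R0 w x ρ ∧ Vn w ρ) := dfn
      have := conn hV h12 (fun w u v => by
        obtain ⟨ρ, a, b, h1, h2, h3, h4⟩ := hG w u v
        have h5 := Nice.ncard (L := L) (D := fun w y => D0 w x ρ y) dfn (fun w => hf _ _) h4
        refine (h5.and (NN.of_mem h1 h2 h3)).mono ?_
        rintro w' ⟨k1, k2⟩
        have e : ∀ w'', R0 w'' x ρ → ((∃ ρ, R0 w'' x ρ ∧ Vn w'' ρ) ↔ Vn w'' ρ) := by
          intro w'' hr
          refine ⟨?_, fun h => ⟨ρ, hr, h⟩⟩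
          rintro ⟨ρ', m1, m2⟩
          exact (hc _ _ _ hr m1).trans m2
        rw [e w' k2, e w (h3 w h1 h2)]
        simp only [Vn]
        rw [k1]) ⟨ρ1, hr1, rfl⟩
      obtain ⟨ρ, m1, m2⟩ := this
      exact ((hc _ _ _ hr2 m1).trans m2).symm
    have ih1 : ∀ i, ∃ N, ∀ x w, H x w → rk i x w → Dom x w → ∀ ρ, R0 w x ρ →
        {y | D0 w x ρ y}.ncard ≤ N := by
      intro i
      let r := rk i
      have hr : DefP L (univ : Set M) (fun q : Pow M k × M => r q.1 q.2) := hrk i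
      have uniq : ∀ x w w', H x w → r x w → H x w' → r x w' → w = w' :=
        fun x w w' h1 h2 h3 h4 => rank_unique i h1 h3 h2.1 h2.2 h4.1 h4.2
      change ∃ N, ∀ x w, H x w → r x w → Dom x w → ∀ ρ, R0 w x ρ →
        {y | D0 w x ρ y}.ncard ≤ N
      clear_value r
      have eqD : ∀ x w, H x w → r x w → ∀ ρ, {y | ∃ w, H x w ∧ r x w ∧ D0 w x ρ y} = {y | D0 w x ρ y} := by
        intro x w h1 h2 ρ
        ext y
        refine ⟨?_, fun h => ⟨w, h1, h2, h⟩⟩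
        rintro ⟨w', h3, h4, h5⟩
        have := uniq x w w' h1 h2 h3 h4
        subst this; exact h5
      obtain ⟨N, hN⟩ := ih j (fun x ρ => ∃ w, H x w ∧ r x w ∧ R0 w x ρ)
        (fun x ρ y => ∃ w, H x w ∧ r x w ∧ D0 w x ρ y) dfn dfn
        (fun x ρ => by
          by_cases h : ∃ w, H x w ∧ r x w
          · obtain ⟨w, h1, h2⟩ := h
            rw [eqD x w h1 h2]; exact hf _ _
          · convert Set.finite_empty (α := M)
            ext y
            simp only [mem_ofPred_eq, mem_empty_iff_false, iff_false]
            rintro ⟨w, h1, h2, _⟩; exact h ⟨w, h1, h2⟩)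
        (by
          rintro x ρ ρ' ⟨w, h1, h2, h3⟩ ⟨w', h1', h2', h3'⟩
          have := uniq x w w' h1 h2 h1' h2'
          subst this
          rw [eqD x w h1 h2, eqD x w h1 h2]
          exact hc _ _ _ h3 h3')
      refine ⟨N, fun x w h1 h2 hd ρ h3 => ?_⟩
      have := hN x (by
        have : (fun ρ => ∃ w, H x w ∧ r x w ∧ R0 w x ρ) = R0 w x := by
          funext ρ
          apply propext
          refine ⟨?_, fun h => ⟨w, h1, h2, h⟩⟩
          rintro ⟨w', h1', h2', h3'⟩
          have := uniq x w w' h1 h2 h1' h2'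
          subst this; exact h3'
        rw [this]; exact hd) ρ ⟨w, h1, h2, h3⟩
      rwa [eqD x w h1 h2] at this
    have ih2 : ∀ i, ∃ N, ∀ x w, ¬ H x w → rk i x w → Dom x w → ∀ ρ, R0 w x ρ →
        {y | D0 w x ρ y}.ncard ≤ N := by
      intro i
      let r := rk i
      have hr : DefP L (univ : Set M) (fun q : Pow M k × M => r q.1 q.2) := hrk i
      have noH : ∀ x w w', ¬ H x w' → r x w → r x w' → ∀ t, w ≤ t → t ≤ w' → ¬ H x t := by
        intro x w w' h0 h1 h2 t t1 t2 ht
        have tlt : t < w' := lt_of_le_of_ne t2 fun h => h0 (h ▸ ht)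
        have e0 := (al_iff (hfin x) _ _).1 h1.1
        have e2 := fun h => h2.2 ((al_iff (hfin x) _ _).2 h)
        apply e2
        have h4 : insert t {t | H x t ∧ t < w} ⊆ {t | H x t ∧ t < w'} := by
          rintro s (rfl | hs)
          · exact ⟨ht, tlt⟩
          · exact ⟨hs.1, hs.2.trans (t1.trans_lt tlt)⟩
        have h5 := ncard_le_ncard h4 ((hfin x).subset fun t h => h.1)
        rw [ncard_insert_of_notMem (fun h => h.2.not_ge t1) ((hfin x).subset fun t h => h.1)] at h5
        omega
      have rtr : ∀ x w w', {t | H x t ∧ t < w'} = {t | H x t ∧ t < w} → r x w → r x w' := by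
        intro x w w' this h2
        have g1 := h2.1
        have g2 := h2.2
        rw [al_iff (hfin x), ← this, ← al_iff (hfin x)] at g1 g2
        exact ⟨g1, g2⟩
      change ∃ N, ∀ x w, ¬ H x w → r x w → Dom x w → ∀ ρ, R0 w x ρ →
        {y | D0 w x ρ y}.ncard ≤ N
      clear_value r
      obtain ⟨N, hN⟩ := ih (j+1) (fun x (ρ : M × Pow M j) => ¬ H x ρ.1 ∧ r x ρ.1 ∧ Dom x ρ.1 ∧ R0 ρ.1 x ρ.2)
        (fun x (ρ : M × Pow M j) y => D0 ρ.1 x ρ.2 y)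
        (show DefP L (univ : Set M) (fun q : Pow M k × M × Pow M j =>
          ¬ H q.1 q.2.1 ∧ r q.1 q.2.1 ∧ Dom q.1 q.2.1 ∧ R0 q.2.1 q.1 q.2.2) from dfn)
        (show DefP L (univ : Set M) (fun q : Pow M k × (M × Pow M j) × M =>
          D0 q.2.1.1 q.1 q.2.1.2 q.2.2) from dfn)
        (fun x ρ => hf _ _)
        (by
          rintro x ⟨w, ρ⟩ ⟨w', ρ'⟩ ⟨h1, h2, h3, h4⟩ ⟨h1', h2', h3', h4'⟩
          rcases le_total w w' with h | h
          · exact const x w w' h (noH x w w' h1' h2 h2') h3 ρ ρ' h4 h4'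
          · exact (const x w' w h (noH x w' w h1 h2' h2) h3' ρ' ρ h4' h4).symm)
      refine ⟨N, fun x w h1 h2 h3 ρ h4 => ?_⟩
      refine hN x ?_ (w, ρ) ⟨h1, h2, h3, h4⟩
      obtain ⟨a, b, ha, hb, hab⟩ := finite_near (hfin x) h1
      have hnb : NN w (fun w' => Dom x w' ↔ Dom x w) := by
        by_contra h; exact h1 (Or.inl h)
      obtain ⟨e, e1, e2⟩ := hnb.2
      refine ⟨w, min b e, lt_min hb e1, fun w' u v => ?_⟩
      have hdw' : Dom x w' := (e2 w' u (v.trans_le (min_le_right _ _))).2 h3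
      have hhw' : ¬ H x w' := hab w' (ha.trans u) (v.trans_le (min_le_left _ _))
      have hrw' : r x w' := by
        have : {t | H x t ∧ t < w'} = {t | H x t ∧ t < w} := by
          ext t
          refine ⟨fun h => ⟨h.1, ?_⟩, fun h => ⟨h.1, h.2.trans u⟩⟩
          by_contra hlt
          push Not at hlt
          exact hab t (ha.trans_le hlt) (h.2.trans (v.trans_le (min_le_left _ _))) h.1
        exact rtr x w w' this h2
      have : (fun ρ : Pow M j => ¬ H x w' ∧ r x w' ∧ Dom x w' ∧ R0 w' x ρ) = R0 w' x := by
        funext ρ; simp [hdw', hhw', hrw']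
      simp only [this]; exact hdw'
    choose N1 hN1 using ih1
    choose N2 hN2 using ih2
    refine ⟨(Finset.range (K+1)).sum fun i => N1 i + N2 i, ?_⟩
    rintro ⟨w, x⟩ hl ρ hρ
    obtain ⟨i, hi, hri⟩ := rkex x w
    have hle : N1 i + N2 i ≤ (Finset.range (K+1)).sum fun i => N1 i + N2 i :=
      Finset.single_le_sum (f := fun i => N1 i + N2 i) (fun _ _ => Nat.zero_le _) (Finset.mem_range.2 hi)
    by_cases hH' : H x w
    · have : {y | D (w, x) ρ y}.ncard ≤ N1 i := hN1 i x w hH' hri hl ρ hρ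
      omega
    · have : {y | D (w, x) ρ y}.ncard ≤ N2 i := hN2 i x w hH' hri hl ρ hρ
      omega

/-- Uniform finiteness. -/
theorem unif_fin {U : Type u} [Crd M U] {D : U → M → Prop}
    (hD : DefP L (univ : Set M) (fun q : U × M => D q.1 q.2)) (hf : ∀ x, {y | D x y}.Finite) :
    ∃ N, ∀ x, {y | D x y}.ncard ≤ N := by
  obtain ⟨n, f, g, h1, h2, h3, h4⟩ := exists_pow L (M := M) U
  have h2' := h2 univ
  obtain ⟨N, hN⟩ := uf (L := L) n 0 (fun _ _ => True) (fun x _ y => D (g x) y) dfn dfn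
    (fun x _ => hf _) (fun _ _ _ _ _ => rfl)
  refine ⟨N, fun x => ?_⟩
  have := hN (f x) trivial PUnit.unit trivial
  rwa [h3] at this

end uf
end OM

namespace OM
set_option linter.unusedSectionVars false

section defq
variable {L : FirstOrder.Language} {M : Type u} [L.Structure M]

/-- A definable family of types on `X` parametrized by `E`. -/
structure DefQ (L : FirstOrder.Language) {M : Type u} [L.Structure M] (A : Set M) {E X : Type u}
    [Crd M E] [Crd M X] (q : E → (X → Prop) → Prop) : Prop where
  and : ∀ e P Q, DefP L (univ : Set M) P → DefP L (univ : Set M) Q →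
    (q e (fun x => P x ∧ Q x) ↔ q e P ∧ q e Q)
  not : ∀ e P, DefP L (univ : Set M) P → (q e (fun x => ¬ P x) ↔ ¬ q e P)
  defn : ∀ {Y : Type u} [Crd M Y] (P : Y → X → Prop) (g : Y → E),
    DefP L A (fun z : Y × X => P z.1 z.2) → DefF L A g → DefP L A (fun y => q (g y) (P y))

variable {A : Set M} {E X Y U : Type u} [Crd M E] [Crd M X] [Crd M Y] [Crd M U]
variable {q : E → (X → Prop) → Prop}

theorem DefQ.mono (h : DefQ L A q) {e : E} {P Q : X → Prop} (hP : DefP L (univ : Set M) P)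
    (hQ : DefP L (univ : Set M) Q) (hp : q e P) (hPQ : ∀ x, P x → Q x) : q e Q := by
  have : (fun x => P x ∧ Q x) = P := funext fun x => propext ⟨fun h => h.1, fun h => ⟨h, hPQ x h⟩⟩
  exact ((h.and e P Q hP hQ).1 (this.symm ▸ hp)).2

theorem DefQ.top (h : DefQ L A q) {e : E} {P : X → Prop} (hP : ∀ x, P x) : q e P := by
  have h1 : P = fun _ => ¬ False := funext fun x => propext ⟨fun _ => id, fun _ => hP x⟩
  rw [h1, h.not e (fun _ => False) (DefP.const _)]
  intro h2
  have h3 := h.mono (DefP.const _) (DefP.const _) h2 (Q := fun _ => ¬ False) (fun _ h => h.elim)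
  rw [h.not e (fun _ => False) (DefP.const _)] at h3
  exact h3 h2

theorem DefQ.congr (h : DefQ L A q) {e : E} {P Q : X → Prop} (hp : q e P) (hPQ : ∀ x, P x ↔ Q x) :
    q e Q := (funext fun x => propext (hPQ x) : P = Q) ▸ hp

theorem DefQ.exists (h : DefQ L A q) {e : E} {P : X → Prop} (hP : DefP L (univ : Set M) P)
    (hp : q e P) : ∃ x, P x := by
  by_contra hno
  push Not at hno
  exact (h.not e P hP).1 (h.top hno) hp

theorem DefQ.allFin (h : DefQ L A q) {e : E} {N : ℕ} {P : Fin N → X → Prop}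
    (hP : ∀ i, DefP L (univ : Set M) (P i)) (hp : ∀ i, q e (P i)) : q e (fun x => ∀ i, P i x) := by
  induction N with
  | zero => exact h.top fun x i => i.elim0
  | succ N ih =>
    have h1 := ih (fun i => hP i.succ) (fun i => hp i.succ)
    have h2 := (h.and e _ _ (hP 0) (DefP.allFin fun i : Fin N => hP i.succ)).2 ⟨hp 0, h1⟩
    refine h.congr h2 fun x => ?_
    rw [Fin.forall_fin_succ]

theorem DefQ.exFin (h : DefQ L A q) {e : E} {N : ℕ} {P : Fin N → X → Prop}
    (hP : ∀ i, DefP L (univ : Set M) (P i)) (hp : q e (fun x => ∃ i, P i x)) : ∃ i, q e (P i) := by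
  by_contra hno
  push Not at hno
  have h1 := h.allFin (P := fun i x => ¬ P i x) (fun i => (hP i).not) (fun i => (h.not e _ (hP i)).2 (hno i))
  refine (h.not e _ (DefP.exFin hP)).1 (h.congr h1 fun x => ?_) hp
  push Not; rfl

theorem DefQ.univ_ (h : DefQ L A q) (P : Y → X → Prop) (g : Y → E)
    (hP : DefP L (univ : Set M) (fun z : Y × X => P z.1 z.2)) (hg : DefF L (univ : Set M) g) :
    DefP L (univ : Set M) (fun y => q (g y) (P y)) := by
  obtain ⟨s, c, G, hG, hGP⟩ := DefP.params hP
  have hG' := hG.mono (empty_subset A)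
  have h1 : DefP L A (fun z : (Fin s → M) × Y × E => q z.2.2 (fun x => G z.1 (z.2.1, x))) :=
    h.defn (Y := (Fin s → M) × Y × E) (fun z x => G z.1 (z.2.1, x)) (fun z => z.2.2)
      (DefP.comp2 hG' DefF.fst0.fst (DefF.pair DefF.fst0.snd.fst DefF.snd0)) DefF.snd0.snd
  have h2 := (h1.mono (subset_univ A)).comp (f := fun y : Y => (c, y, g y))
    (DefF.pair (DefF.const c) (DefF.pair DefF.id hg))
  refine h2.congr fun y => ?_
  have : P y = fun x => G c (y, x) := funext fun x => propext (hGP (y, x))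
  simp only [this]

theorem DefQ.toUniv (h : DefQ L A q) : DefQ L (univ : Set M) q :=
  ⟨h.and, h.not, fun P g hP hg => h.univ_ P g hP hg⟩

theorem DefQ.univ1 (h : DefQ L A q) (e : E) (P : Y → X → Prop)
    (hP : DefP L (univ : Set M) (fun z : Y × X => P z.1 z.2)) :
    DefP L (univ : Set M) (fun y => q e (P y)) := h.univ_ P (fun _ => e) hP (DefF.const e)

/-- Reparametrization. -/
theorem DefQ.reparam (h : DefQ L A q) {f : Y → E} (hf : DefF L A f) : DefQ L A (fun y => q (f y)) :=
  ⟨fun e => h.and (f e), fun e => h.not (f e), fun P g hP hg => h.defn P (fun y => f (g y)) hP (DefF.comp hf hg)⟩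

/-- Pushforward. -/
theorem DefQ.push (h : DefQ L A q) {f : X → Y} (hf : DefF L A f) :
    DefQ L A (fun e P => q e (fun x => P (f x))) := by
  have hf' := hf.mono (subset_univ A)
  refine ⟨fun e P Q hP hQ => h.and e _ _ (hP.comp hf') (hQ.comp hf'), fun e P hP => h.not e _ (hP.comp hf'),
    fun P g hP hg => h.defn (fun y x => P y (f x)) g ?_ hg⟩
  exact DefP.comp2 hP DefF.fst0 (DefF.comp hf DefF.snd0)

/-- Composition. -/
theorem DefQ.bind (h : DefQ L A q) {r : E × X → (Y → Prop) → Prop} (hr : DefQ L A r) :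
    DefQ L A (fun e (P : Y → Prop) => q e (fun x => r (e, x) P)) := by
  have hd : ∀ e (P : Y → Prop), DefP L (univ : Set M) P →
      DefP L (univ : Set M) (fun x => r (e, x) P) := fun e P hP =>
    hr.univ_ (fun _ => P) (fun x => (e, x)) (hP.comp DefF.snd0) (DefF.pair (DefF.const e) DefF.id)
  refine ⟨fun e P Q hP hQ => ?_, fun e P hP => ?_, fun {W} _ P g hP hg => ?_⟩
  · rw [← h.and e _ _ (hd e P hP) (hd e Q hQ)]
    have : (fun x => r (e, x) (fun y => P y ∧ Q y)) = fun x => r (e, x) P ∧ r (e, x) Q :=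
      funext fun x => propext (hr.and _ _ _ hP hQ)
    rw [this]
  · rw [← h.not e _ (hd e P hP)]
    have : (fun x => r (e, x) (fun y => ¬ P y)) = fun x => ¬ r (e, x) P :=
      funext fun x => propext (hr.not _ _ hP)
    rw [this]
  · refine h.defn (fun z x => r (g z, x) (P z)) g ?_ hg
    exact hr.defn (fun (z : W × X) y => P z.1 y) (fun (z : W × X) => (g z.1, z.2))
      (DefP.comp2 hP DefF.fst0.fst DefF.snd0) (DefF.pair (DefF.comp hg DefF.fst0) DefF.snd0)

/-- Keep the base coordinate. -/
theorem DefQ.keep {r : E × X → (Y → Prop) → Prop} (hr : DefQ L A r) :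
    DefQ L A (fun (e : E × X) (P : Y × X → Prop) => r e (fun y => P (y, e.2))) := by
  have hd : ∀ (e : E × X) (P : Y × X → Prop), DefP L (univ : Set M) P →
      DefP L (univ : Set M) (fun y => P (y, e.2)) := fun e P hP =>
    hP.comp (DefF.pair DefF.id (DefF.const e.2))
  refine ⟨fun e P Q hP hQ => hr.and e _ _ (hd e P hP) (hd e Q hQ), fun e P hP => hr.not e _ (hd e P hP),
    fun P g hP hg => hr.defn (fun z y => P z (y, (g z).2)) g ?_ hg⟩
  exact DefP.comp2 hP DefF.fst0 (DefF.pair DefF.snd0 (DefF.comp hg DefF.fst0).snd)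

/-- Fibred composition. -/
theorem DefQ.fib (h : DefQ L A q) {r : E × X → (Y → Prop) → Prop} (hr : DefQ L A r) :
    DefQ L A (fun e (P : Y × X → Prop) => q e (fun x => r (e, x) (fun y => P (y, x)))) :=
  h.bind hr.keep

theorem DefQ.point {f : E → X} (hf : DefF L A f) : DefQ L A (fun e (P : X → Prop) => P (f e)) :=
  ⟨fun _ _ _ _ _ => Iff.rfl, fun _ _ _ => Iff.rfl, fun _ _ hP hg =>
    DefP.comp2 hP DefF.id (DefF.comp hf hg)⟩

end defq

section sel
variable {L : FirstOrder.Language} {M : Type u} [L.Structure M] [LinearOrder M] [OMin L M]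
variable {A : Set M} {E U V : Type u} [Crd M E] [Crd M U] [Crd M V]

/-- `c` is the infimum of `C`. -/
def Inf (C : M → Prop) (c : M) : Prop := (∀ z, C z → c ≤ z) ∧ ∀ d, (∀ z, C z → d ≤ z) → d ≤ c

/-- The type determined by a cut. -/
def Sel (C K : E → M → Prop) (e : E) (P : M → Prop) : Prop :=
  ((∀ z, ¬ C e z) ∧ NP P) ∨ ((∀ b, ∃ z, z < b ∧ C e z) ∧ NM P) ∨
  ∃ c, Inf (C e) c ∧ ((K e c ∧ P c) ∨ (¬ K e c ∧ C e c ∧ NL c P) ∨ (¬ K e c ∧ ¬ C e c ∧ NR c P))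

variable [DenselyOrdered M] [NoMinOrder M] [NoMaxOrder M] [Nonempty M]

theorem sel_cases {C K : E → M → Prop} (hC : DefP L (univ : Set M) (fun z : E × M => C z.1 z.2)) (e : E) :
    ((∀ z, ¬ C e z) ∧ ∀ P, Sel C K e P ↔ NP P) ∨
    ((∀ b, ∃ z, z < b ∧ C e z) ∧ ∀ P, Sel C K e P ↔ NM P) ∨
    ∃ c, Inf (C e) c ∧ ((K e c ∧ ∀ P, Sel C K e P ↔ P c) ∨
      (¬ K e c ∧ C e c ∧ ∀ P, Sel C K e P ↔ NL c P) ∨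
      (¬ K e c ∧ ¬ C e c ∧ ∀ P, Sel C K e P ↔ NR c P)) := by
  have a : M := Classical.arbitrary M
  have n1 : (∀ z, ¬ C e z) → ¬ (∀ b, ∃ z, z < b ∧ C e z) := fun h h' => by
    obtain ⟨z, _, hz⟩ := h' a; exact h z hz
  have n2 : (∀ z, ¬ C e z) → ∀ c, ¬ Inf (C e) c := fun h c hc => by
    obtain ⟨d, hd⟩ := exists_gt c
    exact (hc.2 d fun z hz => absurd hz (h z)).not_gt hd
  have n3 : (∀ b, ∃ z, z < b ∧ C e z) → ∀ c, ¬ Inf (C e) c := fun h c hc => by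
    obtain ⟨z, h1, h2⟩ := h c
    exact (hc.1 z h2).not_gt h1
  have n4 : ∀ c c', Inf (C e) c → Inf (C e) c' → c' = c := fun c c' h h' =>
    le_antisymm (h.2 _ h'.1) (h'.2 _ h.1)
  by_cases h1 : ∀ z, ¬ C e z
  · refine Or.inl ⟨h1, fun P => ⟨?_, fun h => Or.inl ⟨h1, h⟩⟩⟩
    rintro (⟨_, h⟩ | ⟨h, _⟩ | ⟨c, h, _⟩)
    · exact h
    · exact absurd h (n1 h1)
    · exact absurd h (n2 h1 c)
  by_cases h2 : ∀ b, ∃ z, z < b ∧ C e z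
  · refine Or.inr (Or.inl ⟨h2, fun P => ⟨?_, fun h => Or.inr (Or.inl ⟨h2, h⟩)⟩⟩)
    rintro (⟨h, _⟩ | ⟨_, h⟩ | ⟨c, h, _⟩)
    · exact absurd h2 (n1 h)
    · exact h
    · exact absurd h (n3 h2 c)
  have hCe : DefP L (univ : Set M) (C e) := DefP.comp2 hC (DefF.const e) DefF.id
  push Not at h1
  have h2' := h2
  push Not at h2'
  obtain ⟨b, hb⟩ := h2'
  obtain ⟨c, hc⟩ := exists_glb hCe h1 ⟨b, fun x hx => by
    by_contra hlt; push Not at hlt; exact hb x hlt hx⟩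
  have hc : Inf (C e) c := ⟨fun z hz => hc.1 hz, fun d hd => le_glb hc d hd⟩
  have n0 : ¬ ∀ z, ¬ C e z := by push Not; exact h1
  have red : ∀ P, Sel C K e P ↔ ((K e c ∧ P c) ∨ (¬ K e c ∧ C e c ∧ NL c P) ∨ (¬ K e c ∧ ¬ C e c ∧ NR c P)) := by
    intro P
    refine ⟨?_, fun h => Or.inr (Or.inr ⟨c, hc, h⟩)⟩
    rintro (⟨h, _⟩ | ⟨h, _⟩ | ⟨c', h, h'⟩)
    · exact absurd h n0
    · exact absurd h h2
    · rw [n4 c c' hc h] at h'; exact h'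
  refine Or.inr (Or.inr ⟨c, hc, ?_⟩)
  by_cases hK : K e c
  · exact Or.inl ⟨hK, fun P => by rw [red]; simp [hK]⟩
  · by_cases hCc : C e c
    · exact Or.inr (Or.inl ⟨hK, hCc, fun P => by rw [red]; simp [hK, hCc]⟩)
    · exact Or.inr (Or.inr ⟨hK, hCc, fun P => by rw [red]; simp [hK, hCc]⟩)

theorem ultra_and {q : (M → Prop) → Prop} {P Q : M → Prop}
    (h : (∀ P, q P ↔ NP P) ∨ (∀ P, q P ↔ NM P) ∨ (∃ c, ∀ P, q P ↔ P c) ∨ (∃ c, ∀ P, q P ↔ NL c P) ∨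
    (∃ c, ∀ P, q P ↔ NR c P)) : q (fun x => P x ∧ Q x) ↔ q P ∧ q Q := by
  rcases h with h | h | ⟨c, h⟩ | ⟨c, h⟩ | ⟨c, h⟩ <;> simp only [h]
  · exact ⟨fun h => ⟨h.mono fun x h => h.1, h.mono fun x h => h.2⟩, fun h => h.1.and h.2⟩
  · exact ⟨fun h => ⟨h.mono fun x h => h.1, h.mono fun x h => h.2⟩, fun h => h.1.and h.2⟩
  · exact ⟨fun h => ⟨h.mono fun x h => h.1, h.mono fun x h => h.2⟩, fun h => h.1.and h.2⟩
  · exact ⟨fun h => ⟨h.mono fun x h => h.1, h.mono fun x h => h.2⟩, fun h => h.1.and h.2⟩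

theorem ultra_not {q : (M → Prop) → Prop} {P : M → Prop} (hP : DefP L (univ : Set M) P)
    (h : (∀ P, q P ↔ NP P) ∨ (∀ P, q P ↔ NM P) ∨ (∃ c, ∀ P, q P ↔ P c) ∨ (∃ c, ∀ P, q P ↔ NL c P) ∨
    (∃ c, ∀ P, q P ↔ NR c P)) : q (fun x => ¬ P x) ↔ ¬ q P := by
  rcases h with h | h | ⟨c, h⟩ | ⟨c, h⟩ | ⟨c, h⟩ <;> simp only [h]
  · exact ⟨fun h h' => let ⟨_, hx⟩ := (h.and h').exists; hx.1 hx.2, fun h => (np_or hP).resolve_left h⟩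
  · exact ⟨fun h h' => let ⟨_, hx⟩ := (h.and h').exists; hx.1 hx.2, fun h => (nm_or hP).resolve_left h⟩
  · exact ⟨fun h h' => let ⟨_, hx⟩ := (h.and h').exists; hx.2.1 hx.2.2, fun h => (nl_or hP c).resolve_left h⟩
  · exact ⟨fun h h' => let ⟨_, hx⟩ := (h.and h').exists; hx.2.1 hx.2.2, fun h => (nr_or hP c).resolve_left h⟩

theorem DefQ.sel {C K : E → M → Prop} (hC : DefP L A (fun z : E × M => C z.1 z.2))
    (hK : DefP L A (fun z : E × M => K z.1 z.2)) : DefQ L A (Sel C K) := by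
  have key : ∀ e, (∀ P, Sel C K e P ↔ NP P) ∨ (∀ P, Sel C K e P ↔ NM P) ∨ (∃ c, ∀ P, Sel C K e P ↔ P c) ∨
      (∃ c, ∀ P, Sel C K e P ↔ NL c P) ∨ (∃ c, ∀ P, Sel C K e P ↔ NR c P) := by
    intro e
    rcases sel_cases (K := K) (hC.mono (subset_univ A)) e with h | h | ⟨c, _, h | h | h⟩
    · exact Or.inl h.2
    · exact Or.inr (Or.inl h.2)
    · exact Or.inr (Or.inr (Or.inl ⟨c, h.2⟩))
    · exact Or.inr (Or.inr (Or.inr (Or.inl ⟨c, h.2.2⟩)))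
    · exact Or.inr (Or.inr (Or.inr (Or.inr ⟨c, h.2.2⟩)))
  refine ⟨fun e P Q _ _ => ultra_and (key e), fun e P hP => ultra_not hP (key e), fun P g hP hg => ?_⟩
  unfold Sel Inf
  exact dfn

/-- A definable chain of nonempty sets belongs to the selected type. -/
theorem sel_chain {Ω : E → V → Prop} {Z : E → V → M → Prop}
    (hΩ : DefP L (univ : Set M) (fun z : E × V => Ω z.1 z.2))
    (hZ : DefP L (univ : Set M) (fun z : E × V × M => Z z.1 z.2.1 z.2.2)) (e : E)
    (hne : ∀ v, Ω e v → ∃ z, Z e v z)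
    (hch : ∀ v v', Ω e v → Ω e v' → (∀ z, Z e v z → Z e v' z) ∨ (∀ z, Z e v' z → Z e v z))
    (v : V) (hv : Ω e v) :
    Sel (fun e z => ∀ v, Ω e v → ∃ z', z' ≤ z ∧ Z e v z') (fun e c => ∀ v, Ω e v → Z e v c) e (Z e v) := by
  have inter : ∀ v v', Ω e v → Ω e v' → ∃ v'', Ω e v'' ∧ ∀ z, Z e v'' z → Z e v z ∧ Z e v' z := by
    intro v v' h h'
    rcases hch v v' h h' with k | k
    · exact ⟨v, h, fun z hz => ⟨hz, k z hz⟩⟩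
    · exact ⟨v', h', fun z hz => ⟨k z hz, hz⟩⟩
  have hZv : DefP L (univ : Set M) (Z e v) := DefP.comp3 hZ (DefF.const e) (DefF.const v) DefF.id
  rcases sel_cases (L := L) (C := fun e z => ∀ v, Ω e v → ∃ z', z' ≤ z ∧ Z e v z')
      (K := fun e c => ∀ v, Ω e v → Z e v c) dfn e with ⟨h, h'⟩ | ⟨h, h'⟩ | ⟨c, hc, ⟨h, h'⟩ | ⟨hk, h, h'⟩ | ⟨_, h, h'⟩⟩
  · rw [h']
    refine (np_or hZv).resolve_right ?_
    rintro ⟨d, hd⟩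
    have := h d
    push Not at this
    obtain ⟨v1, o1, k1⟩ := this
    obtain ⟨v2, o2, k2⟩ := inter v v1 hv o1
    obtain ⟨z, hz⟩ := hne v2 o2
    rcases lt_or_ge d z with k | k
    · exact hd z k (k2 z hz).1
    · exact k1 z k (k2 z hz).2
  · rw [h']
    refine (nm_or hZv).resolve_right ?_
    rintro ⟨d, hd⟩
    obtain ⟨z, h1, h2⟩ := h d
    obtain ⟨z', h3, h4⟩ := h2 v hv
    exact hd z' (h3.trans_lt h1) h4
  · rw [h']; exact h v hv
  · rw [h']
    refine (nl_or hZv c).resolve_right ?_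
    rintro ⟨d, d1, d2⟩
    push Not at hk
    obtain ⟨v0, o0, k0⟩ := hk
    obtain ⟨z, z1, z2⟩ := exists_between d1
    have : ∃ v', Ω e v' ∧ ∀ z', z' ≤ z → ¬ Z e v' z' := by
      by_contra hno
      push Not at hno
      exact (hc.1 z hno).not_gt z2
    obtain ⟨v1, o1, k1⟩ := this
    obtain ⟨v2, o2, k2⟩ := inter v v1 hv o1
    obtain ⟨v3, o3, k3⟩ := inter v0 v2 o0 o2
    obtain ⟨t, t1, t2⟩ := h v3 o3
    have e1 := k3 t t2
    have e2 := k2 t e1.2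
    rcases t1.lt_or_eq with k | k
    · rcases lt_or_ge z t with k' | k'
      · exact d2 t (z1.trans k') k e2.1
      · exact k1 t k' e2.2
    · exact k0 (k ▸ e1.1)
  · rw [h']
    refine (nr_or hZv c).resolve_right ?_
    rintro ⟨d, d1, d2⟩
    push Not at h
    obtain ⟨v1, o1, k1⟩ := h
    have : ∃ z, z < d ∧ ∀ v, Ω e v → ∃ z', z' ≤ z ∧ Z e v z' := by
      by_contra hno
      push Not at hno
      refine (hc.2 d fun z hz => ?_).not_gt d1
      by_contra hlt
      push Not at hlt
      obtain ⟨v, ov, hv⟩ := hno z hlt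
      obtain ⟨z', m1, m2⟩ := hz v ov
      exact hv z' m1 m2
    obtain ⟨z, z1, z2⟩ := this
    obtain ⟨v2, o2, k2⟩ := inter v v1 hv o1
    obtain ⟨t, t1, t2⟩ := z2 v2 o2
    rcases lt_or_ge c t with k | k
    · exact d2 t k (t1.trans_lt z1) (k2 t t2).1
    · exact k1 t k (k2 t t2).2

end sel

section lp
variable {L : FirstOrder.Language} {M : Type u} [L.Structure M] [LinearOrder M] [OMin L M]
variable [DenselyOrdered M] [NoMinOrder M] [NoMaxOrder M] [Nonempty M]
variable {A : Set M} {W V : Type u} [Crd M W] [Crd M V]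

/-- Definable families of definable prelinear orders have cofinal definable types. -/
def LP (L : FirstOrder.Language) {M : Type u} [L.Structure M] (A : Set M) (W : Type u) [Crd M W] : Prop :=
  ∀ (E : Type u) [Crd M E] (Ω : E → W → Prop) (O : E → W → W → Prop),
    DefP L A (fun z : E × W => Ω z.1 z.2) →
    DefP L A (fun z : E × W × W => O z.1 z.2.1 z.2.2) →
    ∃ q : E → (W → Prop) → Prop, DefQ L A q ∧ ∀ e,
      (∀ u v, Ω e u → Ω e v → O e u v ∨ O e v u) →
      (∀ u v w, Ω e u → Ω e v → Ω e w → O e u v → O e v w → O e u w) →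
      ∀ u, Ω e u → q e (fun v => Ω e v ∧ O e u v)

theorem LP.unit : LP L A PUnit.{u+1} := by
  intro E _ Ω O hΩ hO
  refine ⟨fun e P => P PUnit.unit, DefQ.point (f := fun _ => PUnit.unit) DefF.unit, ?_⟩
  rintro e ht _ ⟨⟩ hu
  exact ⟨hu, (ht _ _ hu hu).elim id id⟩

theorem LP.trans (h : LP L A W) {f : V → W} {g : W → V} (hf : DefF L A f) (hg : DefF L A g)
    (hgf : ∀ v, g (f v) = v) : LP L A V := by
  intro E _ Ω O hΩ hO
  obtain ⟨q, hq, hq'⟩ := h E (fun e w => Ω e (g w)) (fun e w w' => O e (g w) (g w'))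
    (DefP.comp2 hΩ DefF.fst0 (DefF.comp hg DefF.snd0))
    (DefP.comp3 hO DefF.fst0 (DefF.comp hg DefF.snd0.fst) (DefF.comp hg DefF.snd0.snd))
  refine ⟨_, hq.push hg, fun e h1 h2 u hu => ?_⟩
  have := hq' e (fun u v => h1 _ _) (fun u v w => h2 _ _ _) (f u) (by rw [hgf]; exact hu)
  rw [hgf] at this
  exact this

theorem LP.step (ih : LP L A W) : LP L A (M × W) := by
  intro E _ Ω O hΩ hO
  obtain ⟨q, hq, hq'⟩ := ih (E × M) (fun e w => Ω e.1 (e.2, w)) (fun e w w' => O e.1 (e.2, w) (e.2, w'))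
    dfn dfn
  have hΩu := hΩ.mono (subset_univ A)
  have hOu := hO.mono (subset_univ A)
  have hs : DefQ L A (Sel (fun (e : E) z => ∀ u : M × W, Ω e u → ∃ z', z' ≤ z ∧ ∃ w : W, Ω e (z', w) ∧ O e u (z', w))
    (fun e c => ∀ u : M × W, Ω e u → ∃ w : W, Ω e (c, w) ∧ O e u (c, w))) := DefQ.sel dfn dfn
  have hF := (hs.fib hq).push (f := fun p : W × M => (p.2, p.1)) (DefF.pair DefF.snd0 DefF.fst0)
  refine ⟨_, hF, fun e h1 h2 u hu => ?_⟩
  have hZ : DefP L (univ : Set M) (fun z : E × (M × W) × M => ∃ w : W, Ω z.1 (z.2.2, w) ∧ O z.1 z.2.1 (z.2.2, w)) := dfn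
  have h3 := sel_chain (Ω := Ω) (Z := fun e u z => ∃ w : W, Ω e (z, w) ∧ O e u (z, w)) hΩu hZ e
    (fun v hv => ⟨v.1, v.2, hv, (h1 v v hv hv).elim id id⟩) (fun v v' hv hv' => by
      rcases h1 v v' hv hv' with k | k
      · right; rintro z ⟨w, w1, w2⟩; exact ⟨w, w1, h2 _ _ _ hv hv' w1 k w2⟩
      · left; rintro z ⟨w, w1, w2⟩; exact ⟨w, w1, h2 _ _ _ hv' hv w1 k w2⟩) u hu
  refine hs.mono ?_ ?_ h3 ?_
  · have hZ' : DefP L (univ : Set M) (fun z : M => ∃ w : W, Ω e (z, w) ∧ O e u (z, w)) :=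
      DefP.comp3 (H := fun e u z => ∃ w : W, Ω e (z, w) ∧ O e u (z, w)) hZ (DefF.const e) (DefF.const u) DefF.id
    exact hZ'
  · refine hq.univ_ (fun z w => Ω e (z, w) ∧ O e u (z, w)) (fun z => (e, z)) ?_ (DefF.pair (DefF.const e) DefF.id)
    exact DefP.and (DefP.comp2 hΩu (DefF.const e) (DefF.pair DefF.fst0 DefF.snd0))
      (DefP.comp3 hOu (DefF.const e) (DefF.const u) (DefF.pair DefF.fst0 DefF.snd0))
  · rintro z ⟨w, w1, w2⟩
    have h4 := hq' (e, z) (fun u v => h1 _ _) (fun u v w => h2 _ _ _) w w1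
    refine hq.mono ?_ ?_ h4 ?_
    · exact DefP.and (DefP.comp2 hΩu (DefF.const e) (DefF.pair (DefF.const z) DefF.id))
        (DefP.comp3 hOu (DefF.const e) (DefF.const (z, w)) (DefF.pair (DefF.const z) DefF.id))
    · exact DefP.and (DefP.comp2 hΩu (DefF.const e) (DefF.pair (DefF.const z) DefF.id))
        (DefP.comp3 hOu (DefF.const e) (DefF.const u) (DefF.pair (DefF.const z) DefF.id))
    · rintro w' ⟨k1, k2⟩
      exact ⟨k1, h2 _ _ _ hu w1 k1 w2 k2⟩

theorem LP.pow (m : ℕ) : LP L A (Pow M m) := by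
  induction m with
  | zero => exact LP.unit
  | succ m ih => exact ih.step

theorem lemP (V : Type u) [Crd M V] : LP L A V := by
  obtain ⟨n, f, g, hf, hg, h1, h2⟩ := exists_pow (M := M) L V
  exact (LP.pow n).trans (hf A) (hg A) (by first | exact h1 | exact fun v => congrFun h1 v)

end lp
end OM

namespace OM
set_option linter.unusedSectionVars false

section strata
variable {L : FirstOrder.Language} {M : Type u} [L.Structure M] [LinearOrder M] [OMin L M]
variable [DenselyOrdered M] [NoMinOrder M] [NoMaxOrder M] [Nonempty M]
variable {A : Set M} {V E : Type u} [Crd M V] [Crd M E]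

theorem strata {D : V → M → Prop} (hD : DefP L A (fun q : V × M => D q.1 q.2)) :
    ∃ (N : ℕ) (F : Fin N → V → M → Prop),
      (∀ i, DefP L A (fun q : V × M => F i q.1 q.2)) ∧
      (∀ i v z z', F i v z → F i v z' → z = z') ∧
      ∀ v y, D v y → (∃ i, F i v y) ∨ ((∀ z, z < y → NR z (D v)) ∧ NM (D v)) ∨
        ∃ i z0, F i v z0 ∧ z0 < y ∧ ∀ z, z0 ≤ z → z < y → NR z (D v) := by
  let B : V → M → Prop := fun v z => ¬ NN z (fun z' => D v z' ↔ D v z)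
  have hB : DefP L A (fun q : V × M => B q.1 q.2) := by
    refine DefP.not (DefP.nn (P := fun (q : V × M) z' => D q.1 z' ↔ D q.1 q.2) DefF.snd0 ?_)
    exact dfn
  have hDv : ∀ v, DefP L (univ : Set M) (D v) := fun v =>
    DefP.comp2 (hD.mono (subset_univ A)) (DefF.const v) DefF.id
  have hfin : ∀ v, {z | B v z}.Finite := fun v => bd_finite (hDv v)
  obtain ⟨N, hN⟩ := unif_fin (hB.mono (subset_univ A)) hfin
  refine ⟨N, fun i v z => B v z ∧ AL (B v) i z ∧ ¬ AL (B v) (i+1) z, fun i => ?_, ?_, ?_⟩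
  · exact DefP.and hB (DefP.and (DefP.al hB _) (DefP.not (DefP.al hB _)))
  · rintro i v z z' ⟨h1, h2, h3⟩ ⟨h4, h5, h6⟩
    exact rank_unique _ h1 h4 h2 h3 h5 h6
  · intro v y hy
    have rk : ∀ z, B v z → ∃ i : Fin N, B v z ∧ AL (B v) i z ∧ ¬ AL (B v) (i+1) z := by
      intro z hz
      have lt : {t | B v t ∧ t < z}.ncard < {t | B v t}.ncard := by
        refine ncard_lt_ncard ⟨fun t h => h.1, fun h => ?_⟩ (hfin v)
        exact lt_irrefl z (h (show z ∈ {t | B v t} from hz)).2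
      refine ⟨⟨_, lt.trans_le (hN v)⟩, hz, (al_iff (hfin v) _ _).2 le_rfl, ?_⟩
      rw [al_iff (hfin v)]
      simp
    by_cases hBy : B v y
    · exact Or.inl (rk y hBy)
    have run : ∀ w, w ≤ y → (∀ t, w ≤ t → t ≤ y → ¬ B v t) → D v w := by
      intro w hw hno
      by_contra hDw
      refine conn (L := L) (P := fun z => ¬ D v z) (DefP.not (hDv v)) hw (fun t h1 h2 => ?_) hDw hy
      have := hno t h1 h2
      simp only [B, not_not] at this
      exact this.mono fun x hx => not_congr hx
    right
    by_cases hex : ∃ z, B v z ∧ z < y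
    · right
      have fin : {z | B v z ∧ z < y}.Finite := (hfin v).subset fun t h => h.1
      obtain ⟨z0, hz0, hmax⟩ := fin.exists_maximalFor id _ hex
      obtain ⟨i, hi⟩ := rk z0 hz0.1
      refine ⟨i, z0, hi, hz0.2, fun z h1 h2 => ⟨y, h2, fun w w1 w2 => run w w2.le fun t t1 t2 hb => ?_⟩⟩
      rcases t2.lt_or_eq with k | k
      · have h3 : z0 < t := h1.trans_lt (w1.trans_le t1)
        exact (hmax (j := t) ⟨hb, k⟩ h3.le).not_gt h3
      · exact hBy (k ▸ hb)
    · left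
      push Not at hex
      have all : ∀ w, w < y → D v w := fun w hw => run w hw.le fun t t1 t2 hb => by
        rcases t2.lt_or_eq with k | k
        · exact (hex t hb).not_gt k
        · exact hBy (k ▸ hb)
      exact ⟨fun z hz => ⟨y, hz, fun w _ w2 => all w w2⟩, ⟨y, fun w hw => all w hw⟩⟩

theorem sel_point {G : E → M → Prop} {e : E} {z0 : M} (hG : G e z0)
    (hf : ∀ z z', G e z → G e z' → z = z') {P : M → Prop} (hP : P z0) :
    Sel (fun e z => ∃ z0, G e z0 ∧ z0 ≤ z) G e P := by
  refine Or.inr (Or.inr ⟨z0, ⟨?_, fun d hd => hd z0 ⟨z0, hG, le_rfl⟩⟩, Or.inl ⟨hG, hP⟩⟩)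
  rintro z ⟨z1, h1, h2⟩
  rwa [hf z0 z1 hG h1]

theorem sel_right {G : E → M → Prop} {e : E} {z0 : M} (hG : G e z0)
    (hf : ∀ z z', G e z → G e z' → z = z') {P : M → Prop} (hP : NR z0 P) :
    Sel (fun e z => ∃ z0, G e z0 ∧ z0 < z) (fun _ _ => False) e P := by
  refine Or.inr (Or.inr ⟨z0, ⟨?_, fun d hd => ?_⟩, Or.inr (Or.inr ⟨id, ?_, hP⟩)⟩)
  · rintro z ⟨z1, h1, h2⟩
    rw [hf z0 z1 hG h1]; exact h2.le
  · by_contra hlt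
    push Not at hlt
    obtain ⟨t, t1, t2⟩ := exists_between hlt
    exact (hd t ⟨z0, hG, t1⟩).not_gt t2
  · rintro ⟨z1, h1, h2⟩
    rw [hf z0 z1 hG h1] at h2
    exact lt_irrefl _ h2

theorem sel_bot {e : E} {P : M → Prop} (hP : NM P) :
    Sel (fun (_ : E) _ => True) (fun _ _ => False) e P :=
  Or.inr (Or.inl ⟨fun b => let ⟨z, hz⟩ := exists_lt b; ⟨z, hz, trivial⟩, hP⟩)

theorem DefQ.or {X : Type u} [Crd M X] {q : E → (X → Prop) → Prop} (h : DefQ L A q) {e : E} {P Q : X → Prop}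
    (hP : DefP L (univ : Set M) P) (hQ : DefP L (univ : Set M) Q) (hp : q e (fun x => P x ∨ Q x)) :
    q e P ∨ q e Q := by
  by_contra hno
  push Not at hno
  have h1 := (h.and e _ _ hP.not hQ.not).2 ⟨(h.not e _ hP).2 hno.1, (h.not e _ hQ).2 hno.2⟩
  have h2 := (h.not e _ (DefP.or hP hQ)).1
  exact h2 (h.congr h1 fun x => by push Not; rfl) hp

end strata

section ud
variable {L : FirstOrder.Language} {M : Type u} [L.Structure M] [LinearOrder M] [OMin L M]
variable [DenselyOrdered M] [NoMinOrder M] [NoMaxOrder M] [Nonempty M]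
variable {A : Set M} {X : Type u} [Crd M X]

/-- Uniform definability of types restricted to one family. -/
def UD (L : FirstOrder.Language) {M : Type u} [L.Structure M] (A : Set M) (X : Type u) [Crd M X] : Prop :=
  ∀ p : (X → Prop) → Prop, DefQ L (univ : Set M) (fun (_ : PUnit.{u+1}) => p) →
  ∀ (U : Type u) [Crd M U] (D : U → X → Prop), DefP L A (fun z : U × X => D z.1 z.2) →
  ∃ (E : Type u) (_ : Crd M E) (q : E → (X → Prop) → Prop), DefQ L A q ∧ ∃ e0, ∀ u, p (D u) → q e0 (D u)

theorem UD.two (h : UD L A X) {p : (X → Prop) → Prop} (hp : DefQ L (univ : Set M) (fun (_ : PUnit.{u+1}) => p))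
    {U : Type u} [Crd M U] {D1 D2 : U → X → Prop} (h1 : DefP L A (fun z : U × X => D1 z.1 z.2))
    (h2 : DefP L A (fun z : U × X => D2 z.1 z.2)) :
    ∃ (E : Type u) (_ : Crd M E) (q : E → (X → Prop) → Prop), DefQ L A q ∧
      ∃ e0, (∀ u, p (D1 u) ↔ q e0 (D1 u)) ∧ ∀ u, p (D2 u) ↔ q e0 (D2 u) := by
  obtain ⟨E, hE, q, hq, e0, he⟩ := h p hp (U × M × M × M) (fun v x =>
    (v.2.1 = v.2.2.1 ∧ v.2.1 = v.2.2.2 ∧ D1 v.1 x) ∨ (v.2.1 = v.2.2.1 ∧ ¬ v.2.1 = v.2.2.2 ∧ ¬ D1 v.1 x) ∨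
    (¬ v.2.1 = v.2.2.1 ∧ v.2.1 = v.2.2.2 ∧ D2 v.1 x) ∨ (¬ v.2.1 = v.2.2.1 ∧ ¬ v.2.1 = v.2.2.2 ∧ ¬ D2 v.1 x)) dfn
  obtain ⟨a⟩ := ‹Nonempty M›
  obtain ⟨b, hb⟩ := exists_gt a
  have hab : ¬ a = b := hb.ne
  have k1 : ∀ u, DefP L (univ : Set M) (D1 u) := fun u =>
    DefP.comp2 (h1.mono (subset_univ A)) (DefF.const u) DefF.id
  have k2 : ∀ u, DefP L (univ : Set M) (D2 u) := fun u =>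
    DefP.comp2 (h2.mono (subset_univ A)) (DefF.const u) DefF.id
  refine ⟨E, hE, q, hq, e0, fun u => ⟨fun hu => ?_, fun hu => ?_⟩, fun u => ⟨fun hu => ?_, fun hu => ?_⟩⟩
  · exact hq.congr (he (u, a, a, a) (hp.congr (e := PUnit.unit) hu fun x => by simp)) fun x => by simp
  · by_contra hno
    have hno := (hp.not PUnit.unit _ (k1 u)).2 hno
    have := hq.congr (he (u, a, a, b) (hp.congr (e := PUnit.unit) hno fun x => by simp [hab]))
      (Q := fun x => ¬ D1 u x) fun x => by simp [hab]
    exact (hq.not _ _ (k1 u)).1 this hu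
  · exact hq.congr (he (u, a, b, a) (hp.congr (e := PUnit.unit) hu fun x => by simp [hab])) fun x => by simp [hab]
  · by_contra hno
    have hno := (hp.not PUnit.unit _ (k2 u)).2 hno
    have := hq.congr (he (u, a, b, b) (hp.congr (e := PUnit.unit) hno fun x => by simp [hab]))
      (Q := fun x => ¬ D2 u x) fun x => by simp [hab]
    exact (hq.not _ _ (k2 u)).1 this hu

theorem UD.unit : UD L A PUnit.{u+1} := by
  intro p hp U _ D hD
  refine ⟨PUnit, inferInstance, fun _ P => P PUnit.unit, DefQ.point (f := fun _ => PUnit.unit) DefF.unit,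
    PUnit.unit, fun u hu => ?_⟩
  obtain ⟨⟨⟩, hx⟩ := hp.exists (e := PUnit.unit)
    (DefP.comp2 (hD.mono (subset_univ A)) (DefF.const u) DefF.id) hu
  exact hx

theorem UD.trans {Y : Type u} [Crd M Y] (h : UD L A X) {f : Y → X} {g : X → Y} (hf : DefF L A f) (hg : DefF L A g)
    (hgf : ∀ v, g (f v) = v) : UD L A Y := by
  intro p hp U _ D hD
  obtain ⟨E, hE, q, hq, e0, he⟩ := h _ (hp.push (hf.mono (subset_univ A))) U (fun u x => D u (g x)) dfn
  refine ⟨E, hE, _, hq.push hg, e0, fun u hu => he u ?_⟩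
  simpa only [hgf] using hu

theorem exists_max {N : ℕ} {ne : Fin N → Prop} {le : Fin N → Fin N → Prop} (i0 : Fin N) (h0 : ne i0)
    (hrefl : ∀ i, le i i) (htr : ∀ i j k, le i j → le j k → le i k)
    (htot : ∀ i j, ne i → ¬ le j i → ne j ∧ le i j) :
    ∃ i, ne i ∧ ∀ j, le j i := by
  have : ∀ s : Finset (Fin N), ∃ i, ne i ∧ ∀ j ∈ s, le j i := by
    intro s
    induction s using Finset.induction_on with
    | empty => exact ⟨i0, h0, by simp⟩
    | insert j s hj ih =>
      obtain ⟨i, hi, his⟩ := ih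
      by_cases hji : le j i
      · refine ⟨i, hi, fun k hk => ?_⟩
        rcases Finset.mem_insert.1 hk with rfl | hk
        · exact hji
        · exact his k hk
      · obtain ⟨h1, h2⟩ := htot i j hi hji
        refine ⟨j, h1, fun k hk => ?_⟩
        rcases Finset.mem_insert.1 hk with rfl | hk
        · exact hrefl _
        · exact htr _ _ _ (his k hk) h2
  obtain ⟨i, hi, h⟩ := this Finset.univ
  exact ⟨i, hi, fun j => h j (Finset.mem_univ j)⟩

end ud
end OM

namespace OM
set_option linter.unusedSectionVars false

section ud
variable {L : FirstOrder.Language} {M : Type u} [L.Structure M] [LinearOrder M] [OMin L M]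
variable [DenselyOrdered M] [NoMinOrder M] [NoMaxOrder M] [Nonempty M]
variable {A : Set M} {X : Type u} [Crd M X]

set_option maxHeartbeats 4000000 in
theorem UD.step (ih : UD L A X) : UD L A (M × X) := by
  intro p hp U _ D hD
  have hDu := hD.mono (subset_univ A)
  obtain ⟨N, F, hF, hfun, key⟩ := strata (D := fun (v : U × X) y => D v.1 (y, v.2)) (A := A) (L := L) dfn
  have hFu := fun i => (hF i).mono (subset_univ A)
  have hr : DefQ L (univ : Set M) (fun (_ : PUnit.{u+1}) (P : X → Prop) => p (fun yx => P yx.2)) :=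
    hp.push (f := fun yx : M × X => yx.2) DefF.snd0
  have pmono : ∀ {P Q : M × X → Prop}, p P → DefP L (univ : Set M) P → DefP L (univ : Set M) Q →
    (∀ y x, P (y, x) → Q (y, x)) → p Q := fun h1 h2 h3 h4 => hp.mono (e := PUnit.unit) h2 h3 h1 fun yx => h4 yx.1 yx.2
  have pand : ∀ {P Q : M × X → Prop}, p P → p Q → DefP L (univ : Set M) P → DefP L (univ : Set M) Q →
    p (fun yx => P yx ∧ Q yx) := fun h1 h2 h3 h4 => (hp.and PUnit.unit _ _ h3 h4).2 ⟨h1, h2⟩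
  have dDu : ∀ u, DefP L (univ : Set M) (D u) := fun u => DefP.comp2 hDu (DefF.const u) DefF.id
  by_cases c1 : ∃ i u0, p (fun yx => F i (u0, yx.2) yx.1)
  · obtain ⟨i, u0, h0⟩ := c1
    have hFi := hF i
    have hFiu := hFu i
    obtain ⟨E, hE, q, hq, e0, he⟩ := ih _ hr (U × U)
      (fun v x => ∃ y, F i (v.2, x) y ∧ D v.1 (y, x)) dfn
    have hs : DefQ L A (Sel (fun (e : (E × U) × X) z => ∃ z0, F i (e.1.2, e.2) z0 ∧ z0 ≤ z)
      (fun (e : (E × U) × X) z => F i (e.1.2, e.2) z)) := DefQ.sel dfn dfn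
    have hq1 := hq.reparam (f := fun e : E × U => e.1) DefF.fst0
    refine ⟨E × U, inferInstance, _, hq1.fib hs, (e0, u0), fun u hu => ?_⟩
    have h1 := he (u, u0) (pmono (pand h0 hu dfn (dDu u)) (DefP.and dfn (dDu u)) dfn
      fun y x h => ⟨y, h.1, h.2⟩)
    refine hq.mono dfn ?_ h1 ?_
    · refine hs.univ_ (fun x y => D u (y, x)) (fun x => ((e0, u0), x)) dfn dfn
    · rintro x ⟨y, y1, y2⟩
      exact sel_point (G := fun (e : (E × U) × X) z => F i (e.1.2, e.2) z) y1 (fun z z' => hfun i _ z z') y2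
  have dL : ∀ i u, DefP L (univ : Set M) (fun yx : M × X => ∃ z, F i (u, yx.2) z ∧ z < yx.1) := fun i u => by
    have hFiu := hFu i
    exact dfn
  have key2 : ∀ u, p (D u) → p (fun yx => ((∀ z, z < yx.1 → NR z (fun y => D u (y, yx.2))) ∧ NM (fun y => D u (y, yx.2))) ∨
        ∃ i z0, F i (u, yx.2) z0 ∧ z0 < yx.1 ∧ ∀ z, z0 ≤ z → z < yx.1 → NR z (fun y => D u (y, yx.2))) := by
    intro u hu
    push Not at c1
    have h1 := hp.allFin (e := PUnit.unit) (P := fun i yx => ¬ F i (u, yx.2) yx.1) (fun i => by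
      have hFiu := hFu i
      exact dfn) (fun i => (hp.not PUnit.unit _ (by
      have hFiu := hFu i
      exact dfn)).2 (c1 i u))
    refine pmono (pand h1 hu ?_ (dDu u)) (DefP.and ?_ (dDu u)) ?_ ?_
    · refine DefP.allFin fun i => ?_
      have hFiu := hFu i
      exact dfn
    · refine DefP.allFin fun i => ?_
      have hFiu := hFu i
      exact dfn
    · refine DefP.or dfn (DefP.exFin fun i => ?_)
      have hFiu := hFu i
      exact dfn
    · rintro y x ⟨h2, h3⟩
      rcases key (u, x) y h3 with ⟨i, k⟩ | k
      · exact absurd k (h2 i)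
      · exact k
  have dA : ∀ u, DefP L (univ : Set M) (fun yx : M × X => (∀ z, z < yx.1 → NR z (fun y => D u (y, yx.2))) ∧ NM (fun y => D u (y, yx.2))) := fun u => dfn
  have dB : ∀ u i, DefP L (univ : Set M) (fun yx : M × X => ∃ z0, F i (u, yx.2) z0 ∧ z0 < yx.1 ∧ ∀ z, z0 ≤ z → z < yx.1 → NR z (fun y => D u (y, yx.2))) := by
    intro u i
    have hFiu := hFu i
    exact dfn
  have key3 : ∀ u, p (D u) → p (fun yx => ((∀ z, z < yx.1 → NR z (fun y => D u (y, yx.2))) ∧ NM (fun y => D u (y, yx.2)))) ∨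
      ∃ i, p (fun yx => ∃ z0, F i (u, yx.2) z0 ∧ z0 < yx.1 ∧ ∀ z, z0 ≤ z → z < yx.1 → NR z (fun y => D u (y, yx.2))) := by
    intro u hu
    rcases hp.or (e := PUnit.unit) (dA u) (DefP.exFin (dB u)) (key2 u hu) with h | h
    · exact Or.inl h
    · exact Or.inr (hp.exFin (e := PUnit.unit) (dB u) h)
  by_cases c2 : ∃ i u, p (fun yx => ∃ z, F i (u, yx.2) z ∧ z < yx.1)
  swap
  · push Not at c2
    obtain ⟨E, hE, q, hq, e0, he⟩ := ih _ hr U (fun u x => NM (fun y => D u (y, x))) dfn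
    have hs : DefQ L A (Sel (fun (e : E × X) (z : M) => True) (fun (e : E × X) z => False)) := DefQ.sel dfn dfn
    refine ⟨E, hE, _, hq.fib hs, e0, fun u hu => ?_⟩
    have h1 : q e0 (fun x => NM (fun y => D u (y, x))) := by
      refine he u ?_
      rcases key3 u hu with h | ⟨i, h⟩
      · exact pmono h (dA u) dfn fun y x h => h.2
      · exact absurd (pmono h (dB u i) (dL i u) fun y x ⟨z, h1, h2, _⟩ => ⟨z, h1, h2⟩) (c2 i u)
    refine hq.mono dfn ?_ h1 ?_
    · exact hs.univ_ (fun x y => D u (y, x)) (fun x => (e0, x)) dfn dfn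
    · exact fun x h => sel_bot h
  -- main case
  have dle : ∀ i j u v, DefP L (univ : Set M) (fun yx : M × X => ∃ z z', F i (u, yx.2) z ∧ F j (v, yx.2) z' ∧ z ≤ z') := by
    intro i j u v
    have h1 := hFu i
    have h2 := hFu j
    exact dfn
  have tot : ∀ i j u v, p (fun yx => ∃ z, F i (u, yx.2) z ∧ z < yx.1) → p (fun yx => ∃ z, F j (v, yx.2) z ∧ z < yx.1) →
      p (fun yx => ∃ z z', F i (u, yx.2) z ∧ F j (v, yx.2) z' ∧ z ≤ z') ∨
      p (fun yx => ∃ z z', F j (v, yx.2) z ∧ F i (u, yx.2) z' ∧ z ≤ z') := by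
    intro i j u v hu hv
    refine hp.or (e := PUnit.unit) (dle i j u v) (dle j i v u) ?_
    refine pmono (pand hu hv (dL _ _) (dL _ _)) (DefP.and (dL _ _) (dL _ _)) (DefP.or (dle _ _ _ _) (dle _ _ _ _)) ?_
    rintro y x ⟨⟨z, h1, _⟩, ⟨z', h2, _⟩⟩
    rcases le_total z z' with h | h
    · exact Or.inl ⟨z, z', h1, h2, h⟩
    · exact Or.inr ⟨z', z, h2, h1, h⟩
  have trn : ∀ i j k u v w, p (fun yx => ∃ z z', F i (u, yx.2) z ∧ F j (v, yx.2) z' ∧ z ≤ z') →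
      p (fun yx => ∃ z z', F j (v, yx.2) z ∧ F k (w, yx.2) z' ∧ z ≤ z') →
      p (fun yx => ∃ z z', F i (u, yx.2) z ∧ F k (w, yx.2) z' ∧ z ≤ z') := by
    intro i j k u v w hu hv
    refine pmono (pand hu hv (dle _ _ _ _) (dle _ _ _ _)) (DefP.and (dle _ _ _ _) (dle _ _ _ _)) (dle _ _ _ _) ?_
    rintro y x ⟨⟨z, z', h1, h2, h3⟩, ⟨z1, z1', k1, k2, k3⟩⟩
    have := hfun _ _ _ _ h2 k1
    exact ⟨z, z1', h1, k2, (this ▸ h3).trans k3⟩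
  obtain ⟨i0, hi0⟩ := c2
  obtain ⟨i, hne, hmax⟩ := exists_max (ne := fun i => ∃ u, p (fun yx => ∃ z, F i (u, yx.2) z ∧ z < yx.1))
    (le := fun i' i => ∀ u', p (fun yx => ∃ z, F i' (u', yx.2) z ∧ z < yx.1) →
      ∃ u, p (fun yx => ∃ z, F i (u, yx.2) z ∧ z < yx.1) ∧
      p (fun yx => ∃ z z', F i' (u', yx.2) z ∧ F i (u, yx.2) z' ∧ z ≤ z')) i0 hi0
    (fun i u hu => ⟨u, hu, (tot i i u u hu hu).elim id id⟩)
    (fun i j k hij hjk u hu => by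
      obtain ⟨v, hv, h1⟩ := hij u hu
      obtain ⟨w, hw, h2⟩ := hjk v hv
      exact ⟨w, hw, trn _ _ _ _ _ _ h1 h2⟩)
    (fun i j _ hji => by
      push Not at hji
      obtain ⟨v, hv, h1⟩ := hji
      exact ⟨⟨v, hv⟩, fun u hu => ⟨v, hv, (tot i j u v hu hv).resolve_right (h1 u hu)⟩⟩)
  have hFi := hF i
  have hFiu := hFu i
  obtain ⟨E, hE, q, hq, e0, heR, heW⟩ := ih.two hr (U := U × U)
    (D1 := fun v x => ∃ z z', F i (v.1, x) z ∧ F i (v.2, x) z' ∧ z ≤ z')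
    (D2 := fun v x => ∃ z, F i (v.2, x) z ∧ NR z (fun y => D v.1 (y, x))) dfn dfn
  have dLi : DefP L (univ : Set M) (fun u => p (fun yx => ∃ z, F i (u, yx.2) z ∧ z < yx.1)) :=
    hp.univ1 PUnit.unit (fun (u : U) yx => ∃ z, F i (u, yx.2) z ∧ z < yx.1) dfn
  obtain ⟨s, c, G, hG, hGL⟩ := DefP.params dLi
  have hGA := hG.mono (empty_subset A)
  have hGu := hG.mono (subset_univ _)
  have hO : DefP L A (fun z : (E × (Fin s → M)) × U × U => q z.1.1
      (fun x => ∃ z1 z', F i (z.2.1, x) z1 ∧ F i (z.2.2, x) z' ∧ z1 ≤ z')) :=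
    hq.defn (Y := (E × (Fin s → M)) × U × U) (fun z x => ∃ z1 z', F i (z.2.1, x) z1 ∧ F i (z.2.2, x) z' ∧ z1 ≤ z')
      (fun z => z.1.1) dfn dfn
  obtain ⟨t, ht, ht'⟩ := lemP (L := L) (A := A) U (E × (Fin s → M)) (fun e u => G e.2 u)
    (fun e u u' => q e.1 (fun x => ∃ z z', F i (u, x) z ∧ F i (u', x) z' ∧ z ≤ z')) dfn hO
  have hs : DefQ L A (Sel (fun (e : ((E × (Fin s → M)) × U) × X) z => ∃ z0, F i (e.1.2, e.2) z0 ∧ z0 < z)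
      (fun (e : ((E × (Fin s → M)) × U) × X) z => False)) := DefQ.sel dfn dfn
  have hq1 := hq.reparam (f := fun e : (E × (Fin s → M)) × U => e.1.1) dfn
  have hq2 := hq1.fib hs
  refine ⟨E × (Fin s → M), inferInstance, _, ht.bind hq2, (e0, c), fun u hu => ?_⟩
  have claim : ∃ u1, G c u1 ∧ ∀ u2, G c u2 → q e0 (fun x => ∃ z z', F i (u1, x) z ∧ F i (u2, x) z' ∧ z ≤ z') →
      q e0 (fun x => ∃ z, F i (u2, x) z ∧ NR z (fun y => D u (y, x))) := by
    rcases key3 u hu with h | ⟨j, h⟩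
    · obtain ⟨u1, hu1⟩ := hne
      refine ⟨u1, (hGL u1).1 hu1, fun u2 g2 _ => (heW (u, u2)).1 ?_⟩
      refine pmono (pand ((hGL u2).2 g2) h (dL _ _) (dA u)) (DefP.and (dL _ _) (dA u)) dfn ?_
      rintro y x ⟨⟨z, z1, z2⟩, h1, _⟩
      exact ⟨z, z1, h1 z z2⟩
    · obtain ⟨u1, hu1, hle⟩ := hmax j u (pmono h (dB u j) (dL j u) fun y x ⟨z, h1, h2, _⟩ => ⟨z, h1, h2⟩)
      refine ⟨u1, (hGL u1).1 hu1, fun u2 g2 h2 => (heW (u, u2)).1 ?_⟩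
      have h2 := (heR (u1, u2)).2 h2
      have h3 := trn _ _ _ _ _ _ hle h2
      refine pmono (pand (pand ((hGL u2).2 g2) h (dL _ _) (dB u j)) h3 (DefP.and (dL _ _) (dB u j)) (dle _ _ _ _))
        (DefP.and (DefP.and (dL _ _) (dB u j)) (dle _ _ _ _)) dfn ?_
      rintro y x ⟨⟨⟨z, z1, z2⟩, ⟨w, w1, w2, w3⟩⟩, ⟨a, b, a1, b1, ab⟩⟩
      have e1 := hfun _ _ _ _ z1 b1
      have e2 := hfun _ _ _ _ w1 a1
      subst e1 e2
      exact ⟨z, z1, w3 z ab z2⟩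
  obtain ⟨u1, g1, hu1⟩ := claim
  have h4 := ht' (e0, c) (fun u v gu gv => by
      rcases tot i i u v ((hGL u).2 gu) ((hGL v).2 gv) with h | h
      · exact Or.inl ((heR (u, v)).1 h)
      · exact Or.inr ((heR (v, u)).1 h))
    (fun u v w gu gv gw h1 h2 => (heR (u, w)).1 (trn _ _ _ _ _ _ ((heR (u, v)).2 h1) ((heR (v, w)).2 h2))) u1 g1
  refine ht.mono ?_ ?_ h4 ?_
  · refine DefP.and dfn ?_
    exact hq.univ1 e0 (fun (v : U) x => ∃ z z', F i (u1, x) z ∧ F i (v, x) z' ∧ z ≤ z') dfn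
  · refine hq2.univ_ (fun (v : U) => D u) (fun v => ((e0, c), v)) ?_ dfn
    have := dDu u
    exact dfn
  · rintro u2 ⟨g2, h2⟩
    refine hq.mono dfn ?_ (hu1 u2 g2 h2) ?_
    · exact hs.univ_ (fun x y => D u (y, x)) (fun x => (((e0, c), u2), x)) dfn dfn
    · rintro x ⟨z, z1, z2⟩
      exact sel_right (G := fun (e : ((E × (Fin s → M)) × U) × X) z => F i (e.1.2, e.2) z) z1
        (fun z z' => hfun i _ z z') z2

theorem UD.pow (m : ℕ) : UD L A (Pow M m) := by
  induction m with
  | zero => exact UD.unit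
  | succ m ih => exact ih.step

theorem ud (X : Type u) [Crd M X] : UD L A X := by
  obtain ⟨n, f, g, hf, hg, h1, h2⟩ := exists_pow (M := M) L X
  exact (UD.pow n).trans (hf A) (hg A) h1

end ud
end OM

namespace OM
set_option linter.unusedSectionVars false

section transfer
variable {L : FirstOrder.Language} {M : Type u} [L.Structure M] {A : Set M} {k m : ℕ}

theorem defP_fun {X : Set (Fin k → M)} : DefP L A (fun v => v ∈ X) ↔ A.Definable L X := by
  unfold DefP; exact Iff.rfl

theorem defP_pair {H : (Fin m → M) → (Fin k → M) → Prop} :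
    DefP L A (fun z : (Fin m → M) × (Fin k → M) => H z.1 z.2) ↔
    A.Definable L {w : Fin m ⊕ Fin k → M | H (w ∘ Sum.inl) (w ∘ Sum.inr)} := by
  unfold DefP; exact Iff.rfl

theorem exists_fin (L : FirstOrder.Language) {M : Type u} [L.Structure M] (X : Type u) [Crd M X] :
    ∃ (n : ℕ) (f : X → (Fin n → M)) (g : (Fin n → M) → X),
    (∀ A : Set M, DefF L A f) ∧ (∀ A : Set M, DefF L A g) ∧ (∀ x, g (f x) = x) := by
  let e : Fin (Nat.card (Crd.ι M X)) ≃ Crd.ι M X := (Finite.equivFin _).symm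
  refine ⟨_, fun x => Crd.e x ∘ e, fun y => Crd.e.symm (y ∘ e.symm), fun A => ?_, fun A => ?_, fun x => ?_⟩
  · exact DefF.of_reindex _ e (fun x => rfl)
  · refine DefF.of_reindex _ e.symm (fun x => ?_)
    simp only [Equiv.apply_symm_apply]
    rfl
  · apply (Crd.e (M := M) (X := X)).injective
    rw [Equiv.apply_symm_apply]
    funext i
    simp

theorem typeToQ {p : Set (Set (Fin k → M))} (h1 : IsTypeOn L k p) (h2 : IsDefTypeOver L (univ : Set M) k p) :
    DefQ L (univ : Set M) (fun (_ : PUnit.{u+1}) (P : (Fin k → M) → Prop) => {v | P v} ∈ p) := by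
  obtain ⟨a1, a2, a3, a4, a5⟩ := h1
  have sd : ∀ {P : (Fin k → M) → Prop}, DefP L (univ : Set M) P → (univ : Set M).Definable L {v | P v} :=
    fun h => defP_fun.1 h
  refine ⟨fun _ P Q hP hQ => ⟨fun h => ⟨?_, ?_⟩, fun h => a3 _ h.1 _ h.2⟩, fun _ P hP => ⟨fun h h' => ?_, fun h => ?_⟩, ?_⟩
  · exact a4 _ h _ (sd hP) fun x hx => hx.1
  · exact a4 _ h _ (sd hQ) fun x hx => hx.2
  · apply a2
    have := a3 _ h _ h'
    convert! this using 1
    ext x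
    exact ⟨fun h => h.elim, fun h => h.1 h.2⟩
  · exact (a5 _ (sd hP)).resolve_left h
  · intro Y _ P _ hP _
    obtain ⟨s, c, G, hG, hGP⟩ := DefP.params hP
    obtain ⟨m, f, g, hf, hg, hgf⟩ := exists_fin L (M := M) ((Fin s → M) × Y)
    let H : (Fin m → M) → (Fin k → M) → Prop := fun a v => G (g a).1 ((g a).2, v)
    have hH : DefP L (∅ : Set M) (fun z : (Fin m → M) × (Fin k → M) => H z.1 z.2) := by
      have := hg ∅
      exact DefP.comp2 (H := G) hG (DefF.fst (DefF.comp this DefF.fst0)) (DefF.pair (DefF.snd (DefF.comp this DefF.fst0)) DefF.snd0)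
    have h3 := h2 m _ (defP_pair.1 hH)
    have h4 := (defP_fun.2 h3).comp (f := fun y : Y => f (c, y)) (DefF.comp (hf univ) (DefF.pair (DefF.const c) DefF.id))
    refine h4.congr fun y => ?_
    have : famFiber {w : Fin m ⊕ Fin k → M | H (w ∘ Sum.inl) (w ∘ Sum.inr)} (f (c, y)) = {v | P y v} := by
      ext v
      change H (f (c, y)) v ↔ P y v
      simp only [H, hgf]
      exact (hGP (y, v)).symm
    rw [mem_ofPred_eq, this]

theorem qToType {q : PUnit.{u+1} → ((Fin k → M) → Prop) → Prop} (hq : DefQ L A q) :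
    IsTypeOn L k {X | (univ : Set M).Definable L X ∧ q PUnit.unit (fun v => v ∈ X)} ∧
    IsDefTypeOver L A k {X | (univ : Set M).Definable L X ∧ q PUnit.unit (fun v => v ∈ X)} := by
  refine ⟨⟨fun X h => h.1, ?_, ?_, ?_, ?_⟩, ?_⟩
  · rintro ⟨-, h⟩
    obtain ⟨x, hx⟩ := hq.exists (DefP.const False) h
    exact hx
  · rintro X ⟨h1, h2⟩ Y ⟨h3, h4⟩
    exact ⟨h1.inter h3, (hq.and _ _ _ (defP_fun.2 h1) (defP_fun.2 h3)).2 ⟨h2, h4⟩⟩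
  · rintro X ⟨h1, h2⟩ Y h3 h4
    exact ⟨h3, hq.mono (defP_fun.2 h1) (defP_fun.2 h3) h2 fun x hx => h4 hx⟩
  · intro X hX
    by_cases h : q PUnit.unit (fun v => v ∈ X)
    · exact Or.inl ⟨hX, h⟩
    · exact Or.inr ⟨hX.compl, (hq.not _ _ (defP_fun.2 hX)).2 h⟩
  · intro m D hD
    have hD' : DefP L (∅ : Set M) (fun z : (Fin m → M) × (Fin k → M) => Sum.elim z.1 z.2 ∈ D) := by
      rw [defP_pair (H := fun a b => Sum.elim a b ∈ D)]
      convert! hD using 1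
      ext w
      simp
    have h1 := hq.defn (fun (u : Fin m → M) v => Sum.elim u v ∈ D) (fun _ => PUnit.unit)
      (hD'.mono (empty_subset A)) DefF.unit
    refine defP_fun.1 (h1.congr fun u => ⟨fun h => ⟨?_, h⟩, fun h => h.2⟩)
    exact defP_fun.1 (DefP.comp2 (H := fun u v => Sum.elim u v ∈ D) (hD'.mono (empty_subset univ)) (DefF.const u) DefF.id)

/-- Finite products of coordinate spaces. -/
@[reducible] def crdPi (M : Type u) (n : ℕ) (E : Fin n → Type u) (c : ∀ i, Crd M (E i)) : Crd M (∀ i, E i) where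
  ι := Σ i, (c i).ι
  fin := inferInstance
  e := (Equiv.piCongrRight fun i => (c i).e).trans (Equiv.piCurry (fun i _ => M)).symm

end transfer

section final
variable {L : FirstOrder.Language} {M : Type u} [L.Structure M] [LinearOrder M] [OMin L M]
variable [DenselyOrdered M] [NoMinOrder M] [NoMaxOrder M] [Nonempty M]
variable {A : Set M} {X U : Type u} [Crd M X] [Crd M U]

theorem final {n : ℕ} {p : Fin n → (X → Prop) → Prop} (hp : ∀ i, DefQ L (univ : Set M) (fun (_ : PUnit.{u+1}) => p i))
    {D : U → X → Prop} (hD : DefP L A (fun z : U × X => D z.1 z.2)) {Ω : U → Prop} (hΩ : DefP L A Ω)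
    (hcov : ∀ u, Ω u → ∃ i, p i (D u)) :
    ∃ r : Fin n → PUnit.{u+1} → (X → Prop) → Prop, (∀ i, DefQ L A (r i)) ∧ ∀ u, Ω u → ∃ i, r i PUnit.unit (D u) := by
  have := fun i => ud (L := L) (A := A) X (p i) (hp i) U D hD
  choose E cE q hq e0 he using this
  letI := crdPi M n E cE
  have pr : ∀ (B : Set M) i, DefF L B (fun e : ∀ i, E i => e i) := fun B i =>
    DefF.of_reindex _ (fun j => ⟨i, j⟩) (fun e => rfl)
  have hg : ∀ i (B : Set M), A ⊆ B → DefP L B (fun z : (∀ i, E i) × U => q i (z.1 i) (D z.2)) := by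
    intro i B hB
    have h1 : DefP L A (fun z : (∀ i, E i) × U => q i (z.1 i) (D z.2)) :=
      (hq i).defn (fun z : (∀ i, E i) × U => D z.2) (fun z => z.1 i) dfn (DefF.comp (pr A i) DefF.fst0)
    exact h1.mono hB
  have hGood : DefP L A (fun e : ∀ i, E i => ∀ u, Ω u → ∃ i, q i (e i) (D u)) := by
    refine DefP.all (P := fun (e : ∀ i, E i) u => Ω u → ∃ i, q i (e i) (D u)) ?_
    exact DefP.imp dfn (DefP.exFin fun i => hg i A subset_rfl)
  obtain ⟨s, hs, hs'⟩ := lemP (L := L) (A := A) (∀ i, E i) PUnit.{u+1}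
    (fun _ e => ∀ u, Ω u → ∃ i, q i (e i) (D u)) (fun _ _ _ => True) (hGood.comp DefF.snd0) (DefP.const True)
  have h1 := hs' PUnit.unit (fun _ _ _ _ => Or.inl trivial) (fun _ _ _ _ _ _ _ _ => trivial) e0
    (fun u hu => (hcov u hu).imp fun i hi => he i u hi)
  have hr : ∀ i, DefQ L A (fun z : PUnit.{u+1} × (∀ i, E i) => q i (z.2 i)) := fun i =>
    (hq i).reparam (DefF.comp (pr A i) DefF.snd0)
  refine ⟨fun i => _, fun i => hs.bind (hr i), fun u hu => ?_⟩
  have dq : ∀ i, DefP L (univ : Set M) (fun e : ∀ i, E i => q i (e i) (D u)) := fun i =>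
    (hg i univ (subset_univ A)).comp (f := fun e : ∀ i, E i => (e, u)) (DefF.pair DefF.id (DefF.const u))
  refine hs.exFin dq ?_
  refine hs.mono ?_ (DefP.exFin dq) h1 fun e h => h.1 u hu
  exact DefP.and (hGood.mono (subset_univ A)) (DefP.const True)

end final
end OM

/-- if an `A`-definable family is covered by `n` subfamilies, each extending to
a definable type, then it can be partitioned into `n` subfamilies, each extending to an
`A`-definable type. -/
theorem statement5 (L : FirstOrder.Language) (M : Type*) [L.Structure M] [LinearOrder M]
    (hM : IsOMinimal L M) (A : Set M) (k : ℕ) (S : Set (Set (Fin k → M)))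
    (hS : IsDefFamily L A k S) (n : ℕ)
    (h : ∃ p : Fin n → Set (Set (Fin k → M)),
      (∀ i, IsTypeOn L k (p i) ∧ IsDefTypeOver L (Set.univ : Set M) k (p i)) ∧
      ∀ X ∈ S, ∃ i, X ∈ p i) :
    ∃ T : Fin n → Set (Set (Fin k → M)),
      (∀ i, T i ⊆ S) ∧ (∀ X ∈ S, ∃! i, X ∈ T i) ∧
      ∀ i, ∃ p, IsTypeOn L k p ∧ IsDefTypeOver L A k p ∧ T i ⊆ p := by
  classical
  haveI := OM.OMin.of_isOMinimal hM
  obtain ⟨i1, i2, i3, i4, -, -⟩ := hM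
  obtain ⟨m, Ω, D, hΩ, hD, rfl⟩ := hS
  obtain ⟨p, hp, hcov⟩ := h
  have hD' : OM.DefP L A (fun z : (Fin m → M) × (Fin k → M) => Sum.elim z.1 z.2 ∈ D) := by
    rw [OM.defP_pair (H := fun a b => Sum.elim a b ∈ D)]
    convert! hD using 1
    ext w
    simp
  obtain ⟨r, hr, hr'⟩ := OM.final (L := L) (A := A) (p := fun i P => {v | P v} ∈ p i)
    (fun i => OM.typeToQ (hp i).1 (hp i).2) (D := fun (u : Fin m → M) v => Sum.elim u v ∈ D) hD'
    (Ω := fun u => u ∈ Ω) (OM.defP_fun.2 hΩ) (fun u hu => hcov _ ⟨u, hu, rfl⟩)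
  have hc : ∀ X ∈ famFiber D '' Ω, ∃ i, r i PUnit.unit (fun v => v ∈ X) := by
    rintro _ ⟨u, hu, rfl⟩
    exact hr' u hu
  refine ⟨fun i => {X | X ∈ famFiber D '' Ω ∧ r i PUnit.unit (fun v => v ∈ X) ∧
    ∀ j, j < i → ¬ r j PUnit.unit (fun v => v ∈ X)}, fun i X h => h.1, fun X hX => ?_, fun i => ?_⟩
  · obtain ⟨i, hi, hmin⟩ := exists_minimal_of_wellFoundedLT (fun i => r i PUnit.unit (fun v => v ∈ X)) (hc X hX)
    refine ⟨i, ⟨hX, hi, fun j hj hrj => (hmin hrj hj.le).not_gt hj⟩, ?_⟩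
    rintro j ⟨-, hj, hjm⟩
    rcases lt_trichotomy i j with h | h | h
    · exact absurd hi (hjm i h)
    · exact h.symm
    · exact absurd h (hmin hj h.le).not_gt
  · refine ⟨_, (OM.qToType (hr i)).1, (OM.qToType (hr i)).2, ?_⟩
    rintro X ⟨hX, h1, -⟩
    obtain ⟨j, hj⟩ := hcov X hX
    exact ⟨(hp j).1.1 X hj, h1⟩
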